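/- Translating each of the two interior lattice points of each 2-point tetrahedron to the origin, the set of normalized weight vectors arising from three-dimensional lattice simplices with exactly two interior lattice points has cardinality exactly 548; that is, |W₃,₂| = 548, where W₃,₂ = {normalized weights (λ₀,λ₁,λ₂,λ₃) of S − o : S a tetrahedron in ℤ³ with exactly two interior lattice points, o one of its two interior lattice points}. -/

import Mathlib

open Set MeasureTheory

noncomputable section

/-- The canonical embedding of lattice points `ℤ^d` into `ℝ^d`. -/
def castPt {d : ℕ} (v : Fin d → ℤ) : Fin d → ℝ := fun i => (v i : ℝ)

/-- A lattice polytope: the convex hull of a nonempty finite set of lattice points. -/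
def IsLatticePolytope {d : ℕ} (P : Set (Fin d → ℝ)) : Prop :=
  ∃ V : Finset (Fin d → ℤ), V.Nonempty ∧
    P = convexHull ℝ (castPt '' (V : Set (Fin d → ℤ)))

/-- The interior lattice points of a full-dimensional polytope `P`. -/
def intLatPts {d : ℕ} (P : Set (Fin d → ℝ)) : Set (Fin d → ℤ) :=
  {x | castPt x ∈ interior P}

/-- Unimodular equivalence: an affine lattice automorphism in `GL_d(ℤ) ⋉ ℤ^d` maps `P` onto `Q`. -/
def UnimodEquiv {d : ℕ} (P Q : Set (Fin d → ℝ)) : Prop :=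
  ∃ (A : Matrix (Fin d) (Fin d) ℤ) (b : Fin d → ℤ), IsUnit A.det ∧
    (fun x : Fin d → ℝ => (A.map (Int.cast : ℤ → ℝ)).mulVec x + castPt b) '' P = Q

/-- A three-dimensional lattice polytope with exactly `k` interior lattice points. -/
def IsKPoint3Polytope (k : ℕ) (P : Set (Fin 3 → ℝ)) : Prop :=
  IsLatticePolytope P ∧ affineSpan ℝ P = ⊤ ∧ (intLatPts P).ncard = k

/-- The polytopes satisfying `Q` form exactly `n` unimodular equivalence classes: there are
`n` representatives and every polytope satisfying `Q` is equivalent to exactly one of them. -/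
def HasNClassesUpToEquiv (Q : Set (Fin 3 → ℝ) → Prop) (n : ℕ) : Prop :=
  ∃ S : Finset (Set (Fin 3 → ℝ)), S.card = n ∧ (∀ P ∈ S, Q P) ∧
    ∀ P, Q P → ∃! R, R ∈ S ∧ UnimodEquiv P R

/-- The set `W₃,₂` of normalised weight vectors of three-dimensional lattice simplices with
exactly two interior lattice points, one of which has been translated to the origin:
`lam` is a weight vector of such a tetrahedron `conv{v 0, v 1, v 2, v 3}` when the `lam i`
are positive, `∑ lam i • v i = 0`, `gcd = 1` and the `lam i` are sorted increasingly. -/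
def W32 : Set (Fin 4 → ℤ) :=
  {lam | ∃ v : Fin 4 → Fin 3 → ℤ,
    AffineIndependent ℝ (fun i => castPt (v i)) ∧
    (intLatPts (convexHull ℝ (Set.range fun i => castPt (v i)))).ncard = 2 ∧
    (0 : Fin 3 → ℤ) ∈ intLatPts (convexHull ℝ (Set.range fun i => castPt (v i))) ∧
    (∀ i, 0 < lam i) ∧ (∑ i, lam i • v i) = 0 ∧
    Finset.univ.gcd lam = 1 ∧ Monotone lam}

namespace W32Proof

/-! ### Search machinery (evaluated by the kernel) -/

/-- Evaluate a natural number to a literal before passing it on. -/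
def force {α : Type} (n : ℕ) (f : ℕ → α) : α :=
  Nat.rec (motive := fun _ => α) (f 0) (fun m _ => f (Nat.succ m)) n

/-- Pass on the smaller of the fractions `n / d` and `a / k`. -/
def minF {α : Type} (n d a k : ℕ) (f : ℕ → ℕ → α) : α :=
  cond (Nat.ble (Nat.mul n k) (Nat.mul a d)) (f n d) (f a k)

/-- Binary search trees holding pairs (key, tag). -/
inductive BT : Type
  | e : BT
  | n : ℕ → ℕ → BT → BT → BT

def BT.mem (t : BT) : ℕ → Bool :=
  BT.rec (motive := fun _ => ℕ → Bool) (fun _ => false)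
    (fun key _ _ _ ihl ihr x =>
      cond (Nat.beq x key) true (cond (Nat.ble x key) (ihl x) (ihr x))) t

def BT.toList : BT → List (ℕ × ℕ)
  | .e => []
  | .n k t l r => l.toList ++ (k, t) :: r.toList

/-- A region of the simplex: upper bounds `n i / d i`, lower bounds `e i / k`. -/
structure St : Type where
  n0 : ℕ
  d0 : ℕ
  n1 : ℕ
  d1 : ℕ
  n2 : ℕ
  d2 : ℕ
  n3 : ℕ
  d3 : ℕ
  k : ℕ
  e0 : ℕ
  e1 : ℕ
  e2 : ℕ
  e3 : ℕ
  deriving DecidableEq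

/-- Is the point `x / (x0 + x1 + x2 + x3)` in the table? -/
def memPt (t : BT) (x0 x1 x2 x3 : ℕ) : Bool :=
  force (Nat.gcd (Nat.gcd x0 x1) (Nat.gcd x2 x3)) fun g =>
  force (Nat.div x0 g) fun y0 => force (Nat.div x1 g) fun y1 =>
  force (Nat.div x2 g) fun y2 => force (Nat.div x3 g) fun y3 =>
  cond (Nat.ble y1 127) (cond (Nat.ble y2 127) (cond (Nat.ble y3 127)
    (force (Nat.add (Nat.mul (Nat.add (Nat.mul (Nat.add (Nat.mul y0 128) y1) 128) y2) 128) y3)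
      fun key => t.mem key) false) false) false

def closedN (t : BT) (n0 d0 n1 d1 n2 d2 n3 d3 k e0 e1 e2 e3 : ℕ) : Bool :=
  cond (Nat.ble (Nat.mul n0 k) (Nat.mul e0 d0)) true <|
  cond (Nat.ble (Nat.mul n1 k) (Nat.mul e1 d1)) true <|
  cond (Nat.ble (Nat.mul n2 k) (Nat.mul e2 d2)) true <|
  cond (Nat.ble (Nat.mul n3 k) (Nat.mul e3 d3)) true <|
  force (Nat.mul d0 d1) fun p => force (Nat.mul d2 d3) fun q =>
  force (Nat.add (Nat.mul (Nat.add (Nat.mul n0 d1) (Nat.mul n1 d0)) q)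
    (Nat.mul (Nat.add (Nat.mul n2 d3) (Nat.mul n3 d2)) p)) fun s =>
  force (Nat.mul p q) fun r =>
  cond (Nat.ble s r)
    (cond (Nat.beq s r)
      (memPt t (Nat.mul (Nat.mul n0 d1) q) (Nat.mul (Nat.mul n1 d0) q)
        (Nat.mul (Nat.mul n2 d3) p) (Nat.mul (Nat.mul n3 d2) p)) true) false

def push (t : BT) (n0 d0 n1 d1 n2 d2 n3 d3 k e0 e1 e2 e3 : ℕ) (rest : List St) : List St :=
  cond (closedN t n0 d0 n1 d1 n2 d2 n3 d3 k e0 e1 e2 e3) rest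
    (St.mk n0 d0 n1 d1 n2 d2 n3 d3 k e0 e1 e2 e3 :: rest)

/-- Push the region with new upper bounds `xi / yi`. -/
def pushMin (t : BT) (n0 d0 n1 d1 n2 d2 n3 d3 k e0 e1 e2 e3 : ℕ)
    (x0 x1 x2 x3 y : ℕ) (rest : List St) : List St :=
  force y fun y =>
  force x0 fun x0 => minF n0 d0 x0 y fun n0 d0 =>
  force x1 fun x1 => minF n1 d1 x1 y fun n1 d1 =>
  force x2 fun x2 => minF n2 d2 x2 y fun n2 d2 =>
  force x3 fun x3 => minF n3 d3 x3 y fun n3 d3 =>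
  push t n0 d0 n1 d1 n2 d2 n3 d3 k e0 e1 e2 e3 rest

def child0 (t : BT) (n0 d0 n1 d1 n2 d2 n3 d3 k1 e0 e1 e2 e3 : ℕ) (k a : ℕ) (rest : List St) : List St :=
  minF n0 d0 a k fun n0 d0 => push t n0 d0 n1 d1 n2 d2 n3 d3 k1 e0 e1 e2 e3 rest

def child1 (t : BT) (n0 d0 n1 d1 n2 d2 n3 d3 k1 e0 e1 e2 e3 : ℕ) (k a : ℕ) (rest : List St) : List St :=
  minF n0 d0 a k fun n0 d0 => minF n1 d1 a k fun n1 d1 =>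
  push t n0 d0 n1 d1 n2 d2 n3 d3 k1 e0 e1 e2 e3 rest

def child2 (t : BT) (n0 d0 n1 d1 n2 d2 n3 d3 k1 e0 e1 e2 e3 : ℕ) (k a : ℕ) (rest : List St) : List St :=
  minF n0 d0 a k fun n0 d0 => minF n1 d1 a k fun n1 d1 => minF n2 d2 a k fun n2 d2 =>
  push t n0 d0 n1 d1 n2 d2 n3 d3 k1 e0 e1 e2 e3 rest

def child3 (t : BT) (n0 d0 n1 d1 n2 d2 n3 d3 k1 e0 e1 e2 e3 : ℕ) (k a : ℕ) (rest : List St) : List St :=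
  minF n0 d0 a k fun n0 d0 => minF n1 d1 a k fun n1 d1 => minF n2 d2 a k fun n2 d2 =>
  minF n3 d3 a k fun n3 d3 => push t n0 d0 n1 d1 n2 d2 n3 d3 k1 e0 e1 e2 e3 rest

/-- The region in which `k b - a` is a second interior point. -/
def child5 (t : BT) (n0 d0 n1 d1 n2 d2 n3 d3 k1 e0 e1 e2 e3 : ℕ) (k a0 a1 a2 a3 : ℕ)
    (rest : List St) : List St :=
  cond (Nat.beq k1 1)
    (force (Nat.succ a0) fun x0 => force (Nat.succ a1) fun x1 =>
      force (Nat.succ a2) fun x2 => force (Nat.succ a3) fun x3 =>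
      minF n3 d3 x3 k fun n3 d3 =>
      minF n2 d2 x2 k fun n2 d2 => minF n2 d2 n3 d3 fun n2 d2 =>
      minF n1 d1 x1 k fun n1 d1 => minF n1 d1 n2 d2 fun n1 d1 =>
      minF n0 d0 x0 k fun n0 d0 => minF n0 d0 n1 d1 fun n0 d0 =>
      push t n0 d0 n1 d1 n2 d2 n3 d3 k a0 a1 a2 a3 rest)
    (cond (Nat.ble k k1)
      (pushMin t n0 d0 n1 d1 n2 d2 n3 d3 k1 e0 e1 e2 e3
        (Nat.sub e0 a0) (Nat.sub e1 a1) (Nat.sub e2 a2) (Nat.sub e3 a3) (Nat.sub k1 k) rest)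
      (pushMin t n0 d0 n1 d1 n2 d2 n3 d3 k1 e0 e1 e2 e3
        (Nat.sub a0 e0) (Nat.sub a1 e1) (Nat.sub a2 e2) (Nat.sub a3 e3) (Nat.sub k k1) rest))

def stepN (t : BT) (n0 d0 n1 d1 n2 d2 n3 d3 k1 e0 e1 e2 e3 : ℕ) (k a0 a1 a2 a3 : ℕ)
    (rest : List St) : List St :=
  child0 t n0 d0 n1 d1 n2 d2 n3 d3 k1 e0 e1 e2 e3 k a0 <|
  child1 t n0 d0 n1 d1 n2 d2 n3 d3 k1 e0 e1 e2 e3 k a1 <|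
  child2 t n0 d0 n1 d1 n2 d2 n3 d3 k1 e0 e1 e2 e3 k a2 <|
  child3 t n0 d0 n1 d1 n2 d2 n3 d3 k1 e0 e1 e2 e3 k a3 <|
  pushMin t n0 d0 n1 d1 n2 d2 n3 d3 k1 e0 e1 e2 e3 a0 a1 a2 a3 (Nat.sub k 1) <|
  child5 t n0 d0 n1 d1 n2 d2 n3 d3 k1 e0 e1 e2 e3 k a0 a1 a2 a3 rest

/-- Treat the first region of the stack with the hint `h = k a0 a1 a2` (two digits each). -/
def step (t : BT) (h : ℕ) (st : St) (rest : List St) : List St :=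
  St.rec (motive := fun _ => List St) (fun n0 d0 n1 d1 n2 d2 n3 d3 k1 e0 e1 e2 e3 =>
    force (Nat.div h 1000000) fun k =>
    force (Nat.mod (Nat.div h 10000) 100) fun a0 =>
    force (Nat.mod (Nat.div h 100) 100) fun a1 =>
    force (Nat.mod h 100) fun a2 =>
    force (Nat.sub k (Nat.succ (Nat.add (Nat.add a0 a1) a2))) fun a3 =>
    cond (Nat.beq (Nat.succ (Nat.add (Nat.add (Nat.add a0 a1) a2) a3)) k)
      (cond (Nat.ble 2 k)
        (cond (Nat.beq k k1) (st :: rest)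
          (stepN t n0 d0 n1 d1 n2 d2 n3 d3 k1 e0 e1 e2 e3 k a0 a1 a2 a3 rest))
        (st :: rest)) (st :: rest)) st

def run (t : BT) (hs : List ℕ) : List St → List St :=
  List.rec (motive := fun _ => List St → List St) (fun s => s)
    (fun h _ ih s => List.rec (motive := fun _ => List St) [] (fun st rest _ => ih (step t h st rest)) s)
    hs


/-! ### Soundness of the search -/

theorem force_eq {α : Type} (n : ℕ) (f : ℕ → α) : force n f = f n := by
  cases n <;> rfl

theorem minF_elim {α : Type} {P : α → Prop} {n d a k : ℕ} {f : ℕ → ℕ → α}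
    (h : P (minF n d a k f)) :
    ∃ n' d' : ℕ, (0 < d → 0 < k → 0 < d') ∧
      (∀ x : ℝ, x * d ≤ n → x * k ≤ a → x * d' ≤ n') ∧ P (f n' d') := by
  unfold minF at h
  cases hb : Nat.ble (Nat.mul n k) (Nat.mul a d) with
  | true =>
    rw [hb] at h
    exact ⟨n, d, fun h _ => h, fun x h _ => h, h⟩
  | false =>
    rw [hb] at h
    exact ⟨a, k, fun _ h => h, fun x _ h => h, h⟩

/-- Decoding of keys. -/
def q0 (x : ℕ) : ℕ := x / 2097152
def q1 (x : ℕ) : ℕ := x / 16384 % 128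
def q2 (x : ℕ) : ℕ := x / 128 % 128
def q3 (x : ℕ) : ℕ := x % 128

theorem BT.mem_sound (t : BT) (x : ℕ) (h : t.mem x = true) : ∃ p ∈ t.toList, p.1 = x := by
  induction t with
  | e => simp [BT.mem] at h
  | n key tag l r ihl ihr =>
    have h' : cond (Nat.beq x key) true (cond (Nat.ble x key) (l.mem x) (r.mem x)) = true := h
    cases h1 : Nat.beq x key with
    | true =>
      have := Nat.eq_of_beq_eq_true h1
      exact ⟨(key, tag), by simp [BT.toList], this.symm⟩
    | false =>
      rw [h1] at h'
      cases h2 : Nat.ble x key with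
      | true =>
        rw [h2] at h'
        obtain ⟨p, hp, e⟩ := ihl h'
        exact ⟨p, by simp [BT.toList, hp], e⟩
      | false =>
        rw [h2] at h'
        obtain ⟨p, hp, e⟩ := ihr h'
        exact ⟨p, by simp [BT.toList, hp], e⟩

/-- The point `b` is in the table. -/
def InT (t : BT) (b0 b1 b2 b3 : ℝ) : Prop :=
  ∃ p ∈ t.toList, ∃ g : ℝ, b0 * g = q0 p.1 ∧ b1 * g = q1 p.1 ∧ b2 * g = q2 p.1 ∧ b3 * g = q3 p.1

theorem memPt_sound (t : BT) (x0 x1 x2 x3 : ℕ) (h : memPt t x0 x1 x2 x3 = true) (hx : 0 < x0)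
    (b0 b1 b2 b3 r : ℝ) (h0 : b0 * r = x0) (h1 : b1 * r = x1) (h2 : b2 * r = x2)
    (h3 : b3 * r = x3) : InT t b0 b1 b2 b3 := by
  simp only [memPt, force_eq] at h
  set g := Nat.gcd (Nat.gcd x0 x1) (Nat.gcd x2 x3) with hg
  have d0 : g ∣ x0 := (Nat.gcd_dvd_left _ _).trans (Nat.gcd_dvd_left _ _)
  have d1 : g ∣ x1 := (Nat.gcd_dvd_left _ _).trans (Nat.gcd_dvd_right _ _)
  have d2 : g ∣ x2 := (Nat.gcd_dvd_right _ _).trans (Nat.gcd_dvd_left _ _)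
  have d3 : g ∣ x3 := (Nat.gcd_dvd_right _ _).trans (Nat.gcd_dvd_right _ _)
  have gp : 0 < g := Nat.pos_of_dvd_of_pos d0 hx
  clear_value g
  obtain ⟨y0, rfl⟩ := d0
  obtain ⟨y1, rfl⟩ := d1
  obtain ⟨y2, rfl⟩ := d2
  obtain ⟨y3, rfl⟩ := d3
  have e (y : ℕ) : Nat.div (g * y) g = y := Nat.mul_div_cancel_left y gp
  simp only [e] at h
  cases c1 : Nat.ble y1 127 with
  | false => simp [c1] at h
  | true =>
  cases c2 : Nat.ble y2 127 with
  | false => simp [c1, c2] at h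
  | true =>
  cases c3 : Nat.ble y3 127 with
  | false => simp [c1, c2, c3] at h
  | true =>
  rw [c1, c2, c3] at h
  have c1 := Nat.le_of_ble_eq_true c1
  have c2 := Nat.le_of_ble_eq_true c2
  have c3 := Nat.le_of_ble_eq_true c3
  obtain ⟨p, hp, e⟩ := BT.mem_sound t _ h
  have e' : p.1 = ((y0 * 128 + y1) * 128 + y2) * 128 + y3 := e
  have gp' : (g : ℝ) ≠ 0 := by positivity
  refine ⟨p, hp, r / g, ?_, ?_, ?_, ?_⟩
  · have : q0 p.1 = y0 := by unfold q0; omega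
    rw [this, ← mul_div_assoc, h0]; push_cast; field_simp
  · have : q1 p.1 = y1 := by unfold q1; omega
    rw [this, ← mul_div_assoc, h1]; push_cast; field_simp
  · have : q2 p.1 = y2 := by unfold q2; omega
    rw [this, ← mul_div_assoc, h2]; push_cast; field_simp
  · have : q3 p.1 = y3 := by unfold q3; omega
    rw [this, ← mul_div_assoc, h3]; push_cast; field_simp

/-- `k b - a` is a point of the open simplex. -/
structure Kill (b0 b1 b2 b3 : ℝ) (k a0 a1 a2 a3 : ℕ) : Prop where
  sum : a0 + a1 + a2 + a3 + 1 = k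
  l0 : (a0 : ℝ) < k * b0
  l1 : (a1 : ℝ) < k * b1
  l2 : (a2 : ℝ) < k * b2
  l3 : (a3 : ℝ) < k * b3

/-- `k b - a = b`. -/
def Eqb (b0 b1 b2 b3 : ℝ) (k a0 a1 a2 a3 : ℕ) : Prop :=
  k * b0 - a0 = b0 ∧ k * b1 - a1 = b1 ∧ k * b2 - a2 = b2 ∧ k * b3 - a3 = b3

/-- `k b - a = k' b - a'`. -/
def Eqq (b0 b1 b2 b3 : ℝ) (k a0 a1 a2 a3 k' a0' a1' a2' a3' : ℕ) : Prop :=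
  k * b0 - a0 = k' * b0 - a0' ∧ k * b1 - a1 = k' * b1 - a1' ∧
  k * b2 - a2 = k' * b2 - a2' ∧ k * b3 - a3 = k' * b3 - a3'

structure Hyp (b0 b1 b2 b3 : ℝ) : Prop where
  m01 : b0 ≤ b1
  m12 : b1 ≤ b2
  m23 : b2 ≤ b3
  sum : b0 + b1 + b2 + b3 = 1
  pos : 0 < b0
  two : ∀ k a0 a1 a2 a3 k' a0' a1' a2' a3' : ℕ, Kill b0 b1 b2 b3 k a0 a1 a2 a3 →
    Kill b0 b1 b2 b3 k' a0' a1' a2' a3' →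
    Eqb b0 b1 b2 b3 k a0 a1 a2 a3 ∨ Eqb b0 b1 b2 b3 k' a0' a1' a2' a3' ∨
    Eqq b0 b1 b2 b3 k a0 a1 a2 a3 k' a0' a1' a2' a3'

structure InReg (b0 b1 b2 b3 : ℝ) (n0 d0 n1 d1 n2 d2 n3 d3 k e0 e1 e2 e3 : ℕ) : Prop where
  p0 : 0 < d0
  p1 : 0 < d1
  p2 : 0 < d2
  p3 : 0 < d3
  u0 : b0 * d0 ≤ n0
  u1 : b1 * d1 ≤ n1
  u2 : b2 * d2 ≤ n2
  u3 : b3 * d3 ≤ n3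
  kill : Kill b0 b1 b2 b3 k e0 e1 e2 e3
  ne : k = 1 ∨ ¬ Eqb b0 b1 b2 b3 k e0 e1 e2 e3

def SoundN (t : BT) (n0 d0 n1 d1 n2 d2 n3 d3 k e0 e1 e2 e3 : ℕ) : Prop :=
  ∀ b0 b1 b2 b3 : ℝ, Hyp b0 b1 b2 b3 →
    InReg b0 b1 b2 b3 n0 d0 n1 d1 n2 d2 n3 d3 k e0 e1 e2 e3 → InT t b0 b1 b2 b3

def Sound (t : BT) (s : St) : Prop :=
  SoundN t s.n0 s.d0 s.n1 s.d1 s.n2 s.d2 s.n3 s.d3 s.k s.e0 s.e1 s.e2 s.e3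

def AllGood (t : BT) (l : List St) : Prop := ∀ s ∈ l, Sound t s

theorem low_aux {n d k e : ℕ} {b : ℝ} (h : Nat.ble (Nat.mul n k) (Nat.mul e d) = true)
    (hd : 0 < d) (hu : b * d ≤ n) (hl : (e : ℝ) < k * b) : False := by
  have h1 : n * k ≤ e * d := Nat.le_of_ble_eq_true h
  have h2 : (n : ℝ) * k ≤ e * d := by exact_mod_cast h1
  have hd' : (0 : ℝ) < d := by exact_mod_cast hd
  have h3 : (e : ℝ) * d < k * b * d := by gcongr
  have h4 : (k : ℝ) * (b * d) ≤ k * n := by gcongr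
  nlinarith

theorem closedN_sound (t : BT) (n0 d0 n1 d1 n2 d2 n3 d3 k e0 e1 e2 e3 : ℕ)
    (h : closedN t n0 d0 n1 d1 n2 d2 n3 d3 k e0 e1 e2 e3 = true) :
    SoundN t n0 d0 n1 d1 n2 d2 n3 d3 k e0 e1 e2 e3 := by
  intro b0 b1 b2 b3 H R
  simp only [closedN, force_eq] at h
  cases c0 : Nat.ble (Nat.mul n0 k) (Nat.mul e0 d0) with
  | true => exact (low_aux c0 R.p0 R.u0 R.kill.l0).elim
  | false =>
  cases c1 : Nat.ble (Nat.mul n1 k) (Nat.mul e1 d1) with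
  | true => exact (low_aux c1 R.p1 R.u1 R.kill.l1).elim
  | false =>
  cases c2 : Nat.ble (Nat.mul n2 k) (Nat.mul e2 d2) with
  | true => exact (low_aux c2 R.p2 R.u2 R.kill.l2).elim
  | false =>
  cases c3 : Nat.ble (Nat.mul n3 k) (Nat.mul e3 d3) with
  | true => exact (low_aux c3 R.p3 R.u3 R.kill.l3).elim
  | false =>
  rw [c0, c1, c2, c3] at h
  simp only [cond_false] at h
  have p0 : (0 : ℝ) < d0 := by exact_mod_cast R.p0
  have p1 : (0 : ℝ) < d1 := by exact_mod_cast R.p1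
  have p2 : (0 : ℝ) < d2 := by exact_mod_cast R.p2
  have p3 : (0 : ℝ) < d3 := by exact_mod_cast R.p3
  have v0 : b0 * d0 * (d1 * (d2 * d3)) ≤ n0 * (d1 * (d2 * d3)) := by gcongr; exact R.u0
  have v1 : b1 * d1 * (d0 * (d2 * d3)) ≤ n1 * (d0 * (d2 * d3)) := by gcongr; exact R.u1
  have v2 : b2 * d2 * (d3 * (d0 * d1)) ≤ n2 * (d3 * (d0 * d1)) := by gcongr; exact R.u2
  have v3 : b3 * d3 * (d2 * (d0 * d1)) ≤ n3 * (d2 * (d0 * d1)) := by gcongr; exact R.u3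
  have hs : b0 * d0 * (d1 * (d2 * d3)) + b1 * d1 * (d0 * (d2 * d3)) + b2 * d2 * (d3 * (d0 * d1))
      + b3 * d3 * (d2 * (d0 * d1)) = d0 * d1 * (d2 * d3) := by
    have := H.sum
    linear_combination (d0 * d1 * (d2 * d3) : ℝ) * this
  cases c4 : Nat.ble (Nat.add (Nat.mul (Nat.add (Nat.mul n0 d1) (Nat.mul n1 d0)) (Nat.mul d2 d3))
    (Nat.mul (Nat.add (Nat.mul n2 d3) (Nat.mul n3 d2)) (Nat.mul d0 d1)))
      (Nat.mul (Nat.mul d0 d1) (Nat.mul d2 d3)) with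
  | false => rw [c4] at h; simp at h
  | true =>
  rw [c4] at h
  have c4' : (n0 * d1 + n1 * d0) * (d2 * d3) + (n2 * d3 + n3 * d2) * (d0 * d1)
    ≤ (d0 * d1) * (d2 * d3) := Nat.le_of_ble_eq_true c4
  have c4r : ((n0 : ℝ) * d1 + n1 * d0) * (d2 * d3) + (n2 * d3 + n3 * d2) * (d0 * d1)
    ≤ (d0 * d1) * (d2 * d3) := by exact_mod_cast c4'
  have w0 : b0 * d0 * (d1 * (d2 * d3)) = n0 * (d1 * (d2 * d3)) := by nlinarith
  have w1 : b1 * d1 * (d0 * (d2 * d3)) = n1 * (d0 * (d2 * d3)) := by nlinarith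
  have w2 : b2 * d2 * (d3 * (d0 * d1)) = n2 * (d3 * (d0 * d1)) := by nlinarith
  have w3 : b3 * d3 * (d2 * (d0 * d1)) = n3 * (d2 * (d0 * d1)) := by nlinarith
  cases c5 : Nat.beq (Nat.add (Nat.mul (Nat.add (Nat.mul n0 d1) (Nat.mul n1 d0)) (Nat.mul d2 d3))
    (Nat.mul (Nat.add (Nat.mul n2 d3) (Nat.mul n3 d2)) (Nat.mul d0 d1)))
      (Nat.mul (Nat.mul d0 d1) (Nat.mul d2 d3)) with
  | false =>
    have c5' : (n0 * d1 + n1 * d0) * (d2 * d3) + (n2 * d3 + n3 * d2) * (d0 * d1)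
      ≠ (d0 * d1) * (d2 * d3) := Nat.ne_of_beq_eq_false c5
    exfalso
    apply c5'
    have : ((n0 : ℝ) * d1 + n1 * d0) * (d2 * d3) + (n2 * d3 + n3 * d2) * (d0 * d1)
      = (d0 * d1) * (d2 * d3) := by linarith
    exact_mod_cast this
  | true =>
  rw [c5] at h
  have nn0 : 0 < n0 := by
    rcases Nat.eq_zero_or_pos n0 with h0 | h0
    · exfalso
      have := R.u0
      rw [h0] at this
      have := mul_pos H.pos p0
      push_cast at *
      linarith
    · exact h0
  refine memPt_sound t _ _ _ _ h ?_ b0 b1 b2 b3 ((d0 * d1) * (d2 * d3)) ?_ ?_ ?_ ?_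
  · exact Nat.mul_pos (Nat.mul_pos nn0 R.p1) (Nat.mul_pos R.p2 R.p3)
  · change _ = (((n0 * d1) * (d2 * d3) : ℕ) : ℝ)
    push_cast; linarith
  · change _ = (((n1 * d0) * (d2 * d3) : ℕ) : ℝ)
    push_cast; linarith
  · change _ = (((n2 * d3) * (d0 * d1) : ℕ) : ℝ)
    push_cast; linarith
  · change _ = (((n3 * d2) * (d0 * d1) : ℕ) : ℝ)
    push_cast; linarith

theorem push_sound {t : BT} {n0 d0 n1 d1 n2 d2 n3 d3 k e0 e1 e2 e3 : ℕ} {rest : List St}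
    (h : AllGood t (push t n0 d0 n1 d1 n2 d2 n3 d3 k e0 e1 e2 e3 rest)) :
    SoundN t n0 d0 n1 d1 n2 d2 n3 d3 k e0 e1 e2 e3 ∧ AllGood t rest := by
  unfold push at h
  cases c : closedN t n0 d0 n1 d1 n2 d2 n3 d3 k e0 e1 e2 e3 with
  | true => rw [c] at h; exact ⟨closedN_sound _ _ _ _ _ _ _ _ _ _ _ _ _ _ c, h⟩
  | false =>
    rw [c] at h
    exact ⟨h _ List.mem_cons_self, fun s hs => h s (List.mem_cons_of_mem _ hs)⟩

theorem pushMin_sound {t : BT} {n0 d0 n1 d1 n2 d2 n3 d3 k e0 e1 e2 e3 x0 x1 x2 x3 y : ℕ}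
    {rest : List St}
    (h : AllGood t (pushMin t n0 d0 n1 d1 n2 d2 n3 d3 k e0 e1 e2 e3 x0 x1 x2 x3 y rest)) :
    (∀ b0 b1 b2 b3 : ℝ, Hyp b0 b1 b2 b3 →
      InReg b0 b1 b2 b3 n0 d0 n1 d1 n2 d2 n3 d3 k e0 e1 e2 e3 → 0 < y →
      b0 * y ≤ x0 → b1 * y ≤ x1 → b2 * y ≤ x2 → b3 * y ≤ x3 → InT t b0 b1 b2 b3) ∧
    AllGood t rest := by
  simp only [pushMin, force_eq] at h
  obtain ⟨n0', d0', p0, u0, h⟩ := minF_elim h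
  obtain ⟨n1', d1', p1, u1, h⟩ := minF_elim h
  obtain ⟨n2', d2', p2, u2, h⟩ := minF_elim h
  obtain ⟨n3', d3', p3, u3, h⟩ := minF_elim h
  obtain ⟨h1, h2⟩ := push_sound h
  refine ⟨fun b0 b1 b2 b3 H R hy z0 z1 z2 z3 => h1 b0 b1 b2 b3 H ?_, h2⟩
  exact ⟨p0 R.p0 hy, p1 R.p1 hy, p2 R.p2 hy, p3 R.p3 hy, u0 _ R.u0 z0, u1 _ R.u1 z1,
    u2 _ R.u2 z2, u3 _ R.u3 z3, R.kill, R.ne⟩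

theorem sub_aux {b : ℝ} {k a k' a' : ℕ} (hk : k ≤ k') (h : (k : ℝ) * b - a = k' * b - a') :
    b * (Nat.sub k' k : ℕ) ≤ (Nat.sub a' a : ℕ) := by
  change b * ((k' - k : ℕ) : ℝ) ≤ ((a' - a : ℕ) : ℝ)
  rw [Nat.cast_sub hk]
  have : (a' : ℝ) ≤ ((a' - a : ℕ) : ℝ) + a := by exact_mod_cast (by omega : a' ≤ a' - a + a)
  linarith

theorem mono_aux {x y a : ℝ} {k : ℕ} (hxy : x ≤ y) (h : (k : ℝ) * y ≤ a) : x * k ≤ a := by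
  have : x * k ≤ y * k := by gcongr
  linarith

theorem mono_aux2 {x y : ℝ} {n d : ℕ} (hxy : x ≤ y) (h : y * d ≤ n) : x * d ≤ n := by
  refine le_trans ?_ h
  gcongr

theorem child0_sound {t : BT} {n0 d0 n1 d1 n2 d2 n3 d3 k1 e0 e1 e2 e3 k a : ℕ}
    {rest : List St} (kp : 0 < k)
    (h : AllGood t (child0 t n0 d0 n1 d1 n2 d2 n3 d3 k1 e0 e1 e2 e3 k a rest)) :
    (∀ b0 b1 b2 b3 : ℝ, Hyp b0 b1 b2 b3 →
      InReg b0 b1 b2 b3 n0 d0 n1 d1 n2 d2 n3 d3 k1 e0 e1 e2 e3 → (k : ℝ) * b0 ≤ a →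
      InT t b0 b1 b2 b3) ∧ AllGood t rest := by
  unfold child0 at h
  obtain ⟨n0', d0', p0, u0, h⟩ := minF_elim h
  obtain ⟨C, h⟩ := push_sound h
  refine ⟨fun b0 b1 b2 b3 H R l => C _ _ _ _ H ?_, h⟩
  exact ⟨p0 R.p0 kp, R.p1, R.p2, R.p3,
    u0 _ R.u0 (mono_aux le_rfl l), R.u1, R.u2, R.u3,
    R.kill, R.ne⟩

theorem child1_sound {t : BT} {n0 d0 n1 d1 n2 d2 n3 d3 k1 e0 e1 e2 e3 k a : ℕ}
    {rest : List St} (kp : 0 < k)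
    (h : AllGood t (child1 t n0 d0 n1 d1 n2 d2 n3 d3 k1 e0 e1 e2 e3 k a rest)) :
    (∀ b0 b1 b2 b3 : ℝ, Hyp b0 b1 b2 b3 →
      InReg b0 b1 b2 b3 n0 d0 n1 d1 n2 d2 n3 d3 k1 e0 e1 e2 e3 → (k : ℝ) * b1 ≤ a →
      InT t b0 b1 b2 b3) ∧ AllGood t rest := by
  unfold child1 at h
  obtain ⟨n0', d0', p0, u0, h⟩ := minF_elim h
  obtain ⟨n1', d1', p1, u1, h⟩ := minF_elim h
  obtain ⟨C, h⟩ := push_sound h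
  refine ⟨fun b0 b1 b2 b3 H R l => C _ _ _ _ H ?_, h⟩
  exact ⟨p0 R.p0 kp, p1 R.p1 kp, R.p2, R.p3,
    u0 _ R.u0 (mono_aux H.m01 l), u1 _ R.u1 (mono_aux le_rfl l), R.u2, R.u3,
    R.kill, R.ne⟩

theorem child2_sound {t : BT} {n0 d0 n1 d1 n2 d2 n3 d3 k1 e0 e1 e2 e3 k a : ℕ}
    {rest : List St} (kp : 0 < k)
    (h : AllGood t (child2 t n0 d0 n1 d1 n2 d2 n3 d3 k1 e0 e1 e2 e3 k a rest)) :
    (∀ b0 b1 b2 b3 : ℝ, Hyp b0 b1 b2 b3 →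
      InReg b0 b1 b2 b3 n0 d0 n1 d1 n2 d2 n3 d3 k1 e0 e1 e2 e3 → (k : ℝ) * b2 ≤ a →
      InT t b0 b1 b2 b3) ∧ AllGood t rest := by
  unfold child2 at h
  obtain ⟨n0', d0', p0, u0, h⟩ := minF_elim h
  obtain ⟨n1', d1', p1, u1, h⟩ := minF_elim h
  obtain ⟨n2', d2', p2, u2, h⟩ := minF_elim h
  obtain ⟨C, h⟩ := push_sound h
  refine ⟨fun b0 b1 b2 b3 H R l => C _ _ _ _ H ?_, h⟩
  exact ⟨p0 R.p0 kp, p1 R.p1 kp, p2 R.p2 kp, R.p3,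
    u0 _ R.u0 (mono_aux (H.m01.trans H.m12) l), u1 _ R.u1 (mono_aux H.m12 l), u2 _ R.u2 (mono_aux le_rfl l), R.u3,
    R.kill, R.ne⟩

theorem child3_sound {t : BT} {n0 d0 n1 d1 n2 d2 n3 d3 k1 e0 e1 e2 e3 k a : ℕ}
    {rest : List St} (kp : 0 < k)
    (h : AllGood t (child3 t n0 d0 n1 d1 n2 d2 n3 d3 k1 e0 e1 e2 e3 k a rest)) :
    (∀ b0 b1 b2 b3 : ℝ, Hyp b0 b1 b2 b3 →
      InReg b0 b1 b2 b3 n0 d0 n1 d1 n2 d2 n3 d3 k1 e0 e1 e2 e3 → (k : ℝ) * b3 ≤ a →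
      InT t b0 b1 b2 b3) ∧ AllGood t rest := by
  unfold child3 at h
  obtain ⟨n0', d0', p0, u0, h⟩ := minF_elim h
  obtain ⟨n1', d1', p1, u1, h⟩ := minF_elim h
  obtain ⟨n2', d2', p2, u2, h⟩ := minF_elim h
  obtain ⟨n3', d3', p3, u3, h⟩ := minF_elim h
  obtain ⟨C, h⟩ := push_sound h
  refine ⟨fun b0 b1 b2 b3 H R l => C _ _ _ _ H ?_, h⟩
  exact ⟨p0 R.p0 kp, p1 R.p1 kp, p2 R.p2 kp, p3 R.p3 kp,
    u0 _ R.u0 (mono_aux ((H.m01.trans H.m12).trans H.m23) l), u1 _ R.u1 (mono_aux (H.m12.trans H.m23) l), u2 _ R.u2 (mono_aux H.m23 l), u3 _ R.u3 (mono_aux le_rfl l),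
    R.kill, R.ne⟩

theorem child5_sound {t : BT} {n0 d0 n1 d1 n2 d2 n3 d3 k1 e0 e1 e2 e3 k a0 a1 a2 a3 : ℕ}
    {rest : List St} (kp : 0 < k) (hne : k ≠ k1) (ha : a0 + a1 + a2 + a3 + 1 = k)
    (h : AllGood t (child5 t n0 d0 n1 d1 n2 d2 n3 d3 k1 e0 e1 e2 e3 k a0 a1 a2 a3 rest)) :
    (∀ b0 b1 b2 b3 : ℝ, Hyp b0 b1 b2 b3 →
      InReg b0 b1 b2 b3 n0 d0 n1 d1 n2 d2 n3 d3 k1 e0 e1 e2 e3 →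
      Kill b0 b1 b2 b3 k a0 a1 a2 a3 → ¬ Eqb b0 b1 b2 b3 k a0 a1 a2 a3 →
      InT t b0 b1 b2 b3) ∧ AllGood t rest := by
  unfold child5 at h
  cases c : Nat.beq k1 1 with
  | true =>
    rw [c] at h
    simp only [cond_true, force_eq] at h
    obtain ⟨n43, d43, p43, u43, h⟩ := minF_elim h
    obtain ⟨n42, d42, p42, u42, h⟩ := minF_elim h
    obtain ⟨n42', d42', p42', u42', h⟩ := minF_elim h
    obtain ⟨n41, d41, p41, u41, h⟩ := minF_elim h
    obtain ⟨n41', d41', p41', u41', h⟩ := minF_elim h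
    obtain ⟨n40, d40, p40, u40, h⟩ := minF_elim h
    obtain ⟨n40', d40', p40', u40', h⟩ := minF_elim h
    obtain ⟨C5, h⟩ := push_sound h
    refine ⟨fun b0 b1 b2 b3 H R K N => C5 b0 b1 b2 b3 H ?_, h⟩
    have hs : (a0 : ℝ) + a1 + a2 + a3 + 1 = k := by exact_mod_cast ha
    have hb : (k : ℝ) * b0 + k * b1 + k * b2 + k * b3 = k := by
      linear_combination (k : ℝ) * H.sum
    have K0 := K.l0
    have K1 := K.l1
    have K2 := K.l2
    have K3 := K.l3
    have z0 : b0 * k ≤ (Nat.succ a0 : ℕ) := by push_cast; linarith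
    have z1 : b1 * k ≤ (Nat.succ a1 : ℕ) := by push_cast; linarith
    have z2 : b2 * k ≤ (Nat.succ a2 : ℕ) := by push_cast; linarith
    have z3 : b3 * k ≤ (Nat.succ a3 : ℕ) := by push_cast; linarith
    have P3 := p43 R.p3 kp
    have U3 := u43 _ R.u3 z3
    have P2 := p42' (p42 R.p2 kp) P3
    have U2 := u42' _ (u42 _ R.u2 z2) (mono_aux2 H.m23 U3)
    have P1 := p41' (p41 R.p1 kp) P2
    have U1 := u41' _ (u41 _ R.u1 z1) (mono_aux2 H.m12 U2)
    have P0 := p40' (p40 R.p0 kp) P1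
    have U0 := u40' _ (u40 _ R.u0 z0) (mono_aux2 H.m01 U1)
    exact ⟨P0, P1, P2, P3, U0, U1, U2, U3, K, Or.inr N⟩
  | false =>
    rw [c] at h
    simp only [cond_false] at h
    have hk1 : k1 ≠ 1 := Nat.ne_of_beq_eq_false c
    have eqq (b0 b1 b2 b3 : ℝ) (H : Hyp b0 b1 b2 b3)
        (R : InReg b0 b1 b2 b3 n0 d0 n1 d1 n2 d2 n3 d3 k1 e0 e1 e2 e3)
        (K : Kill b0 b1 b2 b3 k a0 a1 a2 a3) (N : ¬ Eqb b0 b1 b2 b3 k a0 a1 a2 a3) :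
        Eqq b0 b1 b2 b3 k a0 a1 a2 a3 k1 e0 e1 e2 e3 := by
      rcases H.two _ _ _ _ _ _ _ _ _ _ K R.kill with h | h | h
      · exact (N h).elim
      · rcases R.ne with h' | h'
        · exact (hk1 h').elim
        · exact (h' h).elim
      · exact h
    cases c' : Nat.ble k k1 with
    | true =>
      rw [c'] at h
      have hle : k ≤ k1 := Nat.le_of_ble_eq_true c'
      obtain ⟨C5, h⟩ := pushMin_sound h
      refine ⟨fun b0 b1 b2 b3 H R K N => ?_, h⟩
      obtain ⟨q0, q1, q2, q3⟩ := eqq b0 b1 b2 b3 H R K N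
      refine C5 b0 b1 b2 b3 H R ?_ (sub_aux hle q0) (sub_aux hle q1) (sub_aux hle q2)
        (sub_aux hle q3)
      change 0 < k1 - k
      omega
    | false =>
      rw [c'] at h
      have hle : k1 ≤ k := by
        by_contra hc
        rw [Nat.ble_eq_true_of_le (by omega)] at c'
        exact absurd c' (by decide)
      obtain ⟨C5, h⟩ := pushMin_sound h
      refine ⟨fun b0 b1 b2 b3 H R K N => ?_, h⟩
      obtain ⟨q0, q1, q2, q3⟩ := eqq b0 b1 b2 b3 H R K N
      refine C5 b0 b1 b2 b3 H R ?_ (sub_aux hle q0.symm) (sub_aux hle q1.symm)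
        (sub_aux hle q2.symm) (sub_aux hle q3.symm)
      change 0 < k - k1
      omega

theorem stepN_sound {t : BT} {n0 d0 n1 d1 n2 d2 n3 d3 k1 e0 e1 e2 e3 k a0 a1 a2 a3 : ℕ}
    {rest : List St} (hk : 2 ≤ k) (hne : k ≠ k1) (ha : a0 + a1 + a2 + a3 + 1 = k)
    (h : AllGood t (stepN t n0 d0 n1 d1 n2 d2 n3 d3 k1 e0 e1 e2 e3 k a0 a1 a2 a3 rest)) :
    SoundN t n0 d0 n1 d1 n2 d2 n3 d3 k1 e0 e1 e2 e3 ∧ AllGood t rest := by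
  unfold stepN at h
  have kp : 0 < k := by omega
  obtain ⟨C0, h⟩ := child0_sound kp h
  obtain ⟨C1, h⟩ := child1_sound kp h
  obtain ⟨C2, h⟩ := child2_sound kp h
  obtain ⟨C3, h⟩ := child3_sound kp h
  obtain ⟨C4, h⟩ := pushMin_sound h
  obtain ⟨C5, h⟩ := child5_sound kp hne ha h
  refine ⟨fun b0 b1 b2 b3 H R => ?_, h⟩
  by_cases l0 : (k : ℝ) * b0 ≤ a0
  · exact C0 _ _ _ _ H R l0
  by_cases l1 : (k : ℝ) * b1 ≤ a1
  · exact C1 _ _ _ _ H R l1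
  by_cases l2 : (k : ℝ) * b2 ≤ a2
  · exact C2 _ _ _ _ H R l2
  by_cases l3 : (k : ℝ) * b3 ≤ a3
  · exact C3 _ _ _ _ H R l3
  have K : Kill b0 b1 b2 b3 k a0 a1 a2 a3 := 
    ⟨ha, not_le.1 l0, not_le.1 l1, not_le.1 l2, not_le.1 l3⟩
  by_cases N : Eqb b0 b1 b2 b3 k a0 a1 a2 a3
  · obtain ⟨q0, q1, q2, q3⟩ := N
    have hc : ((Nat.sub k 1 : ℕ) : ℝ) = k - 1 := by
      change ((k - 1 : ℕ) : ℝ) = _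
      rw [Nat.cast_sub (by omega)]; simp
    refine C4 _ _ _ _ H R ?_ ?_ ?_ ?_ ?_
    · change 0 < k - 1
      omega
    all_goals rw [hc]; linarith
  · exact C5 _ _ _ _ H R K N

theorem step_sound {t : BT} {h : ℕ} {st : St} {rest : List St}
    (hg : AllGood t (step t h st rest)) : AllGood t (st :: rest) := by
  obtain ⟨n0, d0, n1, d1, n2, d2, n3, d3, k1, e0, e1, e2, e3⟩ := st
  simp only [step, force_eq] at hg
  generalize Nat.div h 1000000 = k at hg
  generalize Nat.mod (Nat.div h 10000) 100 = a0 at hg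
  generalize Nat.mod (Nat.div h 100) 100 = a1 at hg
  generalize Nat.mod h 100 = a2 at hg
  generalize Nat.sub k (Nat.succ (Nat.add (Nat.add a0 a1) a2)) = a3 at hg
  cases c1 : Nat.beq (Nat.succ (Nat.add (Nat.add (Nat.add a0 a1) a2) a3)) k with
  | false => rw [c1] at hg; exact hg
  | true =>
  rw [c1] at hg
  cases c2 : Nat.ble 2 k with
  | false => rw [c2] at hg; exact hg
  | true =>
  rw [c2] at hg
  cases c3 : Nat.beq k k1 with
  | true => rw [c3] at hg; exact hg
  | false =>
  rw [c3] at hg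
  obtain ⟨h1, h2⟩ := stepN_sound (Nat.le_of_ble_eq_true c2) (Nat.ne_of_beq_eq_false c3)
    (Nat.eq_of_beq_eq_true c1) hg
  intro s hs
  rcases List.mem_cons.1 hs with rfl | hs
  · exact h1
  · exact h2 s hs

theorem sound_run {t : BT} (hs : List ℕ) : ∀ s : List St, AllGood t (run t hs s) → AllGood t s := by
  induction hs with
  | nil => intro s h; exact h
  | cons h hs ih =>
    intro s hg
    cases s with
    | nil => intro x hx; simp at hx
    | cons st rest => exact step_sound (ih _ hg)

open BT in
/-- All candidate weights (key, tag). -/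
def table : BT :=
 (n 4311065 29 (n 2213002 4 (n 2146952 7 (n 2130311 2 (n 2113930 2 (n 2113796 2146562 (n 2113669 2 (n 2113667 2146433 (n 2113666 4210817 (n 2113665 10502273 e e)
 e)
 (n 2113668 2 e e))
 (n 2113794 4210818 (n 2113670 2 e e)
 (n 2113795 4243585 e e)))
 (n 2113923 3 (n 2113799 2 (n 2113798 2 (n 2113797 2 e e)
 e)
 (n 2113800 2 e e))
 (n 2113925 2146433 (n 2113924 8405767 e e)
 (n 2113927 2 e e))))
 (n 2114570 3 (n 2114183 3 (n 2114054 2113667 (n 2114053 3 (n 2114052 3 e e)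
 e)
 (n 2114182 3 e e))
 (n 2114312 3 (n 2114311 3 e e)
 (n 2114441 3 e e)))
 (n 2130307 4210818 (n 2130180 5 (n 2130179 6324481 (n 2130178 4 e e)
 e)
 (n 2130181 4227205 e e))
 (n 2130309 16859399 (n 2130308 2113793 e e)
 (n 2130310 2113665 e e)))))
 (n 2130955 3 (n 2130566 3 (n 2130316 2 (n 2130314 2 (n 2130313 2 (n 2130312 2 e e)
 e)
 (n 2130315 2 e e))
 (n 2130438 7 (n 2130437 2130050 e e)
 (n 2130439 4259975 e e)))
 (n 2130697 4260233 (n 2130572 2 (n 2130568 2130052 (n 2130567 4210818 e e)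
 e)
 (n 2130695 3 e e))
 (n 2130826 3 (n 2130824 3 e e)
 (n 2130953 3 e e))))
 (n 2146821 10519436 (n 2146692 4 (n 2131342 3 (n 2131213 3 (n 2131084 3 e e)
 e)
 (n 2131471 3 e e))
 (n 2146695 5 (n 2146693 5 e e)
 (n 2146820 6341122 e e)))
 (n 2146829 2 (n 2146824 6308360 (n 2146823 4211076 (n 2146822 5 e e)
 e)
 (n 2146826 2 e e))
 (n 2146950 4211335 (n 2146832 2 e e)
 (n 2146951 7 e e))))))
 (n 2164370 3 (n 2163335 5 (n 2147595 3 (n 2147208 3 (n 2147080 7 (n 2146955 2 (n 2146953 4292745 e e)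
 e)
 (n 2147082 7 e e))
 (n 2147211 10551563 (n 2147210 23267077 e e)
 (n 2147340 2146566 e e)))
 (n 2163207 5 (n 2148372 3 (n 2147985 3 (n 2147598 3 e e)
 e)
 (n 2163205 4 e e))
 (n 2163333 4 (n 2163209 5 e e)
 (n 2163334 14745986 e e))))
 (n 2163594 7 (n 2163465 7 (n 2163338 6324874 (n 2163337 5 (n 2163336 5 e e)
 e)
 (n 2163463 2113924 e e))
 (n 2163467 8470795 (n 2163466 11 e e)
 (n 2163593 16959241 e e)))
 (n 2163850 3 (n 2163723 7 (n 2163596 7 (n 2163595 7 e e)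
 e)
 (n 2163725 7 e e))
 (n 2163854 4211207 (n 2163853 7 e e)
 (n 2163983 2113667 e e)))))
 (n 2196362 5 (n 2179981 6325261 (n 2179851 5 (n 2179848 6374404 (n 2179847 4 (n 2179846 4 e e)
 e)
 (n 2179849 5 e e))
 (n 2179976 10553107 (n 2179852 5 e e)
 (n 2179980 11 e e)))
 (n 2180497 7 (n 2180239 7 (n 2180236 7 (n 2180110 4243719 e e)
 e)
 (n 2180496 7 e e))
 (n 2196359 4 (n 2180626 4211465 e e)
 (n 2196360 4 e e))))
 (n 2196753 7 (n 2196490 13 (n 2196366 5 (n 2196365 5 (n 2196363 5 e e)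
 e)
 (n 2196489 14779395 e e))
 (n 2196624 11 (n 2196495 2113925 e e)
 (n 2196749 7 e e)))
 (n 2197269 8439573 (n 2197139 7 (n 2196882 7 (n 2196879 7 e e)
 e)
 (n 2197140 7 e e))
 (n 2212876 5 (n 2212873 4 e e)
 (n 2212880 5 e e)))))))
 (n 4244231 13 (n 2279452 11 (n 2230039 7 (n 2213912 7 (n 2213138 11 (n 2213132 13 (n 2213009 5 (n 2213003 13 e e)
 e)
 (n 2213137 11 e e))
 (n 2213522 7 (n 2213396 7 e e)
 (n 2213783 7 e e)))
 (n 2229523 5 (n 2229394 5 (n 2229390 5 (n 2229386 4 e e)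
 e)
 (n 2229515 4 e e))
 (n 2229652 11 (n 2229645 13 e e)
 (n 2229781 11 e e))))
 (n 2247198 7 (n 2246037 5 (n 2245904 5 (n 2230555 7 (n 2230426 7 e e)
 e)
 (n 2246028 4 e e))
 (n 2246295 11 (n 2246158 13 e e)
 (n 2246682 7 e e)))
 (n 2263841 7 (n 2262672 13 (n 2262551 5 (n 2262541 4 e e)
 e)
 (n 2262809 11 e e))
 (n 2279065 5 (n 2279054 4 e e)
 (n 2279314 13 e e)))))
 (n 4243844 8438146 (n 4227331 5 (n 2295966 11 (n 2295579 5 (n 2295567 4 (n 2280484 7 e e)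
 e)
 (n 2295827 13 e e))
 (n 2329123 11 (n 2297127 7 e e)
 (n 2345496 13 e e)))
 (n 4227718 8 (n 4227461 8405380 (n 4227460 6 (n 4227459 7 e e)
 e)
 (n 4227463 16794254 e e))
 (n 4227721 11 (n 4227719 10 e e)
 (n 4227979 13 e e))))
 (n 4244102 11 (n 4243974 8 (n 4243848 11 (n 4243847 11 (n 4243845 9 e e)
 e)
 (n 4243973 10551682 e e))
 (n 4243977 8438019 (n 4243975 12665345 e e)
 (n 4244101 4246021 e e)))
 (n 4244107 2 (n 4244105 13 (n 4244104 16827790 (n 4244103 0 e e)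
 e)
 (n 4244106 8405642 e e))
 (n 4244113 2 (n 4244110 2 e e)
 (n 4244116 2 e e))))))
 (n 4277134 17 (n 4260487 11 (n 4244493 10503053 (n 4244363 17 (n 4244361 2295567 (n 4244360 3 (n 4244235 15 e e)
 e)
 (n 4244362 16 e e))
 (n 4244368 2 (n 4244364 4243590 e e)
 (n 4244491 21022739 e e)))
 (n 4245267 3 (n 4244751 8406287 (n 4244622 19 (n 4244621 19 e e)
 e)
 (n 4244880 3 e e))
 (n 4246041 3 (n 4245654 3 e e)
 (n 4260486 9 e e))))
 (n 4277000 11 (n 4261007 17 (n 4260745 13 (n 4260491 14729355 (n 4260489 12616327 e e)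
 e)
 (n 4260749 15 e e))
 (n 4276872 13 (n 4261265 19 e e)
 (n 4276999 8470793 e e)))
 (n 4277129 14 (n 4277127 13 (n 4277005 12616333 (n 4277003 5 e e)
 e)
 (n 4277128 14 e e))
 (n 4277132 16 (n 4277131 16 e e)
 (n 4277133 17 e e)))))
 (n 4294293 23 (n 4277650 23 (n 4277387 0 (n 4277261 18 (n 4277259 17 (n 4277257 21186569 e e)
 e)
 (n 4277263 19 e e))
 (n 4277392 4211336 (n 4277390 7 e e)
 (n 4277644 3 e e)))
 (n 4278037 10520341 (n 4277907 25 (n 4277779 23 (n 4277777 22 e e)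
 e)
 (n 4277908 25 e e))
 (n 4293517 5 (n 4293513 14 e e)
 (n 4293519 4210949 e e))))
 (n 4310283 22 (n 4310155 17 (n 4310033 5 (n 4310031 5 (n 4310027 18 e e)
 e)
 (n 4310154 17 e e))
 (n 4310161 21 (n 4310156 18 e e)
 (n 4310162 21 e e)))
 (n 4310420 23 (n 4310413 19 (n 4310291 23 e e)
 (n 4310415 26 e e))
 (n 4310549 25 (n 4310543 22 e e)
 (n 4310678 7 e e))))))))
 (n 8472859 0 (n 6375061 17 (n 6357896 17 (n 4392603 5 (n 4343448 27 (n 4343061 5 (n 4326545 5 (n 4311323 31 (n 4311194 31 e e)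
 e)
 (n 4326547 5 e e))
 (n 4343309 25 (n 4343182 21 e e)
 (n 4343439 22 e e)))
 (n 4376089 5 (n 4344609 37 (n 4343699 31 (n 4343577 29 e e)
 e)
 (n 4359575 5 e e))
 (n 4376476 31 (n 4376465 25 e e)
 (n 4377895 43 e e))))
 (n 6357641 17 (n 6357515 17 (n 6357509 13 (n 6341130 7 (n 6341125 12599685 e e)
 e)
 (n 6357511 14 e e))
 (n 6357639 0 (n 6357638 6308099 e e)
 (n 6357640 2228870 e e)))
 (n 6357767 7 (n 6357645 2 (n 6357644 6324358 (n 6357643 19 e e)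
 e)
 (n 6357650 2 e e))
 (n 6357773 9 (n 6357771 9 e e)
 (n 6357895 16 e e)))))
 (n 6374158 19 (n 6358289 0 (n 6358025 19 (n 6357901 21 (n 6357899 19 (n 6357898 0 e e)
 e)
 (n 6357902 0 e e))
 (n 6358155 10 (n 6358031 23 e e)
 (n 6358285 0 e e)))
 (n 6358805 12601109 (n 6358675 31 (n 6358418 6308489 (n 6358415 25 e e)
 e)
 (n 6358676 31 e e))
 (n 6374023 9 (n 6359450 3 e e)
 (n 6374151 31523982 e e))))
 (n 6374413 12 (n 6374287 13 (n 6374284 12 (n 6374281 11 (n 6374280 10 e e)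
 e)
 (n 6374285 13 e e))
 (n 6374409 17 (n 6374408 10 e e)
 (n 6374411 11 e e)))
 (n 6374798 0 (n 6374545 23 (n 6374416 13 (n 6374414 13 e e)
 e)
 (n 6374668 13 e e))
 (n 6375054 3 (n 6374803 0 e e)
 (n 6375058 16 e e))))))
 (n 6457363 34 (n 6423700 27 (n 6407444 29 (n 6407178 0 (n 6390664 18973316 (n 6375448 6308876 (n 6375190 19 e e)
 e)
 (n 6407177 4 e e))
 (n 6407435 23 (n 6407186 6357257 e e)
 (n 6407437 24 e e)))
 (n 6408218 23 (n 6407824 28 (n 6407573 31 (n 6407564 25 e e)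
 e)
 (n 6407831 33 e e))
 (n 6408734 43 (n 6408347 39 e e)
 (n 6423690 4 e e))))
 (n 6424345 19 (n 6423950 14 (n 6423827 17 (n 6423822 18 (n 6423819 13 e e)
 e)
 (n 6423829 17 e e))
 (n 6424207 16 (n 6423958 17 e e)
 (n 6424337 16 e e)))
 (n 6456716 4 (n 6425377 25 (n 6424990 23 (n 6424732 43 e e)
 e)
 (n 6440203 4 e e))
 (n 6456974 29 (n 6456720 33 e e)
 (n 6457115 39 e e)))))
 (n 8471433 0 (n 6489742 4 (n 6473758 23 (n 6473229 4 (n 6458663 55 (n 6457373 41 e e)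
 e)
 (n 6473488 17 e e))
 (n 6473887 23 (n 6473876 19 e e)
 (n 6475306 31 e e)))
 (n 8471307 22 (n 8471303 19 (n 8471174 17 (n 8454791 6 e e)
 e)
 (n 8471305 16892675 e e))
 (n 8471311 4358543 (n 8471309 24 e e)
 (n 8471432 7 e e))))
 (n 8471819 25 (n 8471569 9 (n 8471440 8405384 (n 8471436 17 (n 8471435 8 e e)
 e)
 (n 8471443 2 e e))
 (n 8471694 26 (n 8471692 8 e e)
 (n 8471698 29 e e)))
 (n 8472214 0 (n 8472085 11 (n 8471949 28 e e)
 (n 8472209 10 e e))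
 (n 8472343 37 (n 8472339 34 e e)
 (n 8472730 43 e e)))))))
 (n 10620199 49 (n 8620195 21 (n 8505242 15 (n 8504458 0 (n 8488081 13 (n 8487821 26 (n 8487819 0 (n 8487818 14 e e)
 e)
 (n 8487825 0 e e))
 (n 8488341 23 (n 8488083 13 e e)
 (n 8489115 29 e e)))
 (n 8504595 13 (n 8504468 23 (n 8504464 21 (n 8504463 12 e e)
 e)
 (n 8504587 10 e e))
 (n 8504726 13 (n 8504597 13 e e)
 (n 8504975 34 e e))))
 (n 8538270 47 (n 8537484 10 (n 8537357 29 (n 8506145 19 (n 8505629 17 e e)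
 e)
 (n 8537367 37 e e))
 (n 8537871 34 (n 8537496 27 e e)
 (n 8538001 16 e e)))
 (n 8570639 13 (n 8554139 17 (n 8553881 41 (n 8539431 61 e e)
 e)
 (n 8570524 31 e e))
 (n 8571298 19 (n 8570653 17 e e)
 (n 8572717 25 e e)))))
 (n 10586913 0 (n 10585226 7 (n 10584978 31 (n 10584973 27 (n 10584969 0 (n 10584968 23 e e)
 e)
 (n 10584977 31 e e))
 (n 10585101 13 (n 10585099 0 e e)
 (n 10585107 0 e e)))
 (n 10586133 10 (n 10585752 41 (n 10585485 30 (n 10585232 25 e e)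
 e)
 (n 10585873 10 e e))
 (n 10586263 43 (n 10586139 11 e e)
 (n 10586268 47 e e))))
 (n 10602911 27 (n 10601868 16 (n 10601611 15 (n 10601492 10502666 (n 10601484 14 e e)
 e)
 (n 10601621 19 e e))
 (n 10602000 18 (n 10601879 21 e e)
 (n 10602524 25 e e)))
 (n 10618264 31 (n 10617998 29 (n 10617995 0 (n 10603556 31 e e)
 e)
 (n 10618006 0 e e))
 (n 10618651 35 (n 10618510 26 e e)
 (n 10619554 43 e e))))))
 (n 12797729 57 (n 12698774 15 (n 10670128 79 (n 10636842 19 (n 10635025 11 (n 10634778 35 (n 10634765 10 e e)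
 e)
 (n 10635423 15 e e))
 (n 10667548 47 (n 10667534 4 e e)
 (n 10668178 43 e e)))
 (n 12698635 6 (n 10700834 43 (n 10686771 43 (n 10684191 27 e e)
 e)
 (n 12698633 27 e e))
 (n 12698645 37 (n 12698639 32 e e)
 (n 12698763 19 e e))))
 (n 12731673 17 (n 12715411 17 (n 12700193 57 (n 12698903 33 (n 12698897 29 e e)
 e)
 (n 12700967 67 e e))
 (n 12715675 21 (n 12715417 19 e e)
 (n 12731659 33 e e)))
 (n 12764815 25 (n 12748187 11 (n 12732046 10 (n 12731789 22 e e)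
 e)
 (n 12748445 41 e e))
 (n 12765072 10 (n 12764959 23 e e)
 (n 12767539 19 e e)))))
 (n 14928148 37 (n 14812828 9 (n 14812557 25 (n 14812431 6 (n 14812300 0 (n 12831124 13 e e)
 e)
 (n 14812441 0 e e))
 (n 14812570 15 (n 14812562 13 e e)
 (n 14812699 41 e e)))
 (n 14861854 11 (n 14828826 47 (n 14828819 41 (n 14828813 28 e e)
 e)
 (n 14845324 37 e e))
 (n 14878352 37 (n 14861983 29 e e)
 (n 14895140 23 e e))))
 (n 16959652 47 (n 16926108 51 (n 16925965 37 (n 14977581 41 (n 14944424 71 e e)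
 e)
 (n 16926094 16 e e))
 (n 16926366 47 (n 16926351 7 e e)
 (n 16959394 19 e e)))
 (n 21153571 51 (n 19056144 22 (n 19039888 34 e e)
 (n 19056401 19 e e))
 (n 21252397 11 (n 21169827 65 e e)
 (n 25380756 37 e e)))))))))

/-! ### The certificate -/

def stk0 : List St := [⟨1,4,1,3,1,2,1,1,1,0,0,0,0⟩]

def stk1 : List St := [⟨1,11,2,17,8,25,17,36,13,1,1,4,6⟩,
 ⟨3,35,4,35,11,35,17,35,13,1,1,4,6⟩,
 ⟨3,38,4,38,12,38,1,2,13,1,1,4,6⟩,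
 ⟨1,11,2,17,1,3,12,25,13,1,1,4,6⟩,
 ⟨1,11,1,7,5,17,1,2,1,0,0,0,0⟩,
 ⟨1,11,1,7,1,3,8,17,1,0,0,0,0⟩,
 ⟨1,11,1,7,1,3,1,2,17,1,2,5,8⟩,
 ⟨1,11,1,11,1,3,1,2,1,0,0,0,0⟩,
 ⟨1,8,1,7,3,11,1,2,1,0,0,0,0⟩,
 ⟨1,8,1,7,1,3,5,11,1,0,0,0,0⟩,
 ⟨1,8,1,7,1,3,1,2,11,1,1,3,5⟩,
 ⟨1,8,1,5,2,7,1,2,1,0,0,0,0⟩,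
 ⟨1,8,1,5,1,3,3,7,1,0,0,0,0⟩,
 ⟨1,8,1,5,1,3,1,2,7,0,1,2,3⟩,
 ⟨1,8,1,8,1,3,1,2,1,0,0,0,0⟩,
 ⟨1,5,1,5,2,8,1,2,1,0,0,0,0⟩,
 ⟨1,5,1,5,1,3,3,8,1,0,0,0,0⟩,
 ⟨1,5,1,5,1,3,1,2,8,1,1,2,3⟩,
 ⟨1,5,1,5,1,5,1,2,1,0,0,0,0⟩,
 ⟨1,4,1,3,1,3,2,5,1,0,0,0,0⟩,
 ⟨1,5,1,3,1,3,1,2,5,0,1,1,2⟩,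
 ⟨1,4,1,3,1,3,1,3,1,0,0,0,0⟩,
 ⟨1,4,1,3,1,2,1,2,3,0,0,1,1⟩,
 ⟨1,4,1,3,1,2,1,1,2,0,0,0,1⟩]

def hints0 : List ℕ := [
 2000000, 3000001, 5000101, 8010102, 7000102, 11010103, 17010205, 25010308, 31010410, 37010512,
 43010614, 79021126, 85021228, 67020922, 97031332, 43010614, 67020922, 115031638, 73021024,
 103031434, 65020921, 65020921, 79031026, 55020718, 109041436, 55020718, 103041334, 29010409,
 51020716, 53020717, 51020716, 87031228, 57020818, 53020717, 79031125, 29010409, 52020717,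
 37010512, 55020718, 67020922, 61020820, 127041742, 85031128, 53020717, 83031127, 59020819,
 65020921, 29010409, 19010206, 43020514, 79040926, 61030720, 121061440, 61030720, 97051132,
 61030720, 109051336, 85041028, 103051234, 59030719, 37020412, 43020514, 79040926, 115061338,
 151081750, 103061134, 53030617, 59030719, 23010307, 29010409, 73031023, 47020615, 119051638,
 95041330, 51020716, 51020716, 57020818, 71031022, 19010206, 41020513, 39020512, 77041024,
 63030820, 39020512, 39020512, 55030717, 89051128, 87051127, 71040922, 35020411, 35020411,
 71040922, 71040922, 73040923, 55030717, 77041024, 93051229, 57030718, 35020411, 35020411,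
 37020511, 43020613, 57030817, 57030817, 73041022, 53030716, 87051226, 39020512, 45020614,
 29010409, 139061944, 69030922, 69030922, 63030820, 61030819, 59030818, 29010409, 43020613,
 65030920, 29010409, 43020613, 53030716, 59030818, 37020511, 19010206, 29010409, 29010409,
 36020511, 22010307, 23010307, 46020615, 19010206, 40020513, 61030820, 53030717, 37020512,
 52030717, 106061435, 38020512, 40020513, 37020512, 44020614, 43020614, 61030820, 97051332,
 58030819, 19010206, 23010307, 31010410, 49020616, 103041334, 151061950, 75031024, 29010409,
 52020717, 50020716, 41020513, 49020616, 55020718, 151061950, 67030822, 91041130, 47020615,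
 65030821, 71030923, 31010410, 109051436, 43020514, 19010206, 43020514, 67030822, 91041130,
 59030719, 19010206, 64030821, 40020513, 13010104, 19010206, 79040926, 43020514, 61030720,
 121061440, 61030720, 103051234, 61030720, 97051132, 31020310, 49030516, 79050826, 97061032,
 67040722, 43030414, 67050622, 55040518, 109081036, 55040518, 79060726, 133101244, 55040518,
 73050724, 85060828, 97070932, 53040517, 41030413, 29020309, 97071031, 59040619, 29020309,
 69050722, 53040517, 43030414, 49030516, 61040620, 79050826, 109071136, 73050724, 103071034,
 59040619, 59040619, 93070930, 41030413, 71050723, 70050723, 29020309, 29020309, 61040719,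
 45030514, 35020411, 27020308, 43030513, 55040617, 97071130, 69050821, 71050822, 69050821,
 81060925, 53040616, 95071129, 45030514, 55040617, 67050721, 71050822, 27020308, 28020309,
 70050823, 29020309, 37020412, 61030720, 115061338, 151081750, 31020310, 49030516, 67040722,
 103061134, 35020411, 47030515, 81050926, 53030617, 45030514, 63040720, 46030515, 52030617,
 31020310, 28020309, 46030515, 43030514, 40030413, 27020308, 37030411, 23020207, 49040515,
 47040514, 105091132, 95081029, 75060823, 47040514, 67060720, 57050617, 79070824, 57050617,
 79070824, 57050617, 93081028, 69060721, 79070824, 47040514, 111091234, 73060822, 95081029,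
 49040515, 35030410, 45040513, 89081026, 71060821, 45040513, 61050718, 69060820, 37030411,
 63050719, 43030513, 53040616, 89071027, 77060923, 71060821, 45040513, 23020207, 46040515,
 35030411, 37030412, 25020208, 29020309, 53040517, 43030414, 65050621, 55040518, 67050622,
 79060726, 91070830, 103080934, 127101142, 115091038, 41030413, 39030412, 40030413, 31020310,
 43030414, 39030412, 28020309, 40030413, 19010206, 39030412, 23020207, 41030413, 35030311,
 117101137, 85070827, 73060723, 63050620, 51040516, 73060723, 35030311, 71060722, 61050619,
 36030411, 29020309, 19010206, 29020309, 23020207, 19010206, 23020207]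

set_option maxRecDepth 100000 in
theorem run0 : run table hints0 stk0 = stk1 := by decide +kernel

def stk2 : List St := [⟨7,65,1,7,22,87,1,2,29,3,4,7,14⟩,
 ⟨1,9,1,7,6,23,29,59,29,3,4,7,14⟩,
 ⟨1,9,1,7,3,11,11,23,1,0,0,0,0⟩,
 ⟨1,9,1,7,3,11,1,2,23,2,3,6,11⟩,
 ⟨1,8,1,7,3,11,1,2,9,1,1,2,4⟩,
 ⟨1,8,1,7,1,3,5,11,1,0,0,0,0⟩,
 ⟨1,8,1,7,1,3,1,2,11,1,1,3,5⟩,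
 ⟨1,8,1,5,2,7,1,2,1,0,0,0,0⟩,
 ⟨1,8,1,5,1,3,3,7,1,0,0,0,0⟩,
 ⟨1,8,1,5,1,3,1,2,7,0,1,2,3⟩,
 ⟨1,8,1,8,1,3,1,2,1,0,0,0,0⟩,
 ⟨1,5,1,5,2,8,1,2,1,0,0,0,0⟩,
 ⟨1,5,1,5,1,3,3,8,1,0,0,0,0⟩,
 ⟨1,5,1,5,1,3,1,2,8,1,1,2,3⟩,
 ⟨1,5,1,5,1,5,1,2,1,0,0,0,0⟩,
 ⟨1,4,1,3,1,3,2,5,1,0,0,0,0⟩,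
 ⟨1,5,1,3,1,3,1,2,5,0,1,1,2⟩,
 ⟨1,4,1,3,1,3,1,3,1,0,0,0,0⟩,
 ⟨1,4,1,3,1,2,1,2,3,0,0,1,1⟩,
 ⟨1,4,1,3,1,2,1,1,2,0,0,0,1⟩]

def hints1 : List ℕ := [
 26020308, 27020308, 29020309, 28020309, 40030413, 34030311, 61050620, 59050619, 19010206,
 49040516, 34030311, 58050619, 19010206, 36030411, 35030411, 36030411, 37030412, 15010204,
 31020409, 65040919, 79051123, 99061429, 65040919, 93061327, 25020307, 31020409, 55040716,
 41030512, 65050819, 79061023, 39030511, 39030511, 53040715, 83061124, 53040715, 63050818,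
 77061022, 69050920, 39030511, 83061124, 55040716, 53040715, 35030410, 45040513, 69060820,
 59050717, 47040613, 23020306, 69060919, 93081226, 23020306, 79071022, 49040614, 39030511,
 113091433, 63050818, 103081330, 35030410, 59050717, 157131946, 41030512, 39030511, 57050716,
 71060920, 81071023, 61050817, 47040613, 57050716, 35030410, 31020409, 24020307, 23020306,
 23020306, 57050815, 25020307, 29020408, 45030613, 59040817, 45030613, 39030511, 53040715,
 67050919, 125091736, 95071327, 31020409, 23020306, 29020408, 37030510, 83071123, 37030510,
 71061019, 38030511, 36030510, 24020307, 16010205, 22010307, 52030717, 49030616, 98061332,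
 67040922, 37020512, 37020512, 43020614, 50030716, 13010104, 28020309, 43030514, 49030616,
 43030514, 41030513, 25020308, 37030412, 46040515, 34030411, 79070926, 35030411, 34030411,
 46040515, 61050720, 59050719, 50040616, 49040616, 37030412, 34030411, 49040616, 58050719,
 26020308, 28020309, 58050619, 37030412, 24020307, 15010204, 37030511, 13010104, 26020308,
 50040715, 13010104, 30020409, 36030511, 23020307, 29020409, 23020307, 29020409, 37030511,
 13010104, 47040614, 23020307, 23020307, 15010204, 59050818, 37030512, 58050819, 31020410,
 22010307, 67040922, 32020410, 142091947, 47030615, 25020308, 41030513, 32020410, 73050924,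
 28020309, 40030513, 55040718, 13010104, 24020307, 13010104, 29020409, 22010307, 15010204,
 32020410, 54040717, 15010204, 22010307, 22010307, 22010307, 38030512, 29020409, 22010307,
 24020307, 47040615, 29020409, 23020307, 24020307, 23020307, 25020308, 43030614, 40030513,
 52040717, 29020409, 36030511, 23020307, 37030512, 19010206, 27020308, 33020410, 23010307,
 39020512, 51030616, 103061332, 67040821, 135081742, 53030716, 51030715, 37020511, 43030513,
 51030616, 77050924, 75050923, 59040718, 29020309, 31020409, 37020511, 53030716, 97061329,
 47030614, 51030715, 41030512, 57040717, 47030614, 73050922, 71050921, 15010204, 15010204,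
 23010307, 36020511, 16010205, 23010307, 29020309, 15010204, 51030715, 31020409, 25020307,
 41030512, 31020409, 51040615, 23020306, 15010204, 36020511, 16010205, 13010104, 16010205,
 42030513, 23010307, 24020307, 40030512, 34030410, 59050718, 16010205, 34020411, 22010307,
 13010104, 34020411, 15010204, 13010104, 24020307, 13010104, 67050622, 79060726, 133101244,
 25020208, 67050622, 79060726, 91070830, 103080934, 127101142, 115091038, 23020207, 9010102,
 23020306, 15010204, 37030510, 71061019, 19020205, 41040511, 31030408, 63060817, 31030408,
 49050613, 39040510, 79081021, 87091123, 39040510, 79081021, 31030408, 49050613, 63060817,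
 81081022, 89091124, 71070919, 59060716, 39040510, 65070817, 55060714, 73080919, 111121429,
 73080919, 47050612, 31030408, 57060715, 49050613, 37040410, 59060716, 67070818, 67070818,
 93101125, 75080920, 83091022, 49050613, 56060715, 31030408, 49050613, 29030407, 43040611,
 31030408, 51050713, 59060815, 51050713, 59060815, 79081120, 71071018, 51050713, 59060815,
 73071019, 31030408, 51050713, 31030408, 47050612, 55060714, 39040510, 67070917, 55060714,
 47050612, 75081019, 37040509, 111121528, 73081018, 147162037, 75081019, 59060815, 47050612,
 59060815, 67070917, 39040510, 81081121, 59060815, 37040509, 87091222, 65070916]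

set_option maxRecDepth 100000 in
theorem run1 : run table hints1 stk1 = stk2 := by decide +kernel

def stk3 : List St := [⟨1,19,5,29,7,25,1,2,1,0,0,0,0⟩,
 ⟨1,19,5,29,2,7,1,2,25,1,4,7,12⟩,
 ⟨1,19,2,11,8,29,1,2,1,0,0,0,0⟩,
 ⟨1,19,2,11,2,7,14,29,1,0,0,0,0⟩,
 ⟨1,19,2,11,2,7,1,2,29,1,5,8,14⟩,
 ⟨1,19,1,5,3,11,1,2,1,0,0,0,0⟩,
 ⟨1,19,1,5,2,7,1,2,11,0,2,3,5⟩,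
 ⟨1,13,3,19,2,7,1,2,1,0,0,0,0⟩,
 ⟨1,13,1,5,5,19,1,2,1,0,0,0,0⟩,
 ⟨1,13,1,5,2,7,9,19,1,0,0,0,0⟩,
 ⟨1,13,1,5,2,7,1,2,19,1,3,5,9⟩,
 ⟨1,8,2,13,2,7,1,2,1,0,0,0,0⟩,
 ⟨1,8,1,5,3,13,1,2,1,0,0,0,0⟩,
 ⟨1,8,1,5,2,7,6,13,1,0,0,0,0⟩,
 ⟨1,8,1,5,2,7,1,2,13,1,2,3,6⟩,
 ⟨1,8,1,5,1,3,3,7,1,0,0,0,0⟩,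
 ⟨1,8,1,5,1,3,1,2,7,0,1,2,3⟩,
 ⟨1,8,1,8,1,3,1,2,1,0,0,0,0⟩,
 ⟨1,5,1,5,2,8,1,2,1,0,0,0,0⟩,
 ⟨1,5,1,5,1,3,3,8,1,0,0,0,0⟩,
 ⟨1,5,1,5,1,3,1,2,8,1,1,2,3⟩,
 ⟨1,5,1,5,1,5,1,2,1,0,0,0,0⟩,
 ⟨1,4,1,3,1,3,2,5,1,0,0,0,0⟩,
 ⟨1,5,1,3,1,3,1,2,5,0,1,1,2⟩,
 ⟨1,4,1,3,1,3,1,3,1,0,0,0,0⟩,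
 ⟨1,4,1,3,1,2,1,2,3,0,0,1,1⟩,
 ⟨1,4,1,3,1,2,1,1,2,0,0,0,1⟩]

def hints2 : List ℕ := [
 57060814, 135141934, 151162138, 31030408, 37040509, 39040510, 15010204, 30030408, 31030408,
 15010204, 63060817, 107101429, 43040611, 57050815, 65060917, 65060917, 53050714, 15010204,
 19020205, 19020205, 29030407, 17020204, 27030307, 37040509, 55060714, 71080918, 79091020,
 35040409, 89101123, 121141531, 111131428, 45050611, 63070816, 71080918, 53060713, 83091121,
 79091020, 61070815, 87101122, 147171937, 69080917, 39040510, 43050511, 29030407, 71081017,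
 44050611, 29030407, 29030407, 19020205, 36040509, 23020306, 15010204, 36040509, 19020205,
 19020205, 43050610, 57070813, 26030307, 15010204, 43050611, 67080918, 15010204, 58070815,
 49060613, 50060713, 57070815, 10010103, 16010205, 25020308, 34030411, 43040514, 64060721,
 31030310, 61060720, 52050617, 71070823, 62060720, 73070824, 53050617, 52050617, 53050617,
 43040514, 76070925, 31030310, 34030411, 49040616, 42040513, 41040513, 23020307, 31030409,
 43040613, 36030511, 31030409, 45040614, 42040513, 52050716, 43040613, 22020307, 37030512,
 58050819, 31030410, 76071025, 37030512, 67060922, 23020307, 53050717, 62060820, 61060820,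
 52050717, 83081127, 67060922, 44040614, 31030410, 58050819, 73071024, 43040614, 65060921,
 25020308, 29020409, 31020410, 52040717, 40030513, 43030614, 52040717, 23020307, 29020409,
 32030410, 23020307, 37030512, 32030410, 9010102, 31030409, 38040511, 37040511, 57060817,
 51050715, 85091225, 65070919, 37040511, 38040511, 51050715, 17020205, 37040511, 52060715,
 43050612, 44050613, 44050613, 43050612, 44050613, 57060817, 25030307, 43050612, 52060715,
 57070816, 58070817, 65080919, 114141633, 50060714, 59070817, 51060715, 34040410, 25030307,
 37040511, 41050512, 37040511, 18020205, 29030408, 43050614, 58070819, 19020206, 16010205,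
 20020206, 34030411, 52050617, 70070823, 49050516, 97101132, 125131441, 25020308, 29030309,
 25020308, 91091130, 49050616, 58060719, 30030409, 20020206, 23020307, 23020307, 31030410,
 40040513, 49050616, 30030409, 22020307, 22020307, 17020205, 30030409, 9010102, 20020206,
 23020307, 39040512, 29030309, 65070820, 16010205, 39040512, 26030308, 55060717, 16010205,
 35040411, 23020307, 43050513, 26030308, 23020307, 29030409, 26030308, 45050614, 36040511,
 26030308, 23020307, 9010102, 17020205, 22020307, 37040512, 46050615, 55060718, 37040512,
 25030308, 37040512, 52060717, 43050614, 10010103, 13010104, 25020307, 21020206, 37030411,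
 33030310, 67060720, 87080926, 43040413, 107101132, 53050516, 151141645, 75070822, 65060719,
 35030410, 45040513, 55050616, 75070822, 65060719, 43040512, 44040513, 23020207, 17010205,
 43040512, 53050615, 53050616, 33030409, 51050614, 43040512, 15010204, 24020307, 17010205,
 53050616, 21020206, 33030410, 15010204, 32030409, 22020306, 22020306, 23020307, 33030410,
 22020207, 35030411, 22020306, 24020307, 13010104, 21020206, 23020207, 9010102, 21020206,
 25020307, 45040513, 55050616, 67060720, 65060719, 75070822, 85080925, 35030410, 43040512,
 44040513, 33030409, 15010204, 15010204, 17010205, 55050716, 22020306, 33030409, 19020205,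
 43040512, 29030308, 53050615, 39040411, 81080923, 61060717, 71070820, 61060717, 51050614,
 29030308, 59060716, 25020307, 15010204, 19020205, 40040511, 25020307, 25020307, 32030409,
 22020306, 25020307, 24020307, 28030308, 17010205, 19020205, 49050614, 41040512, 37040411,
 15010204, 32030409, 28030308, 19020205, 19020205, 39040511, 22020306, 39040511, 31030409,
 31030409, 22020306, 21020206, 55050616, 67060720, 65060719, 75070822, 85080925, 19020205,
 39040411, 13010203, 19010305, 11000203, 29010508, 39010711, 67021219, 25010407]

set_option maxRecDepth 100000 in
theorem run2 : run table hints2 stk2 = stk3 := by decide +kernel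

def stk4 : List St := [⟨1,13,1,5,5,19,13,28,16,1,3,4,7⟩,
 ⟨1,13,1,5,5,19,1,2,17,1,3,4,8⟩,
 ⟨1,13,1,5,2,7,9,19,1,0,0,0,0⟩,
 ⟨1,13,1,5,2,7,1,2,19,1,3,5,9⟩,
 ⟨1,8,2,13,2,7,1,2,1,0,0,0,0⟩,
 ⟨1,8,1,5,3,13,1,2,1,0,0,0,0⟩,
 ⟨1,8,1,5,2,7,6,13,1,0,0,0,0⟩,
 ⟨1,8,1,5,2,7,1,2,13,1,2,3,6⟩,
 ⟨1,8,1,5,1,3,3,7,1,0,0,0,0⟩,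
 ⟨1,8,1,5,1,3,1,2,7,0,1,2,3⟩,
 ⟨1,8,1,8,1,3,1,2,1,0,0,0,0⟩,
 ⟨1,5,1,5,2,8,1,2,1,0,0,0,0⟩,
 ⟨1,5,1,5,1,3,3,8,1,0,0,0,0⟩,
 ⟨1,5,1,5,1,3,1,2,8,1,1,2,3⟩,
 ⟨1,5,1,5,1,5,1,2,1,0,0,0,0⟩,
 ⟨1,4,1,3,1,3,2,5,1,0,0,0,0⟩,
 ⟨1,5,1,3,1,3,1,2,5,0,1,1,2⟩,
 ⟨1,4,1,3,1,3,1,3,1,0,0,0,0⟩,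
 ⟨1,4,1,3,1,2,1,2,3,0,0,1,1⟩,
 ⟨1,4,1,3,1,2,1,1,2,0,0,0,1⟩]

def hints3 : List ℕ := [
 43020712, 65031118, 119062033, 137072338, 41020711, 47020813, 59031016, 59031016, 47020813,
 83041423, 47020813, 61031017, 47020813, 43020712, 47020813, 53020915, 71031220, 67031119,
 39020611, 23010406, 51020914, 73031320, 41020711, 59031016, 81041422, 41020711, 69031219,
 45020812, 95041726, 63031117, 51020914, 45020812, 39020710, 23010406, 46020813, 23010406,
 25010407, 39010711, 53020915, 57021016, 67021219, 57021016, 51020914, 57021016, 83031523,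
 79031422, 51020914, 61021117, 25010407, 87041524, 41020711, 27010507, 37010710, 31010608,
 71021419, 41010811, 101032027, 57021115, 63021217, 89031724, 83031622, 61021216, 127042534,
 131042635, 57021115, 67021318, 87031723, 41010811, 63021217, 59021116, 23010406, 49020913,
 71031319, 103041928, 45020812, 93041725, 41020711, 39020710, 61031116, 49020913, 21010405,
 47020912, 51021013, 101042026, 51021013, 71031418, 111052228, 131062633, 91041823, 67031317,
 67031317, 71031418, 51021013, 43020811, 67031317, 31010608, 43020811, 39020710, 101051926,
 41020810, 47020912, 87041722, 147072937, 211104253, 43020811, 63031216, 119062330, 26010507,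
 21010405, 42020811, 23010406, 41020811, 23010406, 31010608, 49020913, 59021116, 83031622,
 53021014, 89031724, 135052636, 75031420, 73031419, 53021014, 26010507, 31010608, 43020811,
 47020912, 33010609, 47010913, 57011116, 71011420, 61011217, 61011217, 39010711, 43010812,
 53011015, 43010812, 37010710, 37010710, 41010811, 51011014, 36010710, 46010913, 22010406,
 26010507, 36010710, 32010609, 27010507, 29010508, 27010507, 25010407, 32010609, 15010204,
 33020509, 89051425, 39020611, 53030815, 67041019, 53030815, 71041120, 71041120, 51030814,
 61040917, 81051223, 47030713, 93061426, 67041019, 67041019, 95061427, 47030713, 95061427,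
 47030713, 53030815, 83051323, 85051324, 79051222, 65041018, 71041120, 51030814, 77051221,
 27020407, 53040814, 83061322, 29020408, 33020509, 61040917, 75051121, 179122651, 89061325,
 53040715, 45030712, 27020407, 41030611, 33020509, 73051120, 59040916, 41030611, 46030713,
 27020407, 17010304, 21010405, 31010608, 27010507, 43020811, 47020912, 47020912, 23010406,
 51021013, 47020912, 67031317, 71031418, 111052228, 131062633, 91041823, 67031317, 47020912,
 101042026, 67031317, 71031418, 27010507, 61021216, 47020912, 51021013, 39020710, 27010507,
 43020811, 101051926, 23010406, 43020811, 23010406, 35020609, 59031115, 55031014, 71041318,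
 91051723, 53031013, 69041317, 103061926, 37020709, 69041317, 107062027, 37020709, 71041318,
 75041419, 43020811, 43020811, 23010406, 55031014, 77041420, 27010507, 35020609, 23010406,
 43020811, 37020709, 41020810, 87041722, 147072937, 211104253, 63031216, 99051925, 57031114,
 77041519, 71041417, 36020709, 27010507, 52031013, 36020709, 56031114, 66031317, 36020709,
 23010406, 31020508, 35020609, 47030812, 23010406, 65041117, 81051421, 27020407, 69051118,
 29020507, 47030812, 59041015, 63041116, 63041116, 75051319, 35020609, 55040914, 59041015,
 43030711, 71051218, 101071726, 43030711, 71051218, 95071624, 71051218, 83061421, 41030710,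
 53040913, 107081827, 53040913, 123092131, 107081827, 41030710, 59041015, 43030711, 83061421,
 67051117, 41030710, 59041015, 87061522, 57041014, 127092232, 69051217, 23010406, 27020407,
 43030711, 35020609, 47030812, 77051320, 73051219, 61041016, 27020407, 69051118, 29020507,
 27020407, 31020607, 27020506, 43030810, 57041113, 69051316, 99071923, 69051316, 43030810,
 53041012, 95071822, 83061619, 27020506, 41030809, 57041113, 47030911, 61041214, 73051417,
 27020506, 71051416, 41030809, 27020506, 16010304, 28020507, 31020608, 32020608]

set_option maxRecDepth 100000 in
theorem run3 : run table hints3 stk3 = stk4 := by decide +kernel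

def stk5 : List St := [⟨1,9,4,29,17,67,1,2,1,0,0,0,0⟩,
 ⟨1,9,4,29,10,39,1,2,67,7,9,17,33⟩,
 ⟨1,9,4,29,8,31,1,2,39,4,5,10,19⟩,
 ⟨1,9,3,21,8,31,1,2,29,3,4,7,14⟩,
 ⟨1,9,3,21,4,15,15,31,1,0,0,0,0⟩,
 ⟨1,9,3,21,4,15,1,2,31,3,4,8,15⟩,
 ⟨1,9,2,13,5,21,1,2,1,0,0,0,0⟩,
 ⟨1,9,2,13,4,15,10,21,1,0,0,0,0⟩,
 ⟨1,9,2,13,4,15,1,2,21,2,3,5,10⟩,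
 ⟨1,9,2,13,2,7,7,15,1,0,0,0,0⟩,
 ⟨1,9,2,13,2,7,1,2,15,1,2,4,7⟩,
 ⟨1,9,1,9,2,7,1,2,1,0,0,0,0⟩,
 ⟨1,8,2,13,2,9,1,2,1,0,0,0,0⟩,
 ⟨1,8,2,13,2,7,4,9,1,0,0,0,0⟩,
 ⟨1,8,2,13,2,7,1,2,9,1,1,2,4⟩,
 ⟨1,8,1,5,3,13,1,2,1,0,0,0,0⟩,
 ⟨1,8,1,5,2,7,6,13,1,0,0,0,0⟩,
 ⟨1,8,1,5,2,7,1,2,13,1,2,3,6⟩,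
 ⟨1,8,1,5,1,3,3,7,1,0,0,0,0⟩,
 ⟨1,8,1,5,1,3,1,2,7,0,1,2,3⟩,
 ⟨1,8,1,8,1,3,1,2,1,0,0,0,0⟩,
 ⟨1,5,1,5,2,8,1,2,1,0,0,0,0⟩,
 ⟨1,5,1,5,1,3,3,8,1,0,0,0,0⟩,
 ⟨1,5,1,5,1,3,1,2,8,1,1,2,3⟩,
 ⟨1,5,1,5,1,5,1,2,1,0,0,0,0⟩,
 ⟨1,4,1,3,1,3,2,5,1,0,0,0,0⟩,
 ⟨1,5,1,3,1,3,1,2,5,0,1,1,2⟩,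
 ⟨1,4,1,3,1,3,1,3,1,0,0,0,0⟩,
 ⟨1,4,1,3,1,2,1,2,3,0,0,1,1⟩,
 ⟨1,4,1,3,1,2,1,1,2,0,0,0,1⟩]

def hints4 : List ℕ := [
 31020608, 33020608, 21010405, 35020609, 55031014, 69041317, 103061926, 119072230, 219134155,
 85051621, 29020507, 35020609, 51030913, 45030811, 95061724, 63041116, 61041115, 107071927,
 91061623, 67051216, 28020507, 23010406, 47030911, 21010405, 51031012, 43030810, 59041114,
 79051519, 75051418, 29020507, 83061520, 55041013, 21010405, 31020607, 21010405, 16010304,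
 36020709, 21010405, 23010406, 28020507, 44030811, 50030913, 27010507, 23010406, 85061522,
 23010406, 21010405, 27020506, 41030810, 11000203, 18010305, 15010204, 32020509, 15010204,
 41030711, 95071726, 28020507, 30020508, 29020508, 47030813, 36020610, 39020711, 17010304,
 50030914, 46030813, 15010204, 54040915, 16010304, 41020811, 37020710, 17010304, 34020609,
 26010507, 17010304, 36020709, 17010304, 131082635, 49030913, 66041317, 116072331, 49030913,
 34020609, 72041419, 17010304, 26010507, 56031115, 17010304, 17010304, 28020507, 15010204,
 30020508, 27020507, 67051218, 56041015, 43030811, 94071725, 34020609, 28020507, 17010304,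
 41030810, 31020608, 32020608, 26010507, 71041419, 126082533, 131082635, 32020608, 27020507,
 48030913, 43030811, 15010204, 26010507, 57041115, 37020710, 42030811, 28020507, 32020608,
 27020507, 16010304, 18010305, 36020710, 18010305, 29020508, 46030913, 53041015, 18010305,
 27020507, 31020608, 56041115, 29020508, 32020609, 41030811, 22010406, 26010507, 23010406,
 15010204, 37020610, 25010407, 59031016, 133072237, 95051626, 155082643, 33020509, 39020611,
 51030814, 57030916, 69041119, 93051526, 63041017, 31020508, 49030813, 35020609, 41020711,
 53030914, 67041118, 65041117, 35020609, 18010305, 25010407, 25010407, 48030813, 29010508,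
 31020508, 35020609, 65041117, 49030813, 57040915, 27020407, 17010304, 38020710, 57031016,
 11000203, 15010204, 18010305, 9010102, 15010204, 61040917, 33020509, 53030815, 67041019,
 81051223, 47030713, 93061426, 67041019, 67041019, 95061427, 53030815, 47030713, 209133259,
 47030713, 95061427, 11010103, 25020307, 47040613, 23020306, 69060919, 93081226, 23020306,
 79071022, 39030511, 57050716, 71060920, 81071023, 61050817, 47040613, 57050716, 19020205,
 23020306, 41040511, 31030408, 63060817, 31030408, 49050613, 39040510, 79081021, 87091123,
 39040510, 79081021, 31030408, 49050613, 63060817, 81081022, 89091124, 71070919, 59060716,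
 31030408, 63060817, 107101429, 31030408, 65070817, 55060714, 47050612, 73080919, 73080919,
 111121429, 39040510, 47050612, 55060714, 39040510, 39040510, 23020306, 57060715, 49050613,
 37040410, 59060716, 67070818, 67070818, 93101125, 75080920, 83091022, 23020306, 49050613,
 56060715, 31030408, 49050613, 33030409, 19020205, 43040512, 29030308, 53050615, 39040411,
 81080923, 61060717, 71070820, 61060717, 51050614, 29030308, 59060716, 25020307, 19020205,
 40040511, 25020307, 25020307, 32030409, 25020307, 21020305, 35030509, 27020407, 49040713,
 61050916, 53040814, 61050916, 49040713, 61050916, 73061119, 23020306, 57050815, 87081223,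
 43040611, 55050814, 47040712, 59050915, 67061017, 79071220, 59050915, 33030508, 87081322,
 107101627, 99091525, 171162643, 53050813, 67061017, 75071119, 43040611, 23020306, 27020407,
 23020306, 49040713, 61050916, 27020407, 47040712, 47040712, 43040611, 89081323, 55050814,
 27020407, 31030408, 23020306, 43040611, 73071019, 43040611, 57050815, 65060917, 65060917,
 53050714, 39040510, 19020205, 49050613, 79081021, 65070817, 55060714, 73080919, 111121429,
 73080919, 57060715, 83091022, 47050612, 87091123, 29030407, 51050713, 71071018, 79081120,
 59060815, 43040611, 71071018, 39040510, 67070917, 55060714, 47050612, 75081019]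

set_option maxRecDepth 100000 in
theorem run4 : run table hints4 stk4 = stk5 := by decide +kernel

def stk6 : List St := [⟨1,8,2,11,7,35,1,2,1,0,0,0,0⟩,
 ⟨1,8,2,11,4,19,17,35,1,0,0,0,0⟩,
 ⟨1,8,2,11,4,19,1,2,35,4,6,7,17⟩,
 ⟨1,8,2,11,3,13,9,19,1,0,0,0,0⟩,
 ⟨1,8,2,11,3,13,1,2,19,2,3,4,9⟩,
 ⟨1,8,1,5,3,13,5,11,1,0,0,0,0⟩,
 ⟨1,8,1,5,3,13,1,2,11,1,2,2,5⟩,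
 ⟨1,8,1,5,2,7,6,13,1,0,0,0,0⟩,
 ⟨1,8,1,5,2,7,1,2,13,1,2,3,6⟩,
 ⟨1,8,1,5,1,3,3,7,1,0,0,0,0⟩,
 ⟨1,8,1,5,1,3,1,2,7,0,1,2,3⟩,
 ⟨1,8,1,8,1,3,1,2,1,0,0,0,0⟩,
 ⟨1,5,1,5,2,8,1,2,1,0,0,0,0⟩,
 ⟨1,5,1,5,1,3,3,8,1,0,0,0,0⟩,
 ⟨1,5,1,5,1,3,1,2,8,1,1,2,3⟩,
 ⟨1,5,1,5,1,5,1,2,1,0,0,0,0⟩,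
 ⟨1,4,1,3,1,3,2,5,1,0,0,0,0⟩,
 ⟨1,5,1,3,1,3,1,2,5,0,1,1,2⟩,
 ⟨1,4,1,3,1,3,1,3,1,0,0,0,0⟩,
 ⟨1,4,1,3,1,2,1,2,3,0,0,1,1⟩,
 ⟨1,4,1,3,1,2,1,1,2,0,0,0,1⟩]

def hints5 : List ℕ := [
 37040509, 111121528, 73081018, 147162037, 75081019, 59060815, 47050612, 59060815, 67070917,
 37040509, 51050713, 59060815, 87091222, 65070916, 57060814, 135141934, 151162138, 23020306,
 19020205, 29030407, 23020306, 39040510, 39040510, 43040611, 51050713, 59060815, 29030407,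
 47050711, 93101422, 73081117, 28030407, 20020305, 19020205, 34030509, 34030509, 99101526,
 19020205, 47050712, 19020205, 34030509, 29030407, 35030509, 41040610, 33030508, 63060916,
 95091424, 167162542, 73071118, 63060916, 49050712, 91091323, 159162340, 33030508, 20020305,
 42040611, 23020306, 27020407, 20020305, 55060813, 47050711, 67071016, 42040611, 28030407,
 20020305, 48050712, 11010103, 20020305, 28030407, 37040510, 41040611, 37040510, 29030408,
 47050713, 20020305, 64070918, 22020306, 23020306, 29020408, 47030713, 61040917, 75051121,
 179122651, 89061325, 25020307, 39030511, 53040715, 37030510, 83071123, 27020407, 59040916,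
 55040815, 73051120, 37030510, 41030611, 63050917, 77061121, 55040815, 75061120, 49040713,
 71061019, 40030611, 36030510, 25020307, 36030510, 11010103, 36030510, 40030611, 34030509,
 47040713, 30030408, 34030509, 11010103, 19020205, 39040411, 33040507, 41050609, 33040509,
 61070917, 60070917, 25030307, 34040509, 53060815, 25030307, 43050612, 46050713, 34040509,
 25030307, 43050612, 25030307, 67081019, 41050611, 53060815, 74091121, 41050611, 50060714,
 68081019, 41050611, 66081018, 53060815, 89111325, 46050713, 19020205, 17020204, 29030407,
 47050612, 27030307, 71080918, 79091020, 35040409, 89101123, 121141531, 111131428, 37040509,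
 45050611, 63070816, 71080918, 53060713, 83091121, 79091020, 61070815, 87101122, 147171937,
 69080917, 31030408, 52060713, 35040409, 27030307, 23020306, 27030406, 43050610, 21020305,
 71081017, 35040508, 55060813, 28030407, 36040509, 44050611, 21020305, 27030406, 43050610,
 35040508, 57070813, 41050609, 28030407, 43050611, 35040509, 20020305, 11010103, 35040509,
 28030407, 15010204, 27030407, 15010204, 26030307, 17020204, 43050611, 17020204, 58070815,
 49060613, 26030307, 50060713, 41050511, 57070815, 28030407, 17020204, 20020305, 27030407,
 42050611, 28030407, 20020305, 18020205, 27030407, 29030408, 49060713, 34040509, 11010202,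
 27020506, 31020607, 41030809, 87061720, 61041214, 71051416, 57041113, 23020405, 49040911,
 83071519, 35030608, 61051114, 71061316, 61051114, 45040810, 93081721, 35030608, 57051013,
 37030708, 41030809, 51041011, 87071719, 51041011, 91071820, 23020405, 91081720, 59051113,
 47040910, 61051213, 121102426, 67061314, 81071617, 71061415, 57051112, 91081819, 57051112,
 91081819, 57051112, 61051213, 93081820, 71061415, 79071517, 47040910, 51041011, 87071719,
 73061416, 23020405, 59051113, 23020405, 23020405, 36030708, 37030708, 41030809, 63051214,
 53041012, 31020607, 67051315, 53041012, 75061417, 23020405, 49040911, 75061417, 53041012,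
 59051113, 23020405, 31020607, 36030708, 19020304, 23020405, 31030507, 35030608, 53050912,
 41040709, 107111824, 59061013, 67071115, 49050811, 59061013, 59061013, 81081418, 71071216,
 49050811, 53050912, 101101723, 61061014, 41040709, 29030506, 51050911, 61061113, 89091619,
 79081417, 61061113, 39040708, 79081417, 41040709, 35030608, 45040810, 75071317, 63061114,
 73071316, 51050911, 29030506, 40040709, 31030507, 31030507, 9010102, 33040507, 59070913,
 77091217, 59070913, 65081014, 83101318, 41050609, 27030406, 35040508, 41050609, 35040607,
 29030506, 45050809, 73081315, 89101618, 63071113, 39040708, 73081315, 25030405, 77091316,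
 43050709, 53060911, 53060911, 43050709, 59071012, 49060810, 67081114, 101121721]

set_option maxRecDepth 100000 in
theorem run5 : run table hints5 stk5 = stk6 := by decide +kernel

def stk7 : List St := [⟨1,8,1,5,2,9,6,13,11,1,2,2,5⟩,
 ⟨1,8,1,5,3,12,4,9,1,0,0,0,0⟩,
 ⟨1,8,1,5,3,12,6,13,9,1,1,2,4⟩,
 ⟨1,8,1,5,2,7,5,12,1,0,0,0,0⟩,
 ⟨1,8,1,5,2,7,6,13,12,1,2,3,5⟩,
 ⟨1,8,1,5,2,7,1,2,13,1,2,3,6⟩,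
 ⟨1,8,1,5,1,3,3,7,1,0,0,0,0⟩,
 ⟨1,8,1,5,1,3,1,2,7,0,1,2,3⟩,
 ⟨1,8,1,8,1,3,1,2,1,0,0,0,0⟩,
 ⟨1,5,1,5,2,8,1,2,1,0,0,0,0⟩,
 ⟨1,5,1,5,1,3,3,8,1,0,0,0,0⟩,
 ⟨1,5,1,5,1,3,1,2,8,1,1,2,3⟩,
 ⟨1,5,1,5,1,5,1,2,1,0,0,0,0⟩,
 ⟨1,4,1,3,1,3,2,5,1,0,0,0,0⟩,
 ⟨1,5,1,3,1,3,1,2,5,0,1,1,2⟩,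
 ⟨1,4,1,3,1,3,1,3,1,0,0,0,0⟩,
 ⟨1,4,1,3,1,2,1,2,3,0,0,1,1⟩,
 ⟨1,4,1,3,1,2,1,1,2,0,0,0,1⟩]

def hints6 : List ℕ := [
 17020303, 41050708, 81101416, 51060910, 57071011, 41050708, 17020303, 25030405, 25030405,
 45050809, 53060911, 29030506, 59071012, 69081214, 97111720, 17020303, 17020303, 9010102,
 17020303, 28030506, 18020304, 37040608, 29030506, 31030507, 57060913, 67071115, 105111823,
 59061013, 113121925, 85091419, 23020405, 9010102, 57060913, 75081217, 33040507, 51060811,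
 69081115, 87101419, 29030506, 43050709, 53060911, 47050810, 61071013, 71081215, 33040507,
 25030405, 25030405, 17020303, 25030405, 9010102, 23020405, 31030507, 28030506, 17020303,
 29030506, 23020405, 25030405, 42050709, 23020405, 60071013, 42050709, 9010102, 41050809,
 42050809, 41050809, 57071113, 18020304, 21020404, 33030607, 67061314, 43040809, 77071516,
 87081718, 97091920, 127122526, 151143031, 23020405, 36030708, 23020405, 19020304, 33030607,
 43040809, 29030506, 49050910, 71071315, 49050910, 101101921, 69071314, 29030506, 23020405,
 22020405, 32030607, 23020405, 17020303, 55061011, 29030506, 49050910, 91091719, 53051011,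
 59061112, 49050910, 65071213, 133142527, 75081415, 79081516, 27030505, 37040707, 91101718,
 61071112, 29030506, 27030505, 35040607, 44050809, 28030506, 22020405, 43050809, 9010102,
 33040607, 17020303, 28030506, 32030607, 22020405, 19020304, 51051011, 22020405, 41040809,
 26030505, 47050910, 53061011, 19020304, 17020303, 19020304, 43050809, 33040607, 9010102,
 31030607, 37040708, 33040607, 42050809, 37040708, 46050910, 26030505, 12010203, 16010304,
 11000203, 18010305, 36020710, 22010406, 18010305, 29020508, 27020507, 40030711, 11000203,
 37030610, 74061320, 50040913, 49040913, 38030710, 37030610, 100081827, 38030710, 22010406,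
 51040914, 11000203, 38030710, 81061522, 40030711, 11000203, 25020407, 39030711, 29020508,
 11000203, 25020407, 39030711, 25020407, 26020507, 46030913, 53041015, 53041015, 51041014,
 51041014, 61051217, 27020507, 18010305, 31020608, 11000203, 11000203, 37020710, 56041115,
 29020508, 32020609, 51041013, 31020608, 26020507, 32020609, 41030811, 32020609, 37030710,
 9010102, 20020305, 11010103, 25020407, 57050916, 37030610, 31030508, 37030610, 25020407,
 32030509, 51050814, 31030508, 51050814, 32030509, 43040712, 31030508, 22020306, 29030408,
 11010103, 22020306, 11010103, 64070918, 19020305, 32030509, 43040712, 29030408, 49050813,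
 61061017, 25020407, 25020407, 29030408, 47050713, 32030509, 39040611, 29030408, 39040611,
 39040611, 38040610, 57060916, 25020407, 37040610, 61061017, 56060915, 56060915, 40040611,
 31030508, 19020305, 59060916, 11010103, 46050712, 48050713, 19020305, 11010103, 19020305,
 25020407, 32030509, 26030407, 39040611, 46050713, 32030509, 33040509, 61070917, 60070917,
 25030307, 34040509, 53060815, 25030307, 43050612, 46050713, 34040509, 25030307, 43050612,
 25030307, 67081019, 41050611, 53060815, 74091121, 41050611, 50060714, 68081019, 41050611,
 66081018, 53060815, 89111325, 46050713, 33040509, 46050713, 52060814, 39040611, 34040509,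
 51060814, 193233054, 32030509, 34040509, 26030407, 32030509, 37040610, 25020407, 82091323,
 44050712, 62071017, 44050712, 37040610, 57070915, 34040509, 25030407, 27030407, 18020205,
 11010103, 42050611, 35040509, 57070815, 29030408, 49060713, 34040509, 20020305, 25030406,
 25030406, 20020305, 9010102, 21020405, 11010202, 46040911, 57051114, 22020405, 29030507,
 11010202, 22020405, 11010202, 22020405, 11010202, 57061014, 37040609, 38040709, 49050912,
 11010202, 47050911, 31030607, 38040709, 22020405, 42040810, 38040709, 41040810, 49050912,
 29030507, 37040709, 41040810, 57061114, 46050911, 11010202, 41050809, 42050809]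

set_option maxRecDepth 100000 in
theorem run6 : run table hints6 stk6 = stk7 := by decide +kernel

def stk8 : List St := [⟨3,40,4,22,1,3,7,17,28,2,5,9,11⟩,
 ⟨1,13,3,16,1,3,9,22,28,2,5,9,11⟩,
 ⟨1,13,1,5,5,16,7,17,1,0,0,0,0⟩,
 ⟨1,13,1,5,1,3,7,17,16,1,3,5,6⟩,
 ⟨1,13,1,5,1,3,3,7,17,1,3,5,7⟩,
 ⟨1,8,2,13,1,3,3,7,1,0,0,0,0⟩,
 ⟨1,8,1,5,4,13,3,7,1,0,0,0,0⟩,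
 ⟨1,8,1,5,1,3,5,13,1,0,0,0,0⟩,
 ⟨1,8,1,5,1,3,3,7,13,1,2,4,5⟩,
 ⟨1,8,1,5,1,3,1,2,7,0,1,2,3⟩,
 ⟨1,8,1,8,1,3,1,2,1,0,0,0,0⟩,
 ⟨1,5,1,5,2,8,1,2,1,0,0,0,0⟩,
 ⟨1,5,1,5,1,3,3,8,1,0,0,0,0⟩,
 ⟨1,5,1,5,1,3,1,2,8,1,1,2,3⟩,
 ⟨1,5,1,5,1,5,1,2,1,0,0,0,0⟩,
 ⟨1,4,1,3,1,3,2,5,1,0,0,0,0⟩,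
 ⟨1,5,1,3,1,3,1,2,5,0,1,1,2⟩,
 ⟨1,4,1,3,1,3,1,3,1,0,0,0,0⟩,
 ⟨1,4,1,3,1,2,1,2,3,0,0,1,1⟩,
 ⟨1,4,1,3,1,2,1,1,2,0,0,0,1⟩]

def hints7 : List ℕ := [
 33040607, 42050809, 46050910, 21020405, 17020304, 61071115, 37040709, 43050810, 113132128,
 37040709, 34040608, 33040608, 69081317, 25030406, 26030506, 41050809, 57071113, 52061012,
 17020304, 41050809, 17020304, 26030506, 17020304, 37040709, 41040810, 26030506, 46050911,
 26030506, 18020304, 25030406, 11010203, 18020305, 17020304, 29030508, 29030508, 25030407,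
 17020304, 17020304, 27030507, 37040710, 41040811, 17020304, 41050810, 26030507, 42050811,
 57071115, 67081318, 41050811, 17020304, 37040710, 46050912, 26030507, 26030507, 42050811,
 26030507, 56061115, 18020305, 22020406, 67071319, 47050913, 22020406, 26030507, 37040710,
 33040609, 27030507, 23020406, 16010304, 18010305, 38030710, 24020406, 51040914, 60051116,
 84071523, 83071522, 71061319, 94081725, 117102132, 11000203, 35030609, 25020407, 39030711,
 26020507, 37030710, 19020305, 18010305, 42040711, 24020406, 47040813, 11010103, 53050914,
 11010103, 20020305, 30030508, 65061118, 52050914, 41040711, 31030508, 30030508, 25020407,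
 9010102, 20020305, 43050711, 35040609, 25030406, 18020305, 28030507, 16010304, 20020305,
 24020406, 11010202, 31030508, 31030508, 43040811, 50050913, 59061115, 39040710, 21020405,
 9010102, 20020305, 24020406, 29030507, 25030406, 35040609, 17020304, 35040609, 17020304,
 17020304, 36040709, 31030608, 26030506, 19020305, 11010203, 26020507, 58051116, 60051117,
 29030508, 40040711, 51050914, 53050915, 31030608, 56051115, 21020405, 49050913, 21020405,
 30030508, 26020507, 21020405, 17020304, 28030507, 21020405, 36040709, 31030608, 27030507,
 11010203, 18020305, 17020304, 29030508, 27030507, 48050913, 56061115, 31030608, 17020304,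
 17020304, 9010102, 26020407, 17010304, 25020406, 27020407, 29020507, 39030610, 53040913,
 43030711, 67051117, 91071523, 65051116, 77061319, 115091929, 191153248, 89071522, 19010305,
 23010406, 21020305, 27020407, 33030508, 39030610, 59050915, 51040813, 45040711, 83071321,
 57050914, 115101829, 79071220, 34030509, 19010305, 39040609, 51050812, 20020305, 34030509,
 19010305, 31030507, 35030608, 97081723, 155132737, 43040710, 47040811, 55050913, 67061116,
 53050912, 23020405, 39040609, 51050812, 21020305, 19020304, 30030507, 21020305, 30030507,
 20020305, 12010203, 19010305, 63051116, 42030711, 64051117, 32030508, 15010204, 19010305,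
 43040711, 55050914, 23020306, 34030509, 53050814, 21020305, 31030508, 15010204, 53050913,
 23020405, 21020305, 30030507, 53050913, 23020405, 21020305, 21020305, 49050812, 19020304,
 19020304, 29030507, 37040609, 23020405, 27020506, 39030709, 107091925, 35030608, 26020506,
 31030507, 35030608, 43040710, 53050912, 39040609, 19020304, 11010202, 26020506, 40040709,
 28030506, 12010203, 39030710, 15010204, 28020507, 26020506, 16010304, 20020305, 43040711,
 15010204, 31030508, 31030508, 11010202, 26020506, 37030709, 45040811, 29030507, 41040710,
 30030507, 37040609, 30030507, 28030506, 15010204, 13010204, 17010305, 22010407, 31010610,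
 26010508, 47020915, 26010508, 61021220, 46020915, 19010306, 40020713, 26010508, 19010306,
 36020711, 19010306, 36020711, 37020712, 91051830, 43020814, 31010610, 47020915, 19010306,
 40020713, 19010306, 26010508, 31010610, 41020813, 31010610, 37020712, 46020915, 58031119,
 56031118, 36020711, 19010306, 31020510, 46030815, 41030713, 43030714, 53040917, 82061427,
 29020509, 40030713, 29020509, 43030714, 31020510, 52030917, 40030613, 29020509, 41030713,
 16010305, 37020712, 52031017, 67041322, 22010407, 52031017, 71041423, 28020509, 22010407,
 43030814, 86061628, 49030916, 44030814, 40030713, 79061426, 22010407, 40030713]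

set_option maxRecDepth 100000 in
theorem run7 : run table hints7 stk7 = stk8 := by decide +kernel

def stk9 : List St := [⟨2,21,1,5,14,47,35,86,11,1,2,3,4⟩,
 ⟨2,21,1,5,10,33,19,47,11,1,2,3,4⟩,
 ⟨1,8,4,21,4,13,9,22,11,1,2,3,4⟩,
 ⟨1,8,1,5,6,21,9,22,11,1,2,3,4⟩,
 ⟨1,8,1,5,4,13,8,21,11,1,2,3,4⟩,
 ⟨2,21,4,21,6,21,3,7,11,1,2,3,4⟩,
 ⟨1,8,1,5,1,3,5,13,1,0,0,0,0⟩,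
 ⟨1,8,1,5,1,3,3,7,13,1,2,4,5⟩,
 ⟨1,8,1,5,1,3,1,2,7,0,1,2,3⟩,
 ⟨1,8,1,8,1,3,1,2,1,0,0,0,0⟩,
 ⟨1,5,1,5,2,8,1,2,1,0,0,0,0⟩,
 ⟨1,5,1,5,1,3,3,8,1,0,0,0,0⟩,
 ⟨1,5,1,5,1,3,1,2,8,1,1,2,3⟩,
 ⟨1,5,1,5,1,5,1,2,1,0,0,0,0⟩,
 ⟨1,4,1,3,1,3,2,5,1,0,0,0,0⟩,
 ⟨1,5,1,3,1,3,1,2,5,0,1,1,2⟩,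
 ⟨1,4,1,3,1,3,1,3,1,0,0,0,0⟩,
 ⟨1,4,1,3,1,2,1,2,3,0,0,1,1⟩,
 ⟨1,4,1,3,1,2,1,1,2,0,0,0,1⟩]

def hints8 : List ℕ := [
 139102546, 61041120, 40030713, 55041018, 70051323, 49030916, 27020508, 42030813, 32020610,
 31020610, 97061932, 37020712, 28020509, 43030814, 79051526, 73051424, 47030915, 57041118,
 41030813, 22010407, 34020611, 29020509, 19010306, 19010306, 19010306, 16010305, 36020711,
 19010306, 26010508, 29020509, 33020610, 33020610, 31020609, 36020711, 26010508, 33020610,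
 27020508, 27020508, 43030813, 26010508, 27020508, 46030914, 29020509, 10010103, 22020307,
 34030511, 61050920, 106091635, 139122146, 40030613, 47040715, 68061022, 46040715, 67061022,
 193172964, 33030510, 41040613, 34030511, 31030410, 43040614, 55050818, 76071125, 41040613,
 47040715, 31030410, 17020205, 27030408, 47050714, 33040509, 66081019, 34040510, 41050612,
 28030409, 43050614, 58070819, 33040510, 41050613, 34040511, 49060716, 67081022, 34040511,
 46050715, 43050614, 88101329, 43050614, 49060716, 41050613, 22020307, 19020206, 31030410,
 17020205, 17020205, 37040512, 46050615, 55060718, 25030308, 52060717, 17020205, 29030409,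
 20020306, 41040613, 19020206, 20020306, 43050613, 36040511, 47050714, 27030408, 20020306,
 35040511, 42050613, 20020306, 28030409, 20020306, 25030308, 37040512, 43050614, 35040511,
 20020306, 11010203, 17010305, 12010203, 24020407, 12010203, 26020507, 31020609, 38030711,
 52041015, 61051217, 46040913, 56051116, 41030812, 36030710, 24020407, 38030711, 26020507,
 59051117, 26020507, 27020508, 37030711, 36030711, 57051117, 56051117, 23020407, 23020407,
 47040914, 47040914, 36030711, 37030711, 56041117, 27020508, 31020609, 33020610, 33020610,
 36020711, 12010203, 40030712, 49040915, 23020407, 12010203, 31020609, 38030711, 51041015,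
 18020305, 12010203, 17010305, 40030712, 10010103, 31030509, 33030510, 19020305, 31030509,
 61061018, 38040611, 20020306, 10010103, 23020407, 17010305, 34030610, 46040814, 56051017,
 61061118, 28030508, 41040712, 17010305, 39040711, 47050814, 34030610, 17010305, 29030508,
 41040712, 47050814, 17010305, 29030508, 37040611, 34030610, 37040611, 17010305, 29030508,
 37040611, 56061016, 84091525, 61061118, 64071119, 23020407, 28030508, 20020306, 24020407,
 29030508, 31030509, 52050915, 40040711, 19020305, 19020305, 27030408, 10010103, 31030509,
 33030510, 19020305, 31030509, 61061018, 38040611, 20020306, 10010103, 17020205, 41050612,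
 17020205, 36040511, 19020305, 26030407, 33040509, 17020205, 34040510, 66081019, 41050612,
 58070917, 52060815, 25030407, 31030509, 17020205, 43050712, 55060916, 34040510, 62071018,
 41050612, 58070917, 17020205, 50060814, 75091222, 49060814, 67081119, 41050612, 65081019,
 31030509, 38040611, 26030407, 45050713, 25030407, 10010103, 20020306, 10010103, 20020306,
 10010103, 17020205, 19020305, 54060816, 26030407, 44050713, 31030509, 25030407, 12010203,
 17020304, 29030508, 19020305, 17020304, 29030508, 17020305, 34040610, 12010203, 35040610,
 37040611, 28030508, 27030408, 29030508, 63071118, 17010305, 62071118, 28030508, 10010103,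
 23020407, 37040611, 25030407, 44050713, 42050712, 89101526, 112131933, 229273967, 43050713,
 10010103, 25030407, 29030508, 25030407, 17020304, 17020304, 17020305, 23020407, 28030508,
 43050713, 36040611, 41050712, 43050713, 58071017, 33040510, 28030508, 12010203, 17020304,
 26030506, 27030507, 37040710, 41040811, 17020304, 41050810, 26030507, 42050811, 57071115,
 67081318, 41050811, 17020304, 37040710, 46050912, 26030507, 26030507, 42050811, 26030507,
 56061115, 27030507, 31030608, 19020305, 26020507, 41040811, 19020305, 17020304, 17020304,
 17020304, 36040709, 19020305, 22020406, 21020406, 33030610, 47040914, 86081725]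

set_option maxRecDepth 100000 in
theorem run8 : run table hints8 stk8 = stk9 := by decide +kernel

def stk10 : List St := [⟨1,14,3,18,4,13,5,11,7,0,1,2,3⟩,
 ⟨1,14,4,21,4,13,8,18,7,0,1,2,3⟩,
 ⟨1,14,1,5,1,3,6,13,7,0,1,2,3⟩,
 ⟨1,8,1,8,1,3,1,2,1,0,0,0,0⟩,
 ⟨1,5,1,5,2,8,1,2,1,0,0,0,0⟩,
 ⟨1,5,1,5,1,3,3,8,1,0,0,0,0⟩,
 ⟨1,5,1,5,1,3,1,2,8,1,1,2,3⟩,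
 ⟨1,5,1,5,1,5,1,2,1,0,0,0,0⟩,
 ⟨1,4,1,3,1,3,2,5,1,0,0,0,0⟩,
 ⟨1,5,1,3,1,3,1,2,5,0,1,1,2⟩,
 ⟨1,4,1,3,1,3,1,3,1,0,0,0,0⟩,
 ⟨1,4,1,3,1,2,1,2,3,0,0,1,1⟩,
 ⟨1,4,1,3,1,2,1,1,2,0,0,0,1⟩]

def hints9 : List ℕ := [
 32030609, 87081726, 43040813, 18020305, 10010103, 33030610, 32030609, 28030508, 48050914,
 71071321, 91091727, 37030711, 58061117, 49050914, 38040711, 59061117, 33030610, 38040711,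
 23020407, 37040711, 33040609, 17020305, 27030508, 18020305, 67071319, 47050913, 26030507,
 37040710, 33040609, 27030507, 27030508, 41050812, 17020305, 12010203, 11010203, 16010305,
 37030712, 46040915, 19020306, 40040713, 34030611, 79081426, 29030509, 34040511, 58070919,
 17020305, 29030509, 42050713, 34040610, 29030509, 51060916, 28030509, 25030408, 17020305,
 34040611, 52060917, 58071019, 17020305, 52060917, 35040611, 29030509, 37040612, 28030509,
 40040713, 37040612, 46050815, 40040713, 37040612, 58070919, 34040511, 25030408, 34040511,
 42050713, 25030408, 43050714, 25030408, 28030509, 52060917, 29030509, 17020305, 28030509,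
 31030610, 61061220, 58061119, 67071322, 61071219, 36040711, 26030508, 37040712, 46050915,
 26030508, 61071220, 31030610, 79091526, 46050915, 26030508, 31030610, 37040712, 64071221,
 61071120, 53061017, 26030508, 46050915, 97111932, 43050814, 58071119, 49060916, 41050813,
 61071220, 67081322, 67081322, 82101627, 52061017, 41050813, 77091525, 37040712, 34040611,
 26030508, 28030509, 42050813, 25030408, 25030408, 22020407, 27030508, 16010305, 19020306,
 21020406, 56061117, 29030509, 29030509, 46050914, 19020306, 17020305, 45050814, 21020406,
 41050812, 17020305, 36040711, 19020306, 21020406, 16010305, 23020407, 17010305, 25020408,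
 19010306, 26020408, 53040917, 79061326, 77061325, 40030713, 52040917, 64051121, 41030713,
 26020408, 64051021, 58050919, 202173267, 70061123, 26020408, 29020509, 12010203, 16010305,
 28020509, 25020408, 40030713, 52040917, 39030712, 25020408, 35030611, 38030712, 22010407,
 49040916, 26020508, 27020508, 10010103, 25020408, 19010306, 31020510, 43030714, 52040917,
 55040918, 67051122, 53040917, 89071529, 64051121, 41030713, 22020307, 26020408, 34030511,
 46040715, 64051021, 58050919, 202173267, 70061123, 26020408, 19010306, 32030510, 26020408,
 32030510, 12010203, 19010306, 67061121, 19010306, 35030611, 22020307, 41030713, 12010203,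
 31030509, 42040713, 41040712, 35030611, 31030510, 43040714, 58051019, 19020306, 31030510,
 43040714, 58051019, 41040713, 26030408, 28030409, 26030408, 18020305, 29030509, 11010203,
 16010305, 49040916, 19020306, 34030611, 31030510, 52050917, 39040712, 26030408, 26030408,
 29030509, 14010204, 13000204, 21010306, 35010511, 49010716, 55010818, 61010920, 79011226,
 67011022, 73011124, 53010817, 41010613, 47010715, 53010817, 37010512, 46010715, 41010613,
 40010613, 27010408, 33010510, 61020919, 29010409, 29010409, 49020715, 89041327, 28010409,
 34010511, 40010613, 31010410, 29010409, 48020715, 22010307, 22010307, 28010409, 17010205,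
 20010306, 36020511, 16010205, 35020511, 20010306, 20010306, 15010204, 29020409, 16010205,
 20010306, 34020511, 11000203, 21010306, 31010509, 17000305, 47010814, 53010916, 23000407,
 59011018, 37010611, 43010713, 49010815, 33010510, 69021121, 41010712, 65021119, 35010610,
 40010712, 37010611, 33010510, 35010610, 45010813, 41010712, 27010408, 33010510, 57020917,
 23010307, 43020613, 45020713, 51020815, 35010610, 39010711, 25010407, 59021017, 25010407,
 30010509, 40010712, 25010407, 44020713, 24010407, 17000305, 27010408, 25010407, 23010406,
 25010407, 24010407, 18010305, 24010407, 30010509, 20010306, 43020713, 28010508, 19010305,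
 20010306, 20010306, 43020713, 17010205, 32020509, 17010205, 19010305, 15010204, 31020509,
 15010204, 17010305, 23010407, 21010406, 27010508, 18010305, 27010508, 20010306]

set_option maxRecDepth 100000 in
theorem run9 : run table hints9 stk9 = stk10 := by decide +kernel

def stk11 : List St := [⟨2,25,7,79,1,3,1,2,13,1,1,4,6⟩,
 ⟨1,11,1,11,8,25,1,2,13,1,1,4,6⟩,
 ⟨1,8,1,8,3,11,1,2,1,0,0,0,0⟩,
 ⟨1,8,1,8,1,3,5,11,1,0,0,0,0⟩,
 ⟨1,8,1,8,1,3,1,2,11,1,1,3,5⟩,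
 ⟨1,5,1,5,2,8,1,2,1,0,0,0,0⟩,
 ⟨1,5,1,5,1,3,3,8,1,0,0,0,0⟩,
 ⟨1,5,1,5,1,3,1,2,8,1,1,2,3⟩,
 ⟨1,5,1,5,1,5,1,2,1,0,0,0,0⟩,
 ⟨1,4,1,3,1,3,2,5,1,0,0,0,0⟩,
 ⟨1,5,1,3,1,3,1,2,5,0,1,1,2⟩,
 ⟨1,4,1,3,1,3,1,3,1,0,0,0,0⟩,
 ⟨1,4,1,3,1,2,1,2,3,0,0,1,1⟩,
 ⟨1,4,1,3,1,2,1,1,2,0,0,0,1⟩]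

def hints10 : List ℕ := [
 20010306, 17010305, 23010407, 23010407, 16010304, 23010407, 16000305, 29010509, 40010713,
 11000203, 46010815, 43010814, 35010611, 31010510, 11000203, 35010611, 31010510, 34010611,
 38010712, 31010510, 24010407, 25010408, 11000203, 28010509, 34010611, 52020917, 25010408,
 11000203, 27010508, 36010711, 26010508, 28010509, 37010712, 31010610, 26010508, 20010306,
 25010408, 31010510, 35010611, 46020715, 24010407, 42020713, 16010205, 22010307, 34020511,
 18010305, 19010306, 25010408, 16010205, 52030817, 46030715, 18010305, 45030714, 30020509,
 16010205, 18010305, 27010508, 11000203, 11000203, 20010306, 11000203, 21010406, 21010406,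
 20010306, 21010406, 17010305, 16010304, 19010306, 28010509, 31010610, 37010712, 26010508,
 21010406, 17010305, 21010406, 21010406, 11010103, 13010104, 19010206, 25010308, 43020514,
 79040926, 61030720, 121061440, 61030720, 97051132, 61030720, 109051336, 85041028, 103051234,
 59030719, 43020514, 49020616, 67030822, 91041130, 41020513, 59030719, 31020310, 49030516,
 79050826, 97061032, 67040722, 43030414, 67050622, 55040518, 109081036, 55040518, 79060726,
 133101244, 55040518, 73050724, 85060828, 97070932, 53040517, 41030413, 29020309, 97071031,
 59040619, 29020309, 69050722, 53040517, 43030414, 49030516, 61040620, 79050826, 109071136,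
 73050724, 103071034, 59040619, 59040619, 93070930, 41030413, 71050723, 70050723, 29020309,
 17010205, 29020309, 61040719, 45030514, 35020411, 27020308, 43030513, 55040617, 97071130,
 69050821, 71050822, 69050821, 81060925, 53040616, 95071129, 45030514, 55040617, 67050721,
 71050822, 27020308, 43030513, 33020410, 35020411, 51030616, 77050924, 75050923, 59040718,
 29020309, 27020308, 57040717, 27020308, 29020309, 28020309, 17010205, 43030514, 49030616,
 34020411, 17010205, 70050823, 43030514, 41030513, 17010205, 37020412, 25010308, 43020514,
 79040926, 115061338, 151081750, 103061134, 35020411, 41020513, 25010308, 93051130, 25010308,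
 29020309, 37020412, 61030720, 115061338, 151081750, 31020310, 49030516, 67040722, 103061134,
 35020411, 47030515, 81050926, 53030617, 45030514, 63040720, 46030515, 52030617, 31020310,
 28020309, 46030515, 43030514, 40030413, 27020308, 17010205, 43030513, 33020410, 57040717,
 37030411, 23020207, 49040515, 47040514, 105091132, 95081029, 75060823, 47040514, 67060720,
 57050617, 79070824, 57050617, 79070824, 57050617, 93081028, 69060721, 79070824, 47040514,
 111091234, 73060822, 95081029, 49040515, 25020307, 17010205, 41030512, 45040513, 35030410,
 17010205, 51040615, 59050717, 61050718, 69060820, 17010205, 35030410, 89081026, 71060821,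
 35030410, 17010205, 59050717, 75060922, 49040614, 107091331, 57050716, 17010205, 34030410,
 59050718, 17010205, 37030411, 63050719, 43030513, 53040616, 89071027, 77060923, 71060821,
 45040513, 23020207, 25020308, 37030412, 46040515, 34030411, 79070926, 35030411, 34030411,
 46040515, 61050720, 59050719, 50040616, 49040616, 37030412, 34030411, 49040616, 58050719,
 19010206, 25020208, 53040517, 43030414, 65050621, 55040518, 67050622, 79060726, 91070830,
 103080934, 127101142, 115091038, 41030413, 39030412, 29020309, 31020310, 43030414, 40030413,
 23020207, 39030412, 41030413, 35030311, 117101137, 85070827, 73060723, 63050620, 51040516,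
 73060723, 35030311, 71060722, 61050619, 29020309, 34030311, 40030413, 61050620, 49040516,
 49040516, 39030412, 23020207, 49040515, 61050619, 35030311, 71060722, 26020308, 23020207,
 29020309, 27020308, 35030411, 29020309, 26020308, 28020309, 49040516, 58050619, 36030411,
 37030412, 13010104, 67050622, 79060726, 133101244, 25020208, 67050622, 79060726]

set_option maxRecDepth 100000 in
theorem run10 : run table hints10 stk10 = stk11 := by decide +kernel

def stk12 : List St := [⟨1,9,4,21,10,49,1,2,11,1,2,2,5⟩,
 ⟨1,9,4,21,5,23,19,39,11,1,2,2,5⟩,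
 ⟨4,38,7,38,8,38,1,2,11,1,2,2,5⟩,
 ⟨1,9,1,5,5,23,10,21,11,1,2,2,5⟩,
 ⟨1,9,1,5,3,13,11,23,11,1,2,2,5⟩,
 ⟨1,9,1,5,2,8,6,13,1,0,0,0,0⟩,
 ⟨1,9,1,5,2,8,1,2,13,1,2,3,6⟩,
 ⟨1,7,1,5,2,9,1,2,1,0,0,0,0⟩,
 ⟨1,7,1,5,2,8,4,9,1,0,0,0,0⟩,
 ⟨1,7,1,5,2,8,1,2,9,1,1,2,4⟩,
 ⟨1,7,1,7,2,8,1,2,1,0,0,0,0⟩,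
 ⟨1,5,1,5,2,8,3,7,1,0,0,0,0⟩,
 ⟨1,5,1,5,2,8,1,2,7,1,1,1,3⟩,
 ⟨1,5,1,5,1,3,3,8,1,0,0,0,0⟩,
 ⟨1,5,1,5,1,3,1,2,8,1,1,2,3⟩,
 ⟨1,5,1,5,1,5,1,2,1,0,0,0,0⟩,
 ⟨1,4,1,3,1,3,2,5,1,0,0,0,0⟩,
 ⟨1,5,1,3,1,3,1,2,5,0,1,1,2⟩,
 ⟨1,4,1,3,1,3,1,3,1,0,0,0,0⟩,
 ⟨1,4,1,3,1,2,1,2,3,0,0,1,1⟩,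
 ⟨1,4,1,3,1,2,1,1,2,0,0,0,1⟩]

def hints11 : List ℕ := [
 91070830, 103080934, 127101142, 115091038, 23020207, 9010102, 19020205, 41040511, 49050613,
 59060716, 49050613, 37040410, 59060716, 67070818, 67070818, 93101125, 75080920, 83091022,
 57060715, 27030307, 17020204, 35040409, 17020204, 19020205, 10010103, 25020308, 34030411,
 43040514, 64060721, 31030310, 61060720, 52050617, 71070823, 62060720, 73070824, 53050617,
 52050617, 53050617, 43040514, 76070925, 31030310, 34030411, 49040616, 42040513, 41040513,
 9010102, 17020205, 19020206, 20020206, 34030411, 52050617, 70070823, 49050516, 97101132,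
 125131441, 25020308, 29030309, 25020308, 91091130, 49050616, 58060719, 9010102, 20020206,
 65070820, 17020205, 26030308, 35040411, 17020205, 10010103, 13010104, 21020206, 35030410,
 47040514, 33030310, 57050617, 67060720, 87080926, 43040413, 107101132, 53050516, 45040513,
 55050616, 65060719, 75070822, 56050617, 27020308, 25020307, 43040512, 33030409, 17010205,
 27020308, 23020207, 25020307, 25020307, 43040512, 53050615, 33030409, 51050614, 43040512,
 17010205, 36030411, 33030410, 22020207, 42040513, 13010104, 21020206, 23020207, 19020205,
 21020206, 35030410, 45040513, 55050616, 67060720, 65060719, 75070822, 85080925, 25020307,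
 43040512, 33030409, 17010205, 25020307, 43040512, 25020307, 29030308, 53050615, 39040411,
 81080923, 61060717, 71070820, 33030409, 61060717, 51050614, 29030308, 59060716, 25020307,
 25020307, 17010205, 41040512, 41040512, 21020206, 67060720, 9010102, 28030308, 17010205,
 41040512, 37040411, 7010101, 9010102, 13010203, 17010304, 21010405, 37020709, 41020810, 71041417,
 29020507, 41030710, 31020607, 27020506, 43030810, 57041113, 69051316, 99071923, 69051316,
 43030810, 53041012, 95071822, 83061619, 27020506, 41030809, 57041113, 47030911, 61041214,
 73051417, 27020506, 71051416, 41030809, 27020506, 21010405, 29020507, 33020608, 37020709,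
 45030811, 75051418, 43030810, 59041114, 83061520, 55041013, 27020506, 31020607, 51031012,
 47030911, 43030810, 55041013, 41030810, 21020305, 29030407, 37040509, 57060814, 47050711,
 93101422, 73081117, 29030407, 33030508, 41040610, 55060813, 47050711, 67071016, 11010202,
 27020506, 31020607, 41030809, 87061720, 61041214, 71051416, 57041113, 23020405, 49040911,
 83071519, 35030608, 61051114, 71061316, 61051114, 45040810, 93081721, 35030608, 57051013,
 37030708, 41030809, 51041011, 87071719, 51041011, 91071820, 23020405, 91081720, 59051113,
 47040910, 61051213, 121102426, 67061314, 81071617, 71061415, 57051112, 91081819, 57051112,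
 91081819, 57051112, 61051213, 93081820, 71061415, 79071517, 47040910, 51041011, 87071719,
 73061416, 23020405, 59051113, 23020405, 23020405, 36030708, 37030708, 41030809, 63051214,
 53041012, 31020607, 67051315, 53041012, 75061417, 23020405, 49040911, 75061417, 53041012,
 59051113, 23020405, 31020607, 36030708, 23020405, 19020304, 31030507, 35030608, 53050912,
 41040709, 107111824, 59061013, 67071115, 49050811, 59061013, 59061013, 81081418, 71071216,
 49050811, 53050912, 101101723, 61061014, 41040709, 31030507, 57060913, 75081217, 37040608,
 29030506, 67071115, 105111823, 59061013, 113121925, 85091419, 29030506, 29030506, 51050911,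
 61061113, 89091619, 79081417, 61061113, 19020304, 37040608, 19020304, 39040708, 79081417,
 39040708, 73081315, 19020304, 28030506, 41040709, 35030608, 45040810, 75071317, 63061114,
 73071316, 29030506, 51050911, 19020304, 40040709, 31030507, 31030507, 23020405, 21020404,
 33030607, 67061314, 43040809, 77071516, 87081718, 97091920, 127122526, 151143031, 39040708,
 33030607, 49050910, 43040809, 71071315, 101101921, 69071314, 49050910]

set_option maxRecDepth 100000 in
theorem run11 : run table hints11 stk11 = stk12 := by decide +kernel

def stk13 : List St := [⟨1,7,2,11,2,9,12,25,1,0,0,0,0⟩,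
 ⟨1,7,2,11,2,9,1,2,25,3,4,5,12⟩,
 ⟨1,7,2,11,2,11,1,2,1,0,0,0,0⟩,
 ⟨1,7,1,5,2,9,5,11,1,0,0,0,0⟩,
 ⟨1,7,1,5,2,9,1,2,11,1,2,2,5⟩,
 ⟨1,7,1,5,2,8,4,9,1,0,0,0,0⟩,
 ⟨1,7,1,5,2,8,1,2,9,1,1,2,4⟩,
 ⟨1,7,1,7,2,8,1,2,1,0,0,0,0⟩,
 ⟨1,5,1,5,2,8,3,7,1,0,0,0,0⟩,
 ⟨1,5,1,5,2,8,1,2,7,1,1,1,3⟩,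
 ⟨1,5,1,5,1,3,3,8,1,0,0,0,0⟩,
 ⟨1,5,1,5,1,3,1,2,8,1,1,2,3⟩,
 ⟨1,5,1,5,1,5,1,2,1,0,0,0,0⟩,
 ⟨1,4,1,3,1,3,2,5,1,0,0,0,0⟩,
 ⟨1,5,1,3,1,3,1,2,5,0,1,1,2⟩,
 ⟨1,4,1,3,1,3,1,3,1,0,0,0,0⟩,
 ⟨1,4,1,3,1,2,1,2,3,0,0,1,1⟩,
 ⟨1,4,1,3,1,2,1,1,2,0,0,0,1⟩]

def hints12 : List ℕ := [
 55061011, 65071213, 133142527, 75081415, 79081516, 37040707, 91101718, 19020304, 29030506,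
 29030506, 47050910, 19020304, 32030607, 22020405, 28030506, 49050911, 21020404, 47050910,
 51051011, 19020304, 22020405, 37040708, 41040809, 21020405, 11010202, 46040911, 57051114,
 22020405, 29030507, 11010202, 22020405, 11010202, 22020405, 11010202, 57061014, 37040609,
 38040709, 49050912, 11010202, 47050911, 31030607, 38040709, 22020405, 42040810, 38040709,
 41040810, 49050912, 29030507, 37040709, 41040810, 57061114, 46050911, 17010304, 21020305,
 25020406, 53040913, 29020507, 45040711, 33030508, 35030608, 97081723, 155132737, 43040710,
 47040811, 55050913, 67061116, 23020405, 23020405, 31030507, 35030608, 47040811, 43040710,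
 47040811, 55050913, 53050912, 23020405, 39040609, 51050812, 19020304, 30030507, 30030507,
 53050913, 49050812, 19020304, 29030507, 37040609, 23020405, 27020506, 39030709, 107091925,
 35030608, 26020506, 31030507, 35030608, 43040710, 53050912, 39040609, 19020304, 11010202,
 26020506, 40040709, 28030506, 11010202, 26020506, 37030709, 45040811, 29030507, 41040710,
 30030507, 37040609, 30030507, 28030506, 11010202, 37030708, 41030809, 51041011, 87071719,
 51041011, 91071820, 23020405, 91081720, 59051113, 47040910, 61051213, 121102426, 67061314,
 81071617, 71061415, 57051112, 91081819, 57051112, 91081819, 57051112, 61051213, 93081820,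
 71061415, 79071517, 47040910, 51041011, 87071719, 73061416, 23020405, 59051113, 23020405,
 25030405, 19020304, 23020405, 29030506, 41040709, 29030506, 51050911, 61061113, 89091619,
 79081417, 61061113, 39040708, 79081417, 29030506, 41040709, 73071316, 51050911, 51060811,
 59070913, 35040607, 29030506, 45050809, 73081315, 89101618, 63071113, 39040708, 73081315,
 77091316, 43050709, 53060911, 53060911, 43050709, 17020303, 51060910, 45050809, 53060911,
 29030506, 59071012, 69081214, 97111720, 17020303, 17020303, 29030506, 37040608, 59061013,
 47050810, 51060811, 69081115, 87101419, 43050709, 53060911, 47050810, 61071013, 71081215,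
 59071013, 28030506, 23020405, 15020203, 33040507, 51060811, 59070913, 77091217, 19020304,
 59070913, 23030305, 41050609, 47060710, 101131522, 55070812, 73091116, 87111319, 47060710,
 61080913, 93121420, 47060710, 77101117, 69091015, 41050609, 39050608, 19020304, 57070912,
 63081013, 53070811, 71091115, 77101216, 19020304, 23030305, 47060710, 19020304, 41050609,
 91111420, 79101217, 65081014, 51060811, 71091115, 39050608, 19020304, 39050608, 23030305,
 51070810, 57080911, 101141620, 71101114, 29040406, 23030305, 53070811, 61080913, 89121319,
 125171827, 81111217, 67091014, 45060709, 39050608, 39050608, 52070811, 45060709, 65091013,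
 39050608, 79111216, 93131419, 107151622, 59080912, 19020304, 23030305, 51070811, 32040507,
 23030404, 17020303, 57071011, 31040506, 41050708, 47060809, 97121719, 137172427, 81101416,
 71091214, 63081112, 71091214, 47060809, 41050708, 41050708, 47060809, 51060910, 57071011,
 41050708, 63081112, 89111617, 95121718, 39050707, 56071011, 37050607, 31040506, 41050708,
 47060809, 81101416, 71091214, 53070910, 47060809, 75101314, 47060809, 67091113, 61081012,
 71091214, 77101315, 77101315, 41050708, 51070810, 57080911, 113161822, 31040506, 87121417,
 57080911, 101141620, 71101114, 59081011, 43060708, 107151820, 85121416, 71101213, 29040505,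
 65091112, 65091112, 29040505, 43060708, 117162022, 29040505, 36050607, 31040506, 29040505,
 31040506, 43060708, 53070910, 59081011, 95131618, 73101214, 17020303, 36050607, 17020303,
 31040506, 29040505, 47060809, 69091213, 75101314, 81111415, 53070910, 36050607]

set_option maxRecDepth 100000 in
theorem run12 : run table hints12 stk12 = stk13 := by decide +kernel

def stk14 : List St := [⟨1,6,1,5,2,8,3,7,1,0,0,0,0⟩,
 ⟨1,6,1,6,2,8,3,7,1,0,0,0,0⟩,
 ⟨1,5,1,5,2,8,3,7,6,1,1,1,2⟩,
 ⟨1,5,1,5,2,8,1,2,7,1,1,1,3⟩,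
 ⟨1,5,1,5,1,3,3,8,1,0,0,0,0⟩,
 ⟨1,5,1,5,1,3,1,2,8,1,1,2,3⟩,
 ⟨1,5,1,5,1,5,1,2,1,0,0,0,0⟩,
 ⟨1,4,1,3,1,3,2,5,1,0,0,0,0⟩,
 ⟨1,5,1,3,1,3,1,2,5,0,1,1,2⟩,
 ⟨1,4,1,3,1,3,1,3,1,0,0,0,0⟩,
 ⟨1,4,1,3,1,2,1,2,3,0,0,1,1⟩,
 ⟨1,4,1,3,1,2,1,1,2,0,0,0,1⟩]

def hints13 : List ℕ := [
 24030405, 19020304, 17020303, 28030506, 17020303, 23020405, 42050709, 15020203, 19020304,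
 32040507, 19020304, 65091014, 43060709, 37050608, 32040507, 32040507, 15020203, 17020303,
 40050708, 17020303, 36050607, 23030404, 30040506, 51070911, 29040506, 23030405, 15020203,
 19020304, 17020303, 23030404, 47060810, 28030506, 32040507, 17020303, 28030506, 23030405,
 23030405, 29040506, 52070911, 23030405, 28030506, 28030506, 23030405, 37050608, 19020304,
 31040506, 35040607, 49060810, 59071012, 67081114, 101121721, 39050608, 63081013, 105131722,
 65081113, 55070911, 79101316, 24030405, 17020303, 24030405, 15020203, 39050608, 63081013,
 15020203, 17020303, 24030405, 23030404, 23030404, 17020303, 29040505, 16020303, 41050809,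
 42050809, 23030405, 29040506, 38050708, 38050708, 29040506, 23030405, 37050708, 38050708,
 32040607, 47060910, 42050809, 36050707, 31040606, 67091314, 29040506, 23030405, 32040607,
 52071011, 36050707, 66091314, 17020303, 21020404, 33030607, 67061314, 43040809, 77071516,
 87081718, 97091920, 127122526, 151143031, 23020405, 23020405, 29030506, 33030607, 49050910,
 43040809, 71071315, 101101921, 69071314, 23020405, 23020405, 55061011, 49050910, 65071213,
 133142527, 75081415, 79081516, 27030505, 37040707, 91101718, 61071112, 27030505, 35040607,
 19020304, 23020405, 44050809, 28030506, 28030506, 51051011, 19020304, 26030505, 47050910,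
 53061011, 19020304, 19020304, 37040708, 16020303, 26030505, 47050910, 37040708, 28030506,
 43050809, 33040607, 37040708, 33040607, 42050809, 46050910, 24030405, 28030506, 22030404,
 15020203, 33040607, 22030404, 17020304, 21020405, 61071115, 37040709, 43050810, 113132128,
 37040709, 26030506, 43050810, 37040709, 41040810, 26030506, 46050911, 26030506, 30040507,
 25030406, 41050710, 25030406, 37050609, 29040507, 93131623, 37050609, 25030406, 23030405,
 23030405, 66091116, 59081014, 23030405, 16020303, 26030506, 41050809, 57071113, 41050809,
 43050810, 26030506, 56071113, 31040607, 32040607, 16020303, 66091314, 43060809, 31040607,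
 22030405, 44060810, 79111518, 43060810, 36050708, 72101416, 22030405, 26030506, 67091315,
 36050708, 37050708, 16020303, 22030405, 39050709, 57081013, 30040507, 50070911, 37050708,
 31040607, 30040507, 22030405, 37050709, 22030405, 57081114, 26030506, 33040608, 34040608,
 53061013, 25030406, 23030405, 25030406, 39050709, 41050710, 29040507, 45060811, 30040507,
 30040507, 23030405, 34040608, 39050709, 21020405, 16020303, 21020405, 22030405, 54071013,
 38050709, 30040507, 51070912, 22030405, 38050709, 22030405, 41050810, 38050709, 53071013,
 31040607, 37050709, 21020405, 18020304, 17020204, 27030406, 29030407, 37040509, 53060713,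
 45050611, 43050610, 21020305, 71081017, 35040508, 55060813, 13010203, 21020305, 27030406,
 23030305, 35040508, 31040407, 57070813, 43050610, 73091017, 47060611, 39050509, 87111220,
 65080915, 41050609, 57070813, 49060711, 31040407, 63080914, 15020203, 15020203, 15020203,
 32040507, 19020304, 13010203, 40050609, 23030305, 13010203, 22030305, 31040507, 13010203,
 37050608, 13010203, 22030305, 41050610, 15020203, 49060712, 54070813, 15020203, 61080915,
 33040508, 29040407, 37050608, 31040507, 15020203, 22030305, 38050609, 25030406, 33040508,
 22030305, 33040508, 29040407, 45060711, 31040507, 22030305, 25030406, 45060711, 25030406,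
 13010203, 9010102, 29030407, 37040509, 57060814, 15020203, 29040406, 23030305, 17020204,
 37040509, 53060713, 45050611, 29030407, 71081017, 23030305, 31040407, 57070813, 43050610,
 73091017, 47060611, 39050509, 87111220, 65080915, 15020203, 22030305, 6010101]

set_option maxRecDepth 100000 in
theorem run13 : run table hints13 stk13 = stk14 := by decide +kernel

def stk15 : List St := [⟨2,17,9,46,1,3,11,31,37,4,7,12,13⟩,
 ⟨2,17,1,5,1,3,4,11,28,3,5,9,10⟩,
 ⟨2,17,1,5,1,3,3,8,11,1,2,3,4⟩,
 ⟨1,7,3,17,1,3,3,8,1,0,0,0,0⟩,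
 ⟨1,7,1,5,5,17,3,8,1,0,0,0,0⟩,
 ⟨1,7,1,5,1,3,6,17,1,0,0,0,0⟩,
 ⟨1,7,1,5,1,3,3,8,17,2,3,5,6⟩,
 ⟨1,5,1,5,2,7,3,8,1,0,0,0,0⟩,
 ⟨1,5,1,5,1,3,3,8,7,1,1,2,2⟩,
 ⟨1,5,1,5,1,3,1,2,8,1,1,2,3⟩,
 ⟨1,5,1,5,1,5,1,2,1,0,0,0,0⟩,
 ⟨1,4,1,3,1,3,2,5,1,0,0,0,0⟩,
 ⟨1,5,1,3,1,3,1,2,5,0,1,1,2⟩,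
 ⟨1,4,1,3,1,3,1,3,1,0,0,0,0⟩,
 ⟨1,4,1,3,1,2,1,2,3,0,0,1,1⟩,
 ⟨1,4,1,3,1,2,1,1,2,0,0,0,1⟩]

def hints14 : List ℕ := [
 22030405, 17020304, 26030506, 31040607, 26030506, 38050709, 33040608, 41050810, 38050709,
 53071013, 31040607, 37050709, 13020203, 29040507, 54080913, 53080913, 33050508, 41060710,
 33050508, 61091015, 41060710, 17020304, 40060709, 46070811, 34050608, 17020304, 41060710,
 69101217, 47070811, 19030304, 31050507, 50080911, 31050507, 40060709, 45070810, 26040406,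
 25040406, 29040507, 41060710, 65101116, 102161725, 101161725, 39060709, 17020304, 19030304,
 46070811, 17020304, 45070811, 39060709, 31050507, 17020304, 19030304, 56091013, 17020304,
 80131419, 55090913, 32050607, 27040506, 36050708, 41060809, 71101416, 76111517, 47070910,
 46070910, 41060809, 26040505, 33050607, 41060809, 36050708, 54081012, 33050607, 58091113,
 26040505, 41060809, 19030304, 27040506, 33050607, 49080911, 55091012, 38060708, 33050607,
 45070810, 31050507, 50080911, 19030304, 33050607, 26040505, 46070910, 26040505, 46070910,
 26040505, 31050606, 43070809, 31050606, 81131617, 51081011, 37060708, 31050606, 43070809,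
 43070809, 46070910, 43070809, 56091112, 61101213, 67111314, 31050606, 46070910, 56091112,
 31050606, 38060708, 31050607, 37060708, 27040506, 64101214, 37060708, 46070910, 50080911,
 31050606, 19030304, 31050607, 13020203, 21030405, 37050709, 57081114, 33050608, 27040506,
 37050709, 86131621, 53081013, 27040506, 47070911, 42060810, 33050608, 62091215, 41060810,
 46070911, 32050607, 31050607, 62101214, 61101214, 37060708, 57091113, 21030405, 37060709,
 26040506, 33050608, 25040406, 45070811, 38060709, 21030405, 25040406, 27040506, 43070810,
 37060709, 21030405, 17020304, 27040506, 31040607, 43060810, 48070911, 26030506, 56081113,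
 44070810, 40060709, 13020203, 19030304, 27040506, 37050709, 21030405, 13020203, 33050608,
 13020203, 26040406, 25040406, 11020202, 18030304, 12020202, 42070809, 23040405, 32050607,
 29050506, 29050506, 39070708, 17030303, 17030303, 52091011, 77131516, 66111314, 41070808,
 41070808, 29050506, 86151718, 52091011, 39070708, 57101112, 62111213, 73131415, 67121314,
 111202223, 39070708, 23040405, 41070809, 62111213, 28050506, 32050607, 17030304, 21030405,
 13020203, 29050507, 13020203, 37060709, 29050507, 41070810, 57101113, 56101113, 13020203,
 18030304, 12020202, 17030303, 13020203, 13020203, 17030304, 21040405, 6010101, 14020203,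
 13020202, 21030304, 23030404, 49070809, 33050506, 27040405, 69101113, 35050606, 47070808,
 55080910, 71101213, 83121415, 95141617, 55080910, 33050506, 61091011, 67101112, 79121314,
 107161819, 125192122, 53080909, 27040405, 35050606, 35050606, 33050506, 43060708, 35050606,
 28040505, 17020303, 11010202, 35050607, 15020203, 36050607, 20030304, 24030405, 28040505,
 36050607, 47070809, 17020303, 41060708, 29040506, 15020203, 16020303, 29040506, 20030304,
 34050607, 21030404, 21030304, 16020303, 20030304, 29040506, 11010202, 34050607, 27040505,
 11010202, 31050506, 46070809, 50080909, 68111213, 37060607, 51080910, 27040505, 38060707,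
 56091011, 31050506, 31050506, 34050607, 25040405, 19030304, 25040405, 45070809, 27040505,
 56091011, 39060708, 19030304, 33050607, 44070809, 25040405, 11010202, 21030404, 19030304,
 33050607, 44070809, 9010102, 14020203, 21030304, 13020202, 27040405, 43060708, 69101113,
 49070809, 33050506, 49070809, 55080910, 61091011, 67101112, 61091011, 20030304, 15020203,
 13020202, 13020202, 9010102, 7010102, 17020305, 11010203, 19020306, 28030509, 52060917, 28030509,
 46050815, 28030509, 31030610, 61061220, 58061119, 67071322, 61071219, 36040711, 26030508,
 37040712, 46050915, 26030508, 61071220, 31030610, 79091526, 46050915]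

set_option maxRecDepth 100000 in
theorem run14 : run table hints14 stk14 = stk15 := by decide +kernel

def stk16 : List St := [⟨2,11,2,11,4,13,2,6,7,1,1,2,2⟩,
 ⟨1,5,1,5,4,13,4,13,7,1,1,2,2⟩,
 ⟨1,5,1,5,1,3,1,2,8,1,1,2,3⟩,
 ⟨1,5,1,5,1,5,1,2,1,0,0,0,0⟩,
 ⟨1,4,1,3,1,3,2,5,1,0,0,0,0⟩,
 ⟨1,5,1,3,1,3,1,2,5,0,1,1,2⟩,
 ⟨1,4,1,3,1,3,1,3,1,0,0,0,0⟩,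
 ⟨1,4,1,3,1,2,1,2,3,0,0,1,1⟩,
 ⟨1,4,1,3,1,2,1,1,2,0,0,0,1⟩]

def hints15 : List ℕ := [
 26030508, 31030610, 37040712, 64071221, 61071120, 53061017, 22020407, 27030508, 46050914,
 19020306, 36040711, 19020306, 25030408, 19020306, 35040611, 46050815, 22030307, 46060715,
 19020306, 52070817, 83111327, 46060715, 73101124, 43060614, 65091021, 19020306, 52070817,
 58080919, 30040509, 19020306, 23030407, 35040611, 35040611, 23030407, 19020306, 43060713,
 51070816, 38050612, 23030407, 36050611, 29040509, 107151834, 29040509, 22030307, 36050611,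
 60081019, 23030407, 54070917, 59081018, 29040509, 31040510, 23030407, 29040509, 37050612,
 29040509, 58081019, 23030407, 43060714, 23030407, 88121529, 37050612, 40050713, 76101325,
 53070917, 29040509, 31040510, 19020306, 40050713, 58071019, 41050713, 49060816, 58071019,
 88111529, 47060815, 19020306, 22030307, 50070816, 19020306, 50070816, 23030407, 47060815,
 22030307, 11010203, 31040609, 36050710, 22030406, 31040609, 46060913, 16020305, 26030508,
 46050915, 97111932, 43050814, 58071119, 49060916, 41050813, 61071220, 67081322, 67081322,
 82101627, 52061017, 41050813, 77091525, 37040712, 23030407, 49060916, 40050713, 55071018,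
 40050713, 55071018, 43060714, 94131631, 29040509, 22030407, 61081120, 38050712, 76101425,
 55071018, 38050712, 52070917, 29040509, 79111426, 73101324, 50070916, 58081019, 29040509,
 61081120, 44060814, 43060814, 109152036, 94131731, 115162138, 163233054, 46060815, 29040509,
 38050712, 22030407, 23030407, 37050711, 43060813, 36050711, 26030508, 71101422, 46060914,
 26030508, 29040509, 32040610, 22030407, 31040610, 56071118, 88111729, 157203152, 71091423,
 47060915, 38050712, 70091323, 91121730, 127172442, 37050712, 121162340, 151202950, 47060915,
 36050711, 38050712, 23030407, 11010203, 34040611, 19020306, 35040611, 39050712, 25030408,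
 39050712, 25030408, 34040611, 26030508, 16020305, 28030509, 42050813, 25030408, 28030509,
 39050712, 25030408, 36040711, 25030408, 11010203, 30040509, 31040609, 37050711, 43060813,
 37050711, 6010101, 11010203, 19030305, 39060711, 46070813, 25040407, 39060711, 67111219,
 25040407, 46070813, 62101117, 19030305, 27040507, 26040507, 41060811, 46070912, 26040507,
 31050608, 62101216, 46070912, 31050608, 26040507, 41060811, 37060710, 63101217, 26040507,
 68111318, 56091115, 61101216, 38060710, 26040507, 61091217, 46070913, 53081015, 36050710,
 46070913, 32050609, 25040407, 39060711, 37060710, 25040407, 43070812, 43070812, 105172029,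
 64101218, 37060710, 43070812, 32050609, 47070913, 46070913, 36050710, 31050608, 51081014,
 36050710, 83131623, 25040407, 37060710, 25040407, 37060710, 22030406, 16030304, 11020203,
 46080913, 61111217, 22040406, 11020203, 31060608, 12020203, 17030304, 41070810, 11020202,
 21040405, 11020202, 13020204, 14020204, 22030407, 35050611, 43060714, 20030306, 82121327,
 20030306, 48070815, 34050511, 47070815, 55080918, 53080917, 67101122, 53080917, 59091019,
 23030407, 28040509, 34050611, 91131630, 53080917, 41060713, 115172038, 40060713, 145222548,
 46070815, 23030407, 21030406, 23030407, 20030306, 17020305, 20030306, 27040508, 35050611,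
 16020305, 29040509, 33050610, 16020305, 14020204, 6010101, 14020204, 21030406, 27040508,
 17020305, 20030306, 17020305, 31050509, 17020305, 38060711, 17020305, 44070813, 37060611,
 33050610, 50080915, 63101119, 56091017, 49080815, 23030407, 44070813, 50080915, 38060711,
 17020305, 31050509, 55091016, 43070812, 31050609, 46070914, 37060711, 14020204, 11020203,
 17030305, 37060711, 46070914, 40070712, 43070813, 82141525, 31050609, 52091015, 46080913,
 47080914, 56091117, 76131523, 23040407, 31050609, 28050508, 31050609, 46080913]

set_option maxRecDepth 100000 in
theorem run15 : run table hints15 stk15 = stk16 := by decide +kernel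

def stk17 : List St := [⟨9,55,10,55,1,5,5,11,7,1,1,1,3⟩,
 ⟨1,6,3,16,3,16,6,13,7,1,1,1,3⟩,
 ⟨1,6,1,5,1,5,7,16,7,1,1,1,3⟩,
 ⟨1,6,1,6,1,5,1,2,7,1,1,1,3⟩,
 ⟨1,4,1,3,1,3,2,5,1,0,0,0,0⟩,
 ⟨1,5,1,3,1,3,1,2,5,0,1,1,2⟩,
 ⟨1,4,1,3,1,3,1,3,1,0,0,0,0⟩,
 ⟨1,4,1,3,1,2,1,2,3,0,0,1,1⟩,
 ⟨1,4,1,3,1,2,1,1,2,0,0,0,1⟩]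

def hints16 : List ℕ := [
 17030305, 11020203, 15020204, 16020204, 16020205, 18020305, 17020205, 33040509, 7000102,
 24030307, 23030306, 94121327, 31040409, 100131429, 53070715, 38050511, 40050611, 23030306,
 71091020, 102131529, 62080917, 47060713, 47060713, 54070815, 130171937, 68091019, 24030307,
 55070816, 47060713, 38050511, 54070815, 38050511, 19020305, 23030306, 23030306, 32040509,
 41050612, 24030307, 55070816, 39050611, 46060713, 38050511, 19020305, 55070915, 25030407,
 25030407, 10010103, 25030407, 32040509, 27030408, 13010204, 33040510, 31040509, 23030307,
 12010203, 19020305, 26030407, 23030306, 23030306, 16020304, 17020304, 70091219, 23030406,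
 23030406, 40050711, 11010203, 49060913, 24030407, 13010204, 11010203, 9010102, 16020204,
 10010103, 17020205, 9010102, 13020203, 16020204, 12010203, 7010101, 31040508, 23030306, 51070813,
 58080915, 19020305, 19020305, 44060711, 19020305, 27040407, 31040508, 50070813, 19020305,
 96141525, 43060711, 34050509, 20030305, 31040508, 55080914, 43060711, 16020304, 28040507,
 23030406, 17020304, 29040507, 17020304, 22030405, 27030507, 35050609, 23030406, 29040507,
 20030305, 27040407, 42060711, 20030305, 29040507, 23030406, 23030406, 9010102, 16020204, 7010101,
 23030306, 20030305, 9010102, 6010101, 16020304, 50080913, 19030305, 7010102, 24030407, 16020205,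
 23030307, 13010204, 33040510, 31040509, 31040509, 33040510, 38050611, 33040510, 51070815,
 58080917, 53070816, 51070815, 44060713, 37050611, 13010204, 29040409, 31040509, 57080917,
 36050511, 37050611, 45060714, 37050611, 29040409, 11010203, 18020305, 31040509, 23030406,
 29040508, 31040509, 16020304, 23030406, 18020305, 16020205, 6010101, 16020304, 13020203,
 29040508, 11010203, 18020305, 18020305, 43060712, 53080815, 46070713, 48070813, 47070813,
 23030406, 48070813, 28040507, 34050609, 11010203, 11010203, 40060711, 18020305, 19030305,
 40060711, 11010203, 29040508, 71111220, 29040508, 45070812, 92141725, 11010203, 29040508,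
 27040507, 13020203, 43060712, 53080815, 46070713, 19030305, 7010101, 11010202, 23030404,
 17020303, 57071011, 31040506, 41050708, 47060809, 97121719, 137172427, 81101416, 71091214,
 63081112, 71091214, 47060809, 41050708, 41050708, 47060809, 51060910, 57071011, 41050708,
 63081112, 89111617, 95121718, 39050707, 56071011, 37050607, 31040506, 41050708, 47060809,
 81101416, 71091214, 53070910, 47060809, 75101314, 47060809, 67091113, 61081012, 71091214,
 77101315, 77101315, 41050708, 51070810, 57080911, 113161822, 31040506, 87121417, 57080911,
 101141620, 71101114, 59081011, 43060708, 107151820, 85121416, 71101213, 29040505, 65091112,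
 65091112, 29040505, 43060708, 117162022, 29040505, 36050607, 31040506, 29040505, 31040506,
 43060708, 53070910, 59081011, 95131618, 73101214, 17020303, 36050607, 17020303, 31040506,
 29040505, 47060809, 69091213, 75101314, 81111415, 53070910, 36050607, 23030404, 17020303,
 29040505, 17020303, 21020404, 27030505, 37040707, 91101718, 61071112, 16020303, 22030404,
 6010101, 11020202, 12020202, 6010101, 13020202, 28040505, 21030304, 35050606, 49070809, 33050506,
 27040405, 69101113, 47070808, 55080910, 71101213, 83121415, 95141617, 55080910, 33050506,
 61091011, 67101112, 79121314, 107161819, 125192122, 53080909, 27040405, 33050506, 43060708,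
 17020303, 48070809, 29040505, 23030404, 23030404, 36050607, 47070809, 17020303, 41060708,
 29040505, 47070808, 73111213, 165252829, 79121314, 125192122, 16020303, 11010202, 11010202,
 21030304, 16020303, 11010202, 31050506, 46070809, 50080909, 68111213, 37060607, 51080910,
 27040505, 38060707, 56091011, 31050506]

set_option maxRecDepth 100000 in
theorem run16 : run table hints16 stk16 = stk17 := by decide +kernel

def stk18 : List St := [⟨2,24,3,14,4,13,2,5,1,0,0,0,0⟩,
 ⟨1,11,5,24,4,13,2,5,1,0,0,0,0⟩,
 ⟨1,11,3,14,4,13,2,5,24,2,5,7,9⟩,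
 ⟨1,11,3,14,5,16,5,13,1,0,0,0,0⟩,
 ⟨1,11,3,14,5,16,2,5,13,1,2,4,5⟩,
 ⟨1,11,3,14,1,3,6,16,1,0,0,0,0⟩,
 ⟨1,11,3,14,1,3,2,5,16,1,3,5,6⟩,
 ⟨1,11,1,4,4,14,2,5,1,0,0,0,0⟩,
 ⟨1,11,1,4,1,3,5,14,1,0,0,0,0⟩,
 ⟨1,11,1,4,1,3,2,5,14,1,3,4,5⟩,
 ⟨1,6,2,11,1,3,2,5,1,0,0,0,0⟩,
 ⟨1,6,1,4,3,11,2,5,1,0,0,0,0⟩,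
 ⟨1,6,1,4,1,3,4,11,1,0,0,0,0⟩,
 ⟨1,6,1,4,1,3,2,5,11,1,2,3,4⟩,
 ⟨1,6,1,6,1,3,2,5,1,0,0,0,0⟩,
 ⟨1,4,1,4,1,3,2,6,1,0,0,0,0⟩,
 ⟨1,4,1,4,1,3,2,5,6,1,1,1,2⟩,
 ⟨1,4,1,4,1,4,2,5,1,0,0,0,0⟩,
 ⟨1,4,1,3,1,3,2,5,4,0,1,1,1⟩,
 ⟨1,5,1,3,1,3,1,2,5,0,1,1,2⟩,
 ⟨1,4,1,3,1,3,1,3,1,0,0,0,0⟩,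
 ⟨1,4,1,3,1,2,1,2,3,0,0,1,1⟩,
 ⟨1,4,1,3,1,2,1,1,2,0,0,0,1⟩]

def hints17 : List ℕ := [
 31050506, 11010202, 21030404, 13020202, 21030304, 27040405, 43060708, 69101113, 49070809,
 33050506, 49070809, 55080910, 61091011, 67101112, 61091011, 21030304, 4000101, 6010101, 11010203,
 14010304, 19010406, 13000304, 23010507, 28010609, 31010710, 49021116, 31010710, 73031624,
 49021116, 43020914, 28010609, 58031219, 31010710, 67031522, 59031319, 100052233, 85041928,
 40020913, 22010507, 40020913, 58031319, 40020913, 70031623, 62031420, 49021116, 22010507,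
 28010609, 41020913, 22010507, 48021115, 46021015, 22010507, 21010506, 33010810, 43021013,
 53021316, 53021316, 23010507, 23010507, 43021013, 41021012, 93042328, 41021012, 23010507,
 49021215, 25010608, 34010811, 37010912, 85032128, 109042736, 61021520, 29010709, 29010709,
 37010912, 29010709, 22010507, 55021318, 46021115, 67031622, 76031825, 34010811, 43021014,
 34010811, 88042129, 97042332, 61031420, 40020913, 21010506, 34010811, 29010709, 41021013,
 61031519, 45021114, 21010506, 22010507, 50021216, 46021115, 29010709, 37010912, 49021216,
 85032128, 157063952, 70031723, 37010912, 26010608, 34010811, 46011115, 61011520, 49011216,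
 38010912, 41011013, 43011014, 49011216, 37010912, 31010710, 43011014, 38010912, 33010810,
 29010709, 41011013, 16010305, 49031016, 58031219, 88051829, 103062134, 34020711, 91051930,
 67041422, 34020711, 73041524, 34020711, 98062032, 31020610, 34020711, 64041321, 193123964,
 44030914, 48031015, 29020609, 29020609, 21010506, 13000304, 33010810, 43021013, 53021316,
 53021316, 23010507, 23010507, 26010608, 33010810, 18010405, 23010507, 13000304, 26010608,
 13000304, 58031318, 43021013, 33020710, 16010305, 23010507, 29020609, 32020710, 23010507,
 16010305, 29020609, 17010405, 13000304, 26010608, 16010305, 13000304, 26010608, 31020709,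
 13000304, 26010608, 30020709, 13000304, 26010608, 45031014, 44031013, 13000304, 29020609,
 43031013, 26010608, 88062027, 29020609, 13000304, 60041418, 103072432, 43031013, 62041419,
 44031013, 32020710, 34020810, 30020709, 16010305, 36020811, 31020709, 23010507, 17010405,
 43021013, 48031114, 53031216, 63041419, 23010507, 18010405, 33020809, 29020708, 17010405,
 37020911, 29010709, 45021114, 77041924, 35020811, 70041722, 93052329, 35020811, 74041823,
 53031316, 61041419, 16010305, 29020609, 33020810, 51031216, 37020911, 85052126, 189114759,
 30020709, 51031216, 16010305, 46031114, 79051924, 37020911, 30020709, 29020709, 17010405,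
 13000304, 41021012, 23010507, 63031519, 83042025, 18010405, 23010507, 38020911, 33010810,
 18010405, 37020911, 85042126, 57031417, 18010405, 42021013, 37020911, 18010405, 45031113,
 17010405, 22010507, 37020912, 25010608, 58031419, 25010608, 73041824, 25010608, 52031217,
 31020710, 22010507, 52031217, 22010507, 49031116, 61041420, 43031014, 29020709, 49031216,
 37020912, 46031115, 37020912, 46031115, 61041520, 58041419, 77051925, 43031014, 34020811,
 33020810, 22010507, 47031115, 30020709, 29020709, 25010608, 61041519, 45031114, 31020710,
 25010608, 22010507, 16010305, 23010507, 38020812, 34020711, 37020812, 52031117, 145083148,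
 70041523, 37020812, 40020913, 95052131, 76041725, 139073146, 34020711, 41020913, 18010405,
 50031116, 31010710, 40020913, 46031015, 49031116, 49031116, 35020811, 38020912, 57031318,
 23010507, 16010305, 23010507, 18010405, 17010405, 16010305, 19010406, 43020914, 58031219,
 49031016, 58031219, 88051829, 103062134, 34020711, 91051930, 67041422, 34020711, 73041524,
 34020711, 98062032, 38020812, 34020711, 52031117, 61031320, 13010204, 28020509, 23020407,
 49040916, 23020407, 13010204, 43030913, 33020710, 29020609, 24020507]

set_option maxRecDepth 100000 in
theorem run17 : run table hints17 stk17 = stk18 := by decide +kernel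

def stk19 : List St := [⟨3,26,2,11,6,19,2,5,13,1,2,4,5⟩,
 ⟨1,7,2,11,1,3,3,8,1,0,0,0,0⟩,
 ⟨1,7,2,11,1,3,2,5,8,1,1,2,3⟩,
 ⟨1,7,1,7,1,3,2,5,1,0,0,0,0⟩,
 ⟨1,6,2,11,2,7,2,5,1,0,0,0,0⟩,
 ⟨1,6,2,11,1,3,2,5,7,1,1,2,2⟩,
 ⟨1,6,1,4,3,11,2,5,1,0,0,0,0⟩,
 ⟨1,6,1,4,1,3,4,11,1,0,0,0,0⟩,
 ⟨1,6,1,4,1,3,2,5,11,1,2,3,4⟩,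
 ⟨1,6,1,6,1,3,2,5,1,0,0,0,0⟩,
 ⟨1,4,1,4,1,3,2,6,1,0,0,0,0⟩,
 ⟨1,4,1,4,1,3,2,5,6,1,1,1,2⟩,
 ⟨1,4,1,4,1,4,2,5,1,0,0,0,0⟩,
 ⟨1,4,1,3,1,3,2,5,4,0,1,1,1⟩,
 ⟨1,5,1,3,1,3,1,2,5,0,1,1,2⟩,
 ⟨1,4,1,3,1,3,1,3,1,0,0,0,0⟩,
 ⟨1,4,1,3,1,2,1,2,3,0,0,1,1⟩,
 ⟨1,4,1,3,1,2,1,1,2,0,0,0,1⟩]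

def hints18 : List ℕ := [
 53041116, 33020710, 49041015, 43030913, 49041015, 36030711, 59051218, 34030710, 63051319,
 73061522, 103092131, 113102334, 23020407, 68061420, 56051117, 23020407, 63051319, 23020407,
 59051218, 49041015, 48041014, 34030710, 36030711, 47041014, 33020710, 119102536, 128112739,
 104092231, 24020507, 71061522, 26020508, 25020508, 19010406, 43030914, 19010406, 35030711,
 49041016, 19010406, 43030914, 35030711, 19010406, 35030711, 34030711, 34030711, 58051219,
 52041117, 13010204, 31020610, 34020711, 64041321, 193123964, 19010406, 28020509, 29020609,
 48031015, 19010406, 41030813, 44030914, 28020509, 54041117, 19010406, 19010406, 40030813,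
 29020609, 55041118, 34020711, 25020508, 19010406, 40030813, 29020609, 29020609, 37030712,
 46040915, 24020507, 19010406, 35030711, 13010303, 18010405, 33020809, 41031011, 29020708,
 29020708, 57041416, 29020708, 33020809, 43031012, 18010405, 36030810, 25020607, 29020708,
 53041315, 34030809, 47041113, 37030910, 45041112, 29020708, 50041214, 37030910, 82072023,
 46041113, 61051517, 57051416, 26020607, 38030910, 58051415, 23020506, 49041213, 23020506,
 18010405, 13010304, 29020709, 17010405, 49031216, 37020912, 46031115, 37020912, 46031115,
 61041520, 34020811, 31020710, 43031014, 46031115, 55041318, 46031115, 40030913, 55041318,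
 17010405, 17010405, 43031014, 41031013, 70051723, 73051824, 109082736, 121093040, 82062027,
 53041317, 46031115, 17010405, 41031013, 57041418, 43031014, 58041419, 41031013, 37030812,
 40030913, 79061826, 23020507, 57051318, 31020710, 49041116, 23020507, 46041015, 35030811,
 58051319, 23020507, 109092536, 40030913, 58051319, 40030913, 23020507, 82071827, 73061624,
 23020507, 37030911, 17010405, 23020507, 26020608, 25020608, 53041317, 67051622, 91072230,
 65051621, 77061925, 205165168, 47041115, 64051521, 85072028, 35030811, 56051318, 34030811,
 139123346, 59051419, 29020709, 38030912, 45041114, 57051418, 17010405, 27020608, 19010406,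
 18010405, 28020608, 29020609, 29020609, 30020709, 31020709, 56041317, 57041317, 42030913,
 83061925, 13000304, 55041217, 43031013, 16010305, 28020609, 19010406, 24020507, 28020608,
 42030913, 37030811, 41030912, 13010204, 23010507, 13010204, 50041115, 59041318, 62051319,
 16010305, 28020608, 23020507, 28020609, 23020507, 18010405, 28020608, 24020507, 24020507,
 13010303, 49041114, 35030810, 13010303, 28020609, 36030811, 13010304, 41030913, 19010406,
 41030913, 49041115, 22010507, 47041015, 23020507, 30020709, 23020507, 13010304, 23020507,
 25020508, 19010406, 18010405, 28020608, 23020506, 25020607, 29020708, 21010506, 13010303,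
 69051720, 38030911, 35030810, 13010303, 38030911, 24020507, 24020507, 31020709, 24020507,
 7010102, 8010102, 13010204, 28030409, 43050614, 58070819, 33040510, 41050613, 34040511, 49060716,
 67081022, 34040511, 46050715, 43050614, 88101329, 43050614, 49060716, 41050613, 18020305,
 23020407, 28030508, 17020305, 34040610, 17020305, 23020407, 28030508, 43050713, 36040611,
 41050712, 43050713, 58071017, 33040510, 28030508, 19020306, 40040713, 34030611, 79081426,
 29030509, 34040511, 58070919, 17020305, 29030509, 42050713, 34040610, 29030509, 51060916,
 28030509, 25030408, 17020305, 34040611, 52060917, 58071019, 17020305, 52060917, 35040611,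
 29030509, 37040612, 28030509, 40040713, 37040612, 46050815, 40040713, 37040612, 58070919,
 34040511, 25030408, 34040511, 42050713, 25030408, 43050714, 25030408, 28030509, 52060917,
 29030509, 19020306, 31030510, 23020407, 28020509, 43040714, 58051019, 34030611, 23020407,
 41040713, 29030509, 52050917, 29030509, 26030408, 28030409, 26030408]

set_option maxRecDepth 100000 in
theorem run18 : run table hints18 stk18 = stk19 := by decide +kernel

def stk20 : List St := [⟨3,21,2,9,2,8,15,38,29,4,6,7,11⟩,
 ⟨1,6,4,21,2,8,2,5,1,0,0,0,0⟩,
 ⟨1,6,2,9,5,21,2,5,1,0,0,0,0⟩,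
 ⟨1,6,2,9,2,8,8,21,1,0,0,0,0⟩,
 ⟨1,6,2,9,2,8,2,5,21,3,4,5,8⟩,
 ⟨1,6,2,9,3,11,3,8,1,0,0,0,0⟩,
 ⟨1,6,2,9,3,11,2,5,8,1,1,2,3⟩,
 ⟨1,6,2,9,2,9,2,5,1,0,0,0,0⟩,
 ⟨1,6,1,4,3,11,3,9,1,0,0,0,0⟩,
 ⟨1,6,1,4,3,11,2,5,9,1,2,2,3⟩,
 ⟨1,6,1,4,1,3,4,11,1,0,0,0,0⟩,
 ⟨1,6,1,4,1,3,2,5,11,1,2,3,4⟩,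
 ⟨1,6,1,6,1,3,2,5,1,0,0,0,0⟩,
 ⟨1,4,1,4,1,3,2,6,1,0,0,0,0⟩,
 ⟨1,4,1,4,1,3,2,5,6,1,1,1,2⟩,
 ⟨1,4,1,4,1,4,2,5,1,0,0,0,0⟩,
 ⟨1,4,1,3,1,3,2,5,4,0,1,1,1⟩,
 ⟨1,5,1,3,1,3,1,2,5,0,1,1,2⟩,
 ⟨1,4,1,3,1,3,1,3,1,0,0,0,0⟩,
 ⟨1,4,1,3,1,2,1,2,3,0,0,1,1⟩,
 ⟨1,4,1,3,1,2,1,1,2,0,0,0,1⟩]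

def hints19 : List ℕ := [
 23020407, 18020305, 29030509, 29030509, 25030408, 19020306, 28030509, 17020305, 34040611,
 52060917, 17020305, 28030509, 46050815, 35040611, 17020305, 22030307, 46060715, 19020306,
 52070817, 83111327, 46060715, 73101124, 43060614, 65091021, 19020306, 52070817, 58080919,
 23030407, 17020305, 19020306, 35040611, 41050713, 19020306, 35040611, 39050712, 30040509,
 19020306, 35040611, 19020306, 43060713, 51070816, 38050612, 36050611, 29040509, 107151834,
 36050611, 60081019, 54070917, 59081018, 29040509, 17020305, 30040509, 17020305, 46060814,
 29040509, 52070916, 19020306, 23030407, 17020305, 31040510, 40050713, 34040611, 31040510,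
 37050612, 29040509, 43060714, 43060714, 88121529, 37050612, 70091223, 29040509, 52070917,
 29040509, 79111426, 73101324, 50070916, 58081019, 29040509, 61081120, 46060815, 17020305,
 29040509, 31040510, 29040509, 17020305, 31040510, 19020306, 17020305, 40050713, 58071019,
 41050713, 49060816, 58071019, 88111529, 47060815, 19020306, 22030307, 50070816, 19020306,
 23030407, 17020305, 50070816, 47060815, 22030307, 16020205, 24030407, 23030307, 13010204,
 33040510, 31040509, 31040509, 33040510, 38050611, 33040510, 51070815, 58080917, 53070816,
 51070815, 44060713, 37050611, 13010204, 29040409, 31040509, 57080917, 36050511, 37050611,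
 45060714, 37050611, 29040409, 18020305, 31040509, 23030406, 29040508, 31040509, 18020305,
 8010102, 43050614, 58070819, 16020205, 8010102, 19030305, 39060711, 46070813, 25040407, 39060711,
 67111219, 25040407, 46070813, 62101117, 13020203, 29040508, 18020305, 18020305, 43060712,
 53080815, 46070713, 48070813, 47070813, 23030406, 48070813, 34050609, 40060711, 18020305,
 19030305, 40060711, 29040508, 71111220, 29040508, 29040508, 14020204, 13020204, 35050611,
 43060714, 20030306, 82121327, 20030306, 48070815, 34050511, 47070815, 55080918, 53080917,
 67101122, 53080917, 59091019, 23030407, 28040509, 34050611, 91131630, 53080917, 41060713,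
 115172038, 40060713, 145222548, 46070815, 23030407, 20030306, 57091017, 17020305, 50080915,
 63101119, 56091017, 49080815, 23030407, 8010102, 9010202, 13010303, 23020506, 19020405, 28030607,
 28030607, 31030708, 19020405, 31030708, 41040911, 49051113, 37040810, 19020405, 31030708,
 48041113, 41040911, 31030708, 28030607, 30030708, 34030809, 45041112, 41041011, 61061516,
 53051314, 21020505, 21020505, 45041112, 19020405, 37040810, 21020505, 19020405, 34030809,
 19020405, 61061516, 69071718, 29030707, 66071617, 77081920, 46051112, 65071617, 85092122,
 37040909, 37040909, 61061516, 66071617, 50051213, 38040910, 29030707, 42041011, 42041011,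
 37040910, 41041011, 19020405, 41041011, 34030809, 71071719, 59061416, 29030707, 50051213,
 49051213, 45041112, 37040910, 21020505, 23020506, 26020607, 38030910, 58051415, 41031011,
 33030808, 58051415, 54051314, 26020607, 34030809, 54051314, 31030708, 23020506, 39040910,
 48051112, 28030607, 39040910, 26020607, 23020506, 8010102, 19020405, 23020506, 41040911,
 26030507, 34040709, 41050811, 49061013, 43050911, 53061114, 68081418, 49061013, 41050811,
 78091621, 34040709, 28030607, 43050911, 58071215, 77091720, 23020506, 41050910, 42050911,
 46051012, 50061113, 41050910, 33040708, 43050911, 23020506, 23020506, 51061113, 34040709,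
 38040810, 28030607, 37040810, 105122328, 26030507, 38040810, 42050911, 23020506, 37040810,
 26030507, 21030405, 29040607, 38050809, 33040708, 41050910, 23030505, 37050809, 23030505,
 41050910, 74101618, 59081314, 23030505, 23030505, 33040708, 53071113, 23030505, 38050809,
 43060910, 46061011, 51071112, 43060910, 38050809, 58081214]

set_option maxRecDepth 100000 in
theorem run19 : run table hints19 stk19 = stk20 := by decide +kernel

def stk21 : List St := [⟨1,14,4,17,1,3,22,61,31,2,7,10,11⟩,
 ⟨1,13,4,17,1,3,5,14,31,2,7,10,11⟩,
 ⟨1,13,1,4,1,3,6,17,1,0,0,0,0⟩,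
 ⟨1,13,1,4,1,3,4,11,17,1,4,5,6⟩,
 ⟨1,10,3,13,1,3,4,11,1,0,0,0,0⟩,
 ⟨1,10,1,4,4,13,4,11,1,0,0,0,0⟩,
 ⟨1,10,1,4,1,3,4,11,13,1,3,4,4⟩,
 ⟨1,6,2,10,1,3,4,11,1,0,0,0,0⟩,
 ⟨1,6,1,4,3,10,4,11,1,0,0,0,0⟩,
 ⟨1,6,1,4,3,10,3,10,1,0,0,0,0⟩,
 ⟨1,6,1,4,1,3,4,11,10,1,2,3,3⟩,
 ⟨1,6,1,4,1,3,2,5,11,1,2,3,4⟩,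
 ⟨1,6,1,6,1,3,2,5,1,0,0,0,0⟩,
 ⟨1,4,1,4,1,3,2,6,1,0,0,0,0⟩,
 ⟨1,4,1,4,1,3,2,5,6,1,1,1,2⟩,
 ⟨1,4,1,4,1,4,2,5,1,0,0,0,0⟩,
 ⟨1,4,1,3,1,3,2,5,4,0,1,1,1⟩,
 ⟨1,5,1,3,1,3,1,2,5,0,1,1,2⟩,
 ⟨1,4,1,3,1,3,1,3,1,0,0,0,0⟩,
 ⟨1,4,1,3,1,2,1,2,3,0,0,1,1⟩,
 ⟨1,4,1,3,1,2,1,1,2,0,0,0,1⟩]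

def hints20 : List ℕ := [
 37050809, 57081214, 89121922, 23030505, 13020203, 33050608, 37060709, 14020303, 23030505,
 43060910, 13020203, 34050708, 48071011, 53081112, 43060910, 68101416, 81121719, 47071011,
 19030404, 53081112, 71111516, 33050707, 31050607, 53081112, 58091213, 63101314, 68111415,
 43070909, 44070910, 79131618, 49081011, 58091213, 38060808, 44070910, 49081011, 33050707,
 19030404, 43070910, 38060809, 26040506, 19030404, 28040606, 47071011, 41060909, 13020203,
 87131920, 59091313, 23030505, 32050707, 41060909, 32050707, 14020303, 25040506, 33050708,
 45070911, 53081113, 66101416, 77121619, 19030404, 19030404, 38060809, 19030404, 45070911,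
 29040607, 43070910, 49081012, 125202631, 19030404, 33050708, 41060910, 37050809, 46071011,
 32050707, 25040506, 33050708, 34050708, 29040607, 49071012, 69101417, 14020303, 38050809,
 13020203, 41060810, 49071012, 69101417, 46070911, 54081113, 25040506, 45070911, 37060709,
 29040607, 25040506, 14020303, 63101315, 29040607, 20030405, 15020304, 19020405, 78101721,
 23030506, 14020303, 23030506, 19020405, 38050810, 43060911, 51071113, 46061012, 50071113,
 35050709, 19020405, 38050810, 27040507, 62091316, 19020405, 28040607, 30040608, 23030506,
 14020303, 34050709, 48071013, 19030305, 27040507, 26040507, 41060811, 46070912, 26040507,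
 31050608, 62101216, 46070912, 31050608, 26040507, 41060811, 37060710, 63101217, 26040507,
 68111318, 56091115, 61101216, 38060710, 14020303, 25040506, 19030404, 49081012, 33050708,
 19030404, 25040506, 15020304, 19030405, 23030506, 32050708, 38060810, 19030405, 26040507,
 39060810, 14020303, 15020304, 27040507, 43060911, 34050709, 47071012, 19020405, 33050708,
 15020304, 15020304, 25040506, 27040507, 84131722, 49071013, 14020303, 25040506, 52081113,
 83131721, 63101316, 19030404, 32050708, 15020304, 51081113, 23030506, 31050608, 19030405,
 43070911, 32050708, 43070911, 23030506, 16020304, 13020203, 23030406, 41060711, 28040507,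
 34050609, 19030305, 71111319, 27040507, 19030404, 14020303, 23030505, 14020303, 38060808,
 13020303, 34050809, 49071213, 37050910, 41061011, 61091516, 46071112, 53081314, 41061011,
 53081314, 41061011, 67101618, 46071112, 61091516, 49071213, 19030405, 31050708, 19030405,
 34050809, 46071112, 58091415, 41061011, 25040606, 46071112, 58091415, 121193031, 70111718,
 31050708, 45071112, 26040607, 17020404, 27030607, 13010303, 18020404, 37040909, 21020505,
 29030707, 45051111, 62071516, 114132829, 35040809, 78091920, 149173738, 45051112, 30030708,
 26030607, 46051112, 53061314, 61071516, 37040910, 19020405, 14020303, 18020404, 27030607,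
 8010102, 13010303, 75091719, 35040809, 35040809, 43051011, 60071415, 22030505, 13010303,
 37050809, 45061011, 70091617, 31040707, 45061011, 53071213, 69091617, 47061111, 30040707,
 37050809, 31040707, 50071112, 22030505, 31040708, 30040707, 43051011, 75101719, 39050910,
 36050809, 31040708, 31040708, 23030506, 19020405, 31040708, 49061113, 26030607, 41050911,
 31040708, 22030505, 30040707, 15020304, 19020405, 27040607, 23030506, 31040708, 15020304,
 32050708, 20030405, 35050809, 13020303, 13020303, 37060809, 31050707, 13020303, 31050708,
 20030405, 15020304, 14020303, 18020404, 13010303, 21030505, 38050910, 49061213, 26030607,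
 41051011, 15020304, 29040707, 23030506, 89122223, 23030506, 50071213, 15020304, 50071213,
 15020304, 27040607, 15020304, 35050809, 23030506, 23030506, 13020303, 35050809, 20030405,
 32050708, 37060809, 31050708, 15020304, 10010203, 13010304, 17010405, 37020912, 25010608,
 58031419, 25010608, 73041824, 31020710, 40030913, 43031014, 14010304, 61041420]

set_option maxRecDepth 100000 in
theorem run20 : run table hints20 stk20 = stk21 := by decide +kernel

def stk22 : List St := [⟨2,13,5,29,1,3,15,43,7,1,1,2,2⟩,
 ⟨2,13,2,10,9,29,4,11,7,1,1,2,2⟩,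
 ⟨2,13,2,10,1,3,10,29,7,1,1,2,2⟩,
 ⟨2,13,2,13,1,3,4,11,7,1,1,2,2⟩,
 ⟨1,6,2,10,4,13,4,11,7,1,1,2,2⟩,
 ⟨1,6,1,4,3,10,4,11,1,0,0,0,0⟩,
 ⟨1,6,1,4,3,10,3,10,1,0,0,0,0⟩,
 ⟨1,6,1,4,1,3,4,11,10,1,2,3,3⟩,
 ⟨1,6,1,4,1,3,2,5,11,1,2,3,4⟩,
 ⟨1,6,1,6,1,3,2,5,1,0,0,0,0⟩,
 ⟨1,4,1,4,1,3,2,6,1,0,0,0,0⟩,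
 ⟨1,4,1,4,1,3,2,5,6,1,1,1,2⟩,
 ⟨1,4,1,4,1,4,2,5,1,0,0,0,0⟩,
 ⟨1,4,1,3,1,3,2,5,4,0,1,1,1⟩,
 ⟨1,5,1,3,1,3,1,2,5,0,1,1,2⟩,
 ⟨1,4,1,3,1,3,1,3,1,0,0,0,0⟩,
 ⟨1,4,1,3,1,2,1,2,3,0,0,1,1⟩,
 ⟨1,4,1,3,1,2,1,1,2,0,0,0,1⟩]

def hints21 : List ℕ := [
 43031014, 43031014, 29020709, 49031216, 37020912, 46031115, 37020912, 46031115, 61041520,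
 43031014, 46031115, 55041318, 46031115, 55041318, 41031013, 70051723, 73051824, 109082736,
 121093040, 82062027, 53041317, 58041419, 41031013, 46031115, 57041418, 43031014, 40030913,
 43031014, 34020811, 29020709, 25010608, 61041519, 45031114, 31020710, 14010304, 14010304,
 25010608, 23020507, 14010304, 40030913, 37030812, 82071827, 73061624, 35030811, 49041116,
 37030812, 79061826, 49041116, 28020609, 36030811, 25020508, 34030711, 14010304, 25020508,
 25020508, 31030610, 14010304, 25020508, 47041015, 42040913, 43040914, 52051117, 43040914,
 25020508, 79071726, 67061422, 25020508, 31030610, 25020508, 31030610, 22020507, 58051319,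
 35030811, 49041116, 32030710, 55051218, 58051319, 41040913, 85081928, 94092131, 53051217,
 112112537, 31030710, 53051217, 103102334, 31030710, 82081827, 31030710, 64061421, 41040913,
 31030710, 44041014, 31030710, 118112739, 14010304, 46041015, 32030710, 35030811, 37030812,
 45041014, 22020507, 54051217, 31030610, 31030709, 34030711, 17010405, 14010304, 23020507,
 31030709, 23020507, 31030709, 43041013, 14010304, 21020506, 31030709, 21020506, 25020607,
 21020506, 37030911, 33030810, 66061620, 49041215, 57051417, 23020507, 33030810, 23020507,
 41041012, 57051417, 73071822, 34030810, 14010304, 37030911, 14010304, 26020608, 25020608,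
 53041317, 67051622, 91072230, 65051621, 77061925, 205165168, 22020507, 47041115, 64051521,
 85072028, 35030811, 56051318, 34030811, 139123346, 59051419, 32030710, 51051216, 33030810,
 29020709, 38030912, 45041114, 57051418, 22020507, 21020506, 35030811, 35030811, 73071823,
 22020507, 14010304, 7010102, 17020305, 28030509, 31030610, 61061220, 58061119, 67071322,
 61071219, 36040711, 26030508, 37040712, 46050915, 26030508, 61071220, 31030610, 79091526,
 46050915, 26030508, 31030610, 37040712, 64071221, 61071120, 53061017, 31040510, 25030408,
 64081121, 25030408, 50070816, 23030407, 25030408, 29040509, 36050611, 50070816, 29040509,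
 29040509, 25030408, 37050612, 29040509, 58081019, 23030407, 43060714, 23030407, 88121529,
 37050612, 25030408, 40050713, 76101325, 53070917, 25030408, 25030408, 29040509, 25030408,
 31040609, 36050710, 16020305, 26030508, 46050915, 97111932, 43050814, 58071119, 49060916,
 41050813, 61071220, 67081322, 67081322, 82101627, 52061017, 41050813, 77091525, 37040712,
 23030407, 49060916, 40050713, 55071018, 40050713, 55071018, 43060714, 94131631, 29040509,
 22030407, 61081120, 38050712, 76101425, 55071018, 38050712, 52070917, 29040509, 79111426,
 73101324, 50070916, 58081019, 29040509, 61081120, 44060814, 43060814, 109152036, 94131731,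
 115162138, 163233054, 46060815, 29040509, 38050712, 22030407, 23030407, 37050711, 43060813,
 36050711, 26030508, 71101422, 46060914, 26030508, 29040509, 32040610, 22030407, 31040610,
 56071118, 88111729, 157203152, 71091423, 47060915, 38050712, 70091323, 91121730, 127172442,
 37050712, 121162340, 151202950, 47060915, 36050711, 38050712, 23030407, 34040611, 26030508,
 16020305, 28030509, 42050813, 25030408, 28030509, 39050712, 25030408, 36040711, 25030408,
 31040609, 37050711, 43060813, 37050711, 26040507, 61091217, 46070913, 53081015, 36050710,
 46070913, 32050609, 25040407, 39060711, 37060710, 25040407, 43070812, 43070812, 105172029,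
 64101218, 37060710, 43070812, 32050609, 47070913, 46070913, 36050710, 31050608, 51081014,
 36050710, 83131623, 25040407, 37060710, 25040407, 37060710, 13020204, 29040509, 14020204,
 43060714, 20030306, 82121327, 20030306, 54080917, 71101223, 41060713, 47070815]

set_option maxRecDepth 100000 in
theorem run21 : run table hints21 stk21 = stk22 := by decide +kernel

def stk23 : List St := [⟨5,33,1,4,2,7,17,54,29,4,7,8,9⟩,
 ⟨2,13,1,4,2,7,3,9,22,3,5,6,7⟩,
 ⟨1,6,3,13,2,7,3,9,1,0,0,0,0⟩,
 ⟨1,6,1,4,2,7,4,13,1,0,0,0,0⟩,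
 ⟨1,6,1,4,2,7,3,9,13,2,3,3,4⟩,
 ⟨1,6,1,4,3,10,3,9,7,1,1,2,2⟩,
 ⟨1,6,1,4,3,10,4,11,9,1,2,2,3⟩,
 ⟨1,6,1,4,3,10,3,10,1,0,0,0,0⟩,
 ⟨1,6,1,4,1,3,4,11,10,1,2,3,3⟩,
 ⟨1,6,1,4,1,3,2,5,11,1,2,3,4⟩,
 ⟨1,6,1,6,1,3,2,5,1,0,0,0,0⟩,
 ⟨1,4,1,4,1,3,2,6,1,0,0,0,0⟩,
 ⟨1,4,1,4,1,3,2,5,6,1,1,1,2⟩,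
 ⟨1,4,1,4,1,4,2,5,1,0,0,0,0⟩,
 ⟨1,4,1,3,1,3,2,5,4,0,1,1,1⟩,
 ⟨1,5,1,3,1,3,1,2,5,0,1,1,2⟩,
 ⟨1,4,1,3,1,3,1,3,1,0,0,0,0⟩,
 ⟨1,4,1,3,1,2,1,2,3,0,0,1,1⟩,
 ⟨1,4,1,3,1,2,1,1,2,0,0,0,1⟩]

def hints22 : List ℕ := [
 49070816, 41060713, 53080917, 67101122, 41060713, 47070815, 67101122, 59091019, 21030406,
 17020305, 14020204, 14020204, 27040508, 23030407, 20030306, 22030407, 28040509, 47070815,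
 35050611, 62091120, 103151834, 73111224, 34050611, 46070815, 127192242, 40060713, 139212446,
 53080917, 35050611, 21030406, 33050610, 27040508, 16020305, 16020305, 14020204, 21030406,
 14020204, 27040508, 17020305, 20030306, 17020305, 31050509, 17020305, 38060711, 17020305,
 44070813, 37060611, 33050610, 50080915, 63101119, 56091017, 49080815, 23030407, 44070813,
 50080915, 38060711, 17020305, 31050509, 55091016, 43070812, 31050609, 46070914, 37060711,
 9010202, 21020506, 14010304, 17010405, 34030810, 17010405, 25020607, 14010304, 48051114,
 47051114, 38040911, 55061316, 94102228, 38040911, 65071519, 17010405, 31030709, 31030709,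
 28030608, 28030608, 29030708, 25020607, 50051214, 39040911, 46051113, 37040910, 73081820,
 25020607, 37040910, 133143337, 37040910, 57061416, 39040911, 39040911, 14010304, 29030708,
 17010405, 45041113, 41041012, 69071720, 41041012, 37030911, 37030911, 38040911, 17010405,
 41041012, 37040911, 15020304, 24030507, 14010304, 17020305, 25030507, 17020305, 37040811,
 41050912, 34040710, 28030608, 17020305, 31040609, 25030507, 25030507, 32040709, 14010304,
 23030506, 31040609, 28030608, 23030506, 14010304, 59071317, 31040609, 14010304, 39050811,
 39050811, 23030506, 48061014, 32040709, 38050811, 17020305, 47061014, 23030506, 17020305,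
 7010102, 31040609, 17020305, 37050711, 17020305, 36050710, 26040507, 61091217, 46070913,
 53081015, 36050710, 46070913, 32050609, 25040407, 39060711, 37060710, 25040407, 43070812,
 43070812, 105172029, 64101218, 37060710, 43070812, 32050609, 47070913, 46070913, 36050710,
 31050608, 51081014, 36050710, 83131623, 25040407, 37060710, 25040407, 37060710, 21030406,
 14020204, 38060711, 17020305, 27040508, 31050509, 17020305, 17020305, 44070813, 37060611,
 43070812, 27040508, 20030405, 14020303, 23030506, 14020303, 25040506, 19030405, 23030506,
 32050708, 38060810, 14020303, 31050608, 39060810, 19030405, 25040506, 19030405, 23030506,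
 43070911, 19030405, 31050608, 31050608, 32050708, 43070911, 7010102, 19030405, 25040507,
 32050709, 37060810, 14020304, 25040507, 34050710, 19030405, 19030405, 7010102, 29040608,
 24030507, 17020305, 45060913, 23030506, 25030507, 53071115, 38050811, 52071115, 14010304,
 37050810, 31040609, 25030507, 39050811, 17020305, 44060913, 37050711, 23030506, 24030507,
 38050811, 20030405, 29040608, 23030506, 25030507, 37050810, 36050710, 64091318, 54081115,
 34050709, 23030506, 34050709, 14020303, 48071013, 41060911, 32040709, 33050709, 29040608,
 47071013, 41060911, 25040507, 29040608, 26040507, 39060811, 26040507, 44070912, 19030405,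
 26040507, 7010102, 25030607, 61071518, 37040911, 17020405, 31040709, 17020405, 34040810,
 37050811, 64091419, 22030506, 38050911, 46061113, 43061012, 52071215, 88122125, 17020405,
 22030506, 44061013, 51071215, 22030506, 22030506, 17020405, 61081418, 52071215, 38050911,
 52071215, 58081317, 22030506, 37050910, 29040708, 17020405, 29040708, 38050911, 45061113,
 22030506, 45061113, 38050911, 41051012, 45061113, 29040708, 51071215, 37050911, 65091619,
 22030506, 17020405, 46061113, 49061214, 55071316, 31040709, 61081517, 38050911, 31040709,
 53071315, 13020303, 22030506, 25030607, 46061113, 61081517, 40060911, 46071013, 34050809,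
 49071213, 37050910, 41061011, 61091516, 46071112, 53081314, 41061011, 53081314, 41061011,
 67101618, 46071112, 61091516, 49071213, 29040708, 54081315, 57081416, 33050809]

set_option maxRecDepth 100000 in
theorem run22 : run table hints22 stk22 = stk23 := by decide +kernel

def stk24 : List St := [⟨1,8,2,13,11,34,2,5,28,3,4,9,11⟩,
 ⟨1,8,1,6,1,3,5,13,1,0,0,0,0⟩,
 ⟨1,8,1,6,1,3,2,5,13,1,2,4,5⟩,
 ⟨1,7,1,6,1,3,3,8,1,0,0,0,0⟩,
 ⟨1,7,1,6,1,3,2,5,8,1,1,2,3⟩,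
 ⟨1,7,1,7,1,3,2,5,1,0,0,0,0⟩,
 ⟨1,6,1,6,2,7,2,5,1,0,0,0,0⟩,
 ⟨1,6,1,6,1,3,2,5,7,1,1,2,2⟩,
 ⟨1,4,1,4,1,3,2,6,1,0,0,0,0⟩,
 ⟨1,4,1,4,1,3,2,5,6,1,1,1,2⟩,
 ⟨1,4,1,4,1,4,2,5,1,0,0,0,0⟩,
 ⟨1,4,1,3,1,3,2,5,4,0,1,1,1⟩,
 ⟨1,5,1,3,1,3,1,2,5,0,1,1,2⟩,
 ⟨1,4,1,3,1,3,1,3,1,0,0,0,0⟩,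
 ⟨1,4,1,3,1,2,1,2,3,0,0,1,1⟩,
 ⟨1,4,1,3,1,2,1,1,2,0,0,0,1⟩]

def hints23 : List ℕ := [
 61091517, 29040708, 37050910, 25030607, 43061012, 40060911, 61091417, 34050809, 55081315,
 40060911, 47071113, 34050809, 46071113, 34050809, 37050910, 41061011, 25030607, 19030405,
 40060911, 46071013, 32050709, 58091316, 22030506, 46071013, 32050709, 32050709, 25040507,
 37060810, 22030506, 58091316, 25040507, 31050708, 22030506, 33050809, 43071012, 46071113,
 25040607, 37060910, 50081214, 25040607, 53081315, 57091416, 37060910, 26040607, 25040606,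
 34050809, 46071112, 58091415, 121193031, 70111718, 19030405, 53081314, 19030405, 34050809,
 31050708, 19030405, 45071112, 19030405, 14020304, 25040507, 34050710, 19030405, 19030405,
 18020405, 21030505, 17020404, 37040910, 26030607, 29030708, 45051112, 23030506, 26030607,
 40050911, 31040708, 15020304, 15020304, 15020304, 26030607, 38050910, 49061213, 33040809,
 41051011, 29040707, 38050910, 49061213, 23030506, 89122223, 23030506, 50071213, 38050910,
 27040607, 23030506, 26030607, 40050911, 17020404, 14020303, 31040708, 17020404, 43061011,
 15020304, 34050809, 15020304, 14020303, 39050910, 17020404, 13020303, 35050809, 20030405,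
 17020404, 20030405, 37060809, 31050707, 32050708, 31050708, 15020304, 13020303, 7010102,
 25040607, 37060910, 14020304, 7010102, 19020406, 13010304, 20020406, 41040913, 29030609,
 52051117, 70071523, 79081726, 32030710, 22020507, 40040913, 50051116, 88091929, 68071522,
 130132943, 175183958, 58061319, 30030709, 20020406, 20020406, 16020305, 35040711, 29030609,
 55061118, 82091727, 25030508, 53061117, 59071219, 103122134, 44050914, 34040711, 43050914,
 15020304, 49061015, 39050812, 20020406, 17020405, 30030709, 9010202, 23020507, 13010304,
 49051115, 29030609, 83091926, 32030710, 29030609, 23020507, 32030710, 13010304, 13010304,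
 37040911, 46051114, 13010304, 24030507, 9010202, 13010304, 23020507, 49051115, 29030609,
 83091926, 32030710, 30030709, 23020507, 29030609, 43050913, 33040710, 26030508, 33040710,
 42050913, 137163043, 35040711, 13010304, 49061115, 67081521, 43051013, 15020304, 26030508,
 16020305, 29030609, 16020305, 23030507, 40050912, 13010304, 49061115, 67081521, 43051013,
 16020305, 55071217, 13010304, 16020305, 16020305, 43060913, 52071116, 40050912, 37050811,
 31040709, 22030506, 30040709, 13010304, 17020405, 23030507, 13010304, 22030406, 22020506,
 22020407, 21020406, 24020507, 13010204, 44040913, 23020407, 33030610, 76071523, 54051116,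
 193183958, 53051016, 45040914, 23020506, 33030709, 14010304, 14010304, 35030711, 17020305,
 13010204, 28030508, 33030610, 38040711, 27030508, 59061118, 18020305, 29030509, 27030508,
 27030508, 19020306, 8010102, 18020305, 19020405, 23020506, 33030709, 43040912, 29030608,
 39040811, 32030709, 29030608, 40040911, 29030608, 18010405, 26030507, 29030608, 18020305,
 46050913, 39040811, 64071318, 44050912, 48051013, 8010102, 18020305, 8010102, 43050912, 25030507,
 25030507, 15020304, 18020305, 33040709, 9010202, 15020304, 17020305, 14010304, 10010203,
 24020507, 35030711, 16010305, 103102132, 33030710, 54051117, 43040913, 19010406, 27030508,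
 16010305, 56061117, 29030509, 29030509, 46050914, 19020306, 19020306, 36040711, 19020306,
 24020507, 35040710, 27030508, 29030608, 19020405, 29030608, 19020405, 27030508, 44050913,
 19020405, 19020405, 14010304, 25030507, 35040710, 8010102, 41050812, 31040609, 46060913, 8010102,
 15020304, 25030507, 14010304, 9010202, 33040709, 16010305, 8010102, 7010102, 8010102, 13010204,
 28030409, 43050614, 58070819, 33040510, 41050613, 34040511, 49060716, 67081022, 34040511,
 46050715, 43050614, 88101329, 43050614, 49060716]

set_option maxRecDepth 100000 in
theorem run23 : run table hints23 stk23 = stk24 := by decide +kernel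

def stk25 : List St := [⟨1,5,3,13,6,23,5,16,36,7,8,9,11⟩,
 ⟨1,5,3,13,6,23,6,19,16,3,3,4,5⟩,
 ⟨1,5,3,13,3,11,7,23,1,0,0,0,0⟩,
 ⟨1,5,3,13,3,11,6,19,23,4,5,6,7⟩,
 ⟨1,5,3,13,2,7,6,19,11,2,2,3,3⟩,
 ⟨1,5,3,13,2,7,2,6,19,3,4,5,6⟩,
 ⟨1,5,1,4,2,7,4,13,1,0,0,0,0⟩,
 ⟨1,5,1,4,2,7,2,6,13,2,3,3,4⟩,
 ⟨1,5,1,4,2,7,2,7,1,0,0,0,0⟩,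
 ⟨1,5,1,4,1,3,2,6,7,1,1,2,2⟩,
 ⟨1,5,1,5,1,3,2,6,1,0,0,0,0⟩,
 ⟨1,4,1,4,1,3,2,6,5,1,1,1,1⟩,
 ⟨1,4,1,4,1,3,2,5,6,1,1,1,2⟩,
 ⟨1,4,1,4,1,4,2,5,1,0,0,0,0⟩,
 ⟨1,4,1,3,1,3,2,5,4,0,1,1,1⟩,
 ⟨1,5,1,3,1,3,1,2,5,0,1,1,2⟩,
 ⟨1,4,1,3,1,3,1,3,1,0,0,0,0⟩,
 ⟨1,4,1,3,1,2,1,2,3,0,0,1,1⟩,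
 ⟨1,4,1,3,1,2,1,1,2,0,0,0,1⟩]

def hints24 : List ℕ := [
 41050613, 19020306, 34040511, 58070919, 25030408, 37040612, 34040511, 58070919, 19020306,
 31030510, 26030408, 28030409, 26030408, 25030408, 22030307, 46060715, 19020306, 52070817,
 83111327, 46060715, 73101124, 43060614, 65091021, 19020306, 52070817, 58080919, 19020306,
 43060713, 51070816, 38050612, 31040510, 37050612, 31040510, 19020306, 19020306, 22030307,
 50070816, 19020306, 22030307, 16020205, 23030307, 13010204, 33040510, 31040509, 31040509,
 33040510, 38050611, 33040510, 51070815, 58080917, 53070816, 51070815, 44060713, 37050611,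
 13010204, 29040409, 31040509, 57080917, 36050511, 37050611, 45060714, 37050611, 29040409,
 8010102, 43050614, 58070819, 16020205, 8010102, 13020203, 43060712, 53080815, 46070713, 19030305,
 14020204, 13020204, 20030306, 43060714, 82121327, 55080918, 43060714, 8010102, 5010101, 7010102,
 10010203, 13010304, 25020608, 22020507, 73071823, 22020507, 16020305, 22030407, 31040610,
 25030607, 61071518, 37040911, 17020405, 31040709, 17020405, 34040810, 37050811, 64091419,
 22030506, 38050911, 46061113, 43061012, 52071215, 88122125, 17020405, 22030506, 44061013,
 51071215, 22030506, 22030506, 17020405, 61081418, 52071215, 38050911, 52071215, 58081317,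
 22030506, 37050910, 29040708, 17020405, 29040708, 38050911, 45061113, 22030506, 45061113,
 38050911, 41051012, 45061113, 29040708, 51071215, 37050911, 65091619, 22030506, 17020405,
 46061113, 49061214, 55071316, 31040709, 61081517, 38050911, 31040709, 53071315, 19020406,
 13010304, 22020507, 16020305, 25030508, 17020405, 13010304, 37040911, 46051114, 23030507,
 40050912, 13010304, 49061115, 67081521, 43051013, 16020305, 55071217, 13010304, 16020305,
 16020305, 43060913, 52071116, 40050912, 37050811, 31040709, 22030506, 30040709, 13010304,
 17020405, 23030507, 13010304, 13020303, 22030506, 25030607, 46061113, 61081517, 40060911,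
 46071013, 34050809, 49071213, 37050910, 41061011, 61091516, 46071112, 53081314, 41061011,
 53081314, 41061011, 67101618, 46071112, 61091516, 49071213, 29040708, 54081315, 57081416,
 33050809, 61091517, 29040708, 37050910, 25030607, 43061012, 40060911, 61091417, 34050809,
 55081315, 40060911, 47071113, 34050809, 46071113, 34050809, 37050910, 41061011, 25030607,
 19030405, 40060911, 46071013, 32050709, 58091316, 22030506, 46071013, 32050709, 16030304,
 11020203, 25040507, 46080913, 61111217, 40070811, 34060709, 62111317, 34060709, 29050608,
 61111217, 40070811, 43070912, 82141723, 64111318, 46080913, 29050608, 34060709, 49091013,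
 67121418, 22040406, 29050608, 11020203, 26050507, 29050608, 36070710, 53101115, 11020203,
 31060608, 49091013, 37070710, 79151621, 58111215, 43080911, 34060709, 26050507, 82161721,
 26050507, 72141519, 41080811, 16030304, 28050607, 35060809, 58101315, 23040506, 31050708,
 31050708, 23040506, 31050708, 40070910, 22040505, 49091112, 22040505, 44081011, 40070910,
 23040506, 43080911, 43080911, 55101214, 67121517, 103192326, 50091113, 22040505, 37070809,
 22040505, 49091112, 22040505, 46091011, 31060707, 76151718, 91182022, 31060707, 58111314,
 41080910, 22040505, 31060707, 22040505, 81161820, 22040505, 41080910, 58111314, 49091112,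
 73141618, 61121315, 46091011, 31060707, 36070809, 23040506, 27050607, 27050607, 71141618,
 32060708, 43080911, 31060608, 82161721, 28050607, 52101113, 67131417, 47091012, 31060608,
 23040506, 28050607, 11020203, 18030405, 29050608, 23040506, 39070811, 23040506, 39070811,
 23040506, 45081012, 40070911, 40070911, 36060810, 40070911, 32050709, 23040506, 26050507,
 16030304, 42080911, 52101114, 16030304, 16030304, 36070809]

set_option maxRecDepth 100000 in
theorem run24 : run table hints24 stk24 = stk25 := by decide +kernel

def stk26 : List St := [⟨6,36,7,36,11,36,2,6,7,1,1,2,2⟩,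
 ⟨2,11,1,5,5,17,2,6,7,1,1,2,2⟩,
 ⟨2,11,2,11,4,13,2,6,7,1,1,2,2⟩,
 ⟨1,5,1,5,4,13,4,13,7,1,1,2,2⟩,
 ⟨1,4,1,4,1,3,2,6,5,1,1,1,1⟩,
 ⟨1,4,1,4,1,3,2,5,6,1,1,1,2⟩,
 ⟨1,4,1,4,1,4,2,5,1,0,0,0,0⟩,
 ⟨1,4,1,3,1,3,2,5,4,0,1,1,1⟩,
 ⟨1,5,1,3,1,3,1,2,5,0,1,1,2⟩,
 ⟨1,4,1,3,1,3,1,3,1,0,0,0,0⟩,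
 ⟨1,4,1,3,1,2,1,2,3,0,0,1,1⟩,
 ⟨1,4,1,3,1,2,1,1,2,0,0,0,1⟩]

def hints25 : List ℕ := [
 31060708, 71141618, 32060708, 27050607, 31060708, 37070810, 41080911, 27050607, 45081012,
 42080911, 16030304, 46091012, 26050507, 33060709, 26050507, 39070811, 16030304, 36070710,
 53101115, 43080912, 18030405, 37070810, 32060709, 57111216, 47091013, 32060709, 51101114,
 41080911, 27050607, 37070810, 31060708, 23040506, 23040506, 37060810, 32050709, 22030506,
 58091316, 25040507, 25040507, 29050608, 47081013, 31050708, 64111417, 49081113, 18030405,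
 32050709, 22030506, 29050608, 25040507, 32050709, 41070911, 22030506, 31050708, 38070810,
 29050608, 25040507, 47081013, 37060810, 34060709, 52091114, 11020203, 25040507, 16030304,
 11020203, 18030405, 33050809, 43071012, 46071113, 25040607, 37060910, 50081214, 25040607,
 53081315, 57091416, 37060910, 30050708, 33050809, 37060910, 23040506, 40070911, 17030404,
 23040506, 46081112, 34060809, 50091213, 23040506, 17030404, 41071011, 37060910, 29050708,
 45081112, 62111517, 41071011, 34060809, 17030404, 37060910, 59101416, 63111517, 29050708,
 53091314, 41071011, 23040506, 30050708, 36060810, 40070911, 39070911, 25040607, 47081113,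
 39070911, 39070911, 17030404, 46081113, 17030404, 29050708, 37060910, 17030404, 17030404,
 30050708, 23040506, 46081112, 37060910, 23040506, 53091314, 41071011, 27050607, 23040506,
 30050708, 23040506, 41080911, 43081011, 56111314, 31060708, 41080911, 26050607, 31060708,
 23040506, 48091113, 53101214, 30050708, 23040506, 41080911, 21040505, 38070910, 41071011,
 45081112, 49091213, 53101314, 59111416, 45081112, 48091113, 49091213, 31060708, 26050607,
 52101214, 26050607, 72141719, 26050607, 37070910, 53101314, 57111415, 41081011, 46091112,
 46091112, 53101314, 53101314, 61121516, 41081011, 78151921, 37070910, 46091112, 42081011,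
 31060708, 86172122, 66131617, 31060708, 27050607, 34060809, 50091213, 23040506, 33060808,
 30050708, 21040505, 33060808, 70131718, 37070909, 47091112, 36070809, 34060809, 21040505,
 38070910, 22040506, 37070810, 33060709, 18030405, 32060709, 33060709, 36070710, 53101115,
 43080912, 57111216, 47091013, 18030405, 32060709, 51101114, 41080911, 41080911, 23040506,
 18030405, 17030404, 26040607, 25040606, 34050809, 46071112, 58091415, 121193031, 70111718,
 19030405, 53081314, 31050708, 34050809, 40070910, 43071011, 52091213, 76131819, 47081112,
 35060809, 19030405, 19030405, 42071011, 19030405, 45071112, 19030405, 29050707, 54091314,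
 41071010, 65111617, 23040506, 19030405, 19030405, 26040607, 22040505, 31050708, 28050607,
 52091213, 40070910, 61111415, 35060809, 23040506, 19030405, 39070910, 19030405, 26050606,
 16030304, 22040505, 11020203, 18030405, 25040607, 26050607, 37070910, 53101314, 57111415,
 41081011, 46091112, 46091112, 53101314, 53101314, 61121516, 41081011, 78151921, 37070910,
 46091112, 22040506, 18030405, 14020304, 13020204, 16020305, 28040509, 22030407, 10010203,
 34050710, 11020203, 25040507, 10010203, 46070914, 34050710, 19030405, 17030305, 37060711,
 46070914, 40070712, 43070813, 82141525, 31050609, 52091015, 46080913, 47080914, 56091117,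
 76131523, 23040407, 31050609, 28050508, 31050609, 46080913, 10010203, 17030305, 41070812,
 23040407, 29050608, 24040507, 19030405, 35060710, 35060710, 17030305, 17030305, 24040507,
 17030305, 17030305, 11020203, 10010203, 17030305, 10010203, 7010102, 16020305, 22030407,
 31040610, 16030304, 11020203, 46080913, 61111217, 22040406, 11020203, 31060608, 13020204,
 22030407, 28040509, 16020305, 11020203, 17030305, 37060711, 46070914, 40070712, 43070813,
 82141525, 31050609, 52091015, 46080913, 47080914, 56091117, 76131523, 23040407]

set_option maxRecDepth 100000 in
theorem run25 : run table hints25 stk25 = stk26 := by decide +kernel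

def stk27 : List St := [⟨6,31,3,13,9,37,2,6,22,4,5,5,7⟩,
 ⟨1,5,3,13,1,4,12,37,1,0,0,0,0⟩,
 ⟨1,5,3,13,1,4,2,6,37,7,8,9,12⟩,
 ⟨1,5,1,4,1,4,4,13,1,0,0,0,0⟩,
 ⟨1,5,1,4,1,4,2,6,13,2,3,3,4⟩,
 ⟨1,4,1,4,1,4,2,6,5,1,1,1,1⟩,
 ⟨1,4,1,4,1,4,2,5,6,1,1,1,2⟩,
 ⟨1,4,1,3,1,3,2,5,4,0,1,1,1⟩,
 ⟨1,5,1,3,1,3,1,2,5,0,1,1,2⟩,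
 ⟨1,4,1,3,1,3,1,3,1,0,0,0,0⟩,
 ⟨1,4,1,3,1,2,1,2,3,0,0,1,1⟩,
 ⟨1,4,1,3,1,2,1,1,2,0,0,0,1⟩]

def hints26 : List ℕ := [
 31050609, 28050508, 31050609, 46080913, 17030305, 11020203, 15030304, 14030303, 10020202,
 25050606, 35070809, 24050506, 27050607, 19040405, 17030404, 24050506, 44091011, 52111213,
 59121415, 24050506, 39080910, 19040405, 31060708, 29060707, 69141718, 54111314, 19040405,
 34070809, 77161920, 33070808, 85182122, 21040505, 10020202, 9020202, 29060707, 25050606,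
 69141718, 54111314, 43091011, 39080910, 19040405, 32070708, 23050506, 60131415, 32070708,
 25050606, 19040405, 51111213, 23050506, 39080910, 19040405, 77161920, 34070809, 37080909,
 33070808, 62131516, 85182122, 23050506, 55121314, 42091011, 23050506, 78171920, 105232627,
 41091010, 25050606, 9020202, 9020202, 23050506, 19040405, 11020203, 9010202, 12020203, 11020202,
 19030404, 13020203, 18030304, 29050606, 24040505, 78131617, 41070809, 23040405, 41070809,
 64111314, 28050506, 103182122, 34060707, 34060707, 118212425, 39070808, 39070808, 41070809,
 40070809, 24040505, 44070910, 29050606, 31050607, 29050606, 45080910, 35060708, 30050607,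
 17030304, 37060709, 29050507, 21030405, 29050507, 41070810, 56101113, 35060708, 45080910,
 24040505, 25040506, 17030304, 25040506, 29050606, 14020303, 25040506, 17030304, 17030304,
 29050607, 17030304, 29050607, 37060809, 17030304, 17030304, 13020203, 5010101, 17030304,
 14020303, 53091113, 37060809, 23040505, 23040505, 31060607, 39070809, 14020303, 53101112,
 48091011, 26050506, 37070808, 14020303, 67131415, 86171819, 26050506, 66131415, 57111213,
 47091011, 41080909, 26050506, 21040405, 29050607, 37070709, 38070809, 23040505, 23040505,
 33060708, 26050506, 38070809, 23040505, 32060707, 66131415, 47091011, 41080909, 51101112,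
 17030304, 21040405, 11020202, 24040505, 23040405, 41070809, 68111415, 83141718, 29050606,
 28050506, 103182122, 34060707, 34060707, 118212425, 39070808, 34060707, 50091011, 14020303,
 14020303, 5010101, 23040505, 14020303, 47091010, 6010101, 9010202, 13010303, 21020505, 21030405,
 29040607, 38050809, 33040708, 41050910, 23030505, 37050809, 23030505, 41050910, 74101618,
 59081314, 23030505, 23030505, 33040708, 53071113, 23030505, 38050809, 43060910, 46061011,
 51071112, 43060910, 38050809, 58081214, 37050809, 57081214, 89121922, 23030505, 13020203,
 33050608, 37060709, 14020303, 23030505, 43060910, 13020203, 34050708, 48071011, 53081112,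
 43060910, 68101416, 81121719, 47071011, 19030404, 53081112, 71111516, 33050707, 31050607,
 53081112, 58091213, 63101314, 68111415, 43070909, 44070910, 79131618, 49081011, 58091213,
 38060808, 44070910, 49081011, 33050707, 19030404, 43070910, 38060809, 26040506, 19030404,
 28040606, 47071011, 41060909, 13020203, 87131920, 59091313, 23030505, 32050707, 41060909,
 32050707, 14020303, 25040506, 33050708, 45070911, 53081113, 66101416, 77121619, 19030404,
 19030404, 38060809, 19030404, 45070911, 29040607, 43070910, 49081012, 125202631, 19030404,
 33050708, 41060910, 37050809, 46071011, 32050707, 25040506, 33050708, 34050708, 29040607,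
 49071012, 69101417, 14020303, 38050809, 13020203, 41060810, 49071012, 69101417, 46070911,
 54081113, 25040506, 45070911, 37060709, 29040607, 25040506, 14020303, 63101315, 29040607,
 19030404, 14020303, 23030505, 14020303, 38060808, 14020303, 17020404, 13010303, 21020505,
 18020404, 22030505, 13010303, 37050809, 45061011, 70091617, 31040707, 45061011, 53071213,
 69091617, 47061111, 30040707, 37050809, 31040707, 50071112, 18020404, 13010303, 13020303,
 21030505, 17020404, 37060809, 31050707, 5010101, 13020303, 37070809, 22040505, 49091112,
 22040505, 46091011, 31060707, 76151718, 91182022, 31060707]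

set_option maxRecDepth 100000 in
theorem run26 : run table hints26 stk26 = stk27 := by decide +kernel

def stk28 : List St := [⟨1,15,2,7,2,7,4,11,4,0,1,1,1⟩,
 ⟨1,12,4,15,2,7,3,8,4,0,1,1,1⟩,
 ⟨1,8,2,7,2,7,4,12,4,0,1,1,1⟩,
 ⟨1,4,2,7,2,7,2,7,4,0,1,1,1⟩,
 ⟨1,5,1,3,1,3,1,2,5,0,1,1,2⟩,
 ⟨1,4,1,3,1,3,1,3,1,0,0,0,0⟩,
 ⟨1,4,1,3,1,2,1,2,3,0,0,1,1⟩,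
 ⟨1,4,1,3,1,2,1,1,2,0,0,0,1⟩]

def hints27 : List ℕ := [
 58111314, 41080910, 22040505, 31060707, 22040505, 81161820, 22040505, 41080910, 58111314,
 49091112, 73141618, 61121315, 46091011, 31060707, 17030404, 21040505, 17030404, 25040606,
 22040505, 61111415, 26050606, 22040505, 14030303, 10020202, 21040505, 17030404, 25050606,
 10020202, 9020202, 29060707, 25050606, 9020202, 5010101, 14020303, 11020202, 18030304, 24040505,
 23040405, 41070809, 68111415, 83141718, 29050606, 28050506, 103182122, 34060707, 34060707,
 118212425, 39070808, 34060707, 50091011, 30050607, 17030304, 21030405, 13020203, 29050507,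
 13020203, 37060709, 29050507, 41070810, 57101113, 56101113, 24040505, 40070809, 31050607,
 35060708, 13020203, 57101113, 13020203, 34060707, 45080910, 35060708, 19030404, 35060708,
 17030304, 25040506, 29050607, 25040506, 13020203, 17030304, 53091113, 31060607, 39070809,
 53101112, 43080910, 67131415, 86171819, 26050506, 21040405, 29050607, 37070709, 26050506,
 11020202, 24040505, 34060707, 118212425, 39070808, 9010202, 21040405, 29050607, 37060809,
 17030304, 37070709, 23040505, 60111314, 38070809, 17030304, 32060707, 33060708, 17030304,
 26050506, 23040505, 43080910, 17030304, 32060707, 32060707, 23040505, 57111213, 71141516,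
 47091011, 41080909, 51101112, 23040505, 11020202, 13020203, 18030304, 23040405, 31050607,
 17030304, 37060709, 29050507, 21030405, 29050507, 41070810, 56101113, 13020203, 17030304,
 21040405, 7000202, 8010202, 8000202, 12010303, 20010506, 26010708, 11000303, 31010810, 19000506,
 43011114, 46011215, 34010911, 41011113, 37011012, 28010709, 43011114, 19000506, 30010809,
 41011113, 37011012, 25000708, 40011113, 47011315, 43011214, 43011214, 46011315, 53011517,
 31010810, 29010809, 39011112, 47011315, 65021821, 25000708, 32010910, 34010911, 28010709,
 29010809, 43011214, 32010910, 85032428, 28010709, 19000506, 43011114, 31010810, 46011215,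
 31010810, 34010911, 41011113, 23010607, 27010708, 19000506, 19000506, 30010809, 25010608,
 25010608, 51021316, 22010507, 27010708, 31010810, 23010607, 34010911, 41021113, 11000303,
 30010809, 47021314, 43021213, 23010607, 25010708, 61021720, 85032428, 53021517, 22010607,
 55021518, 73032024, 47021315, 64031721, 32010910, 15010404, 11000303, 19010505, 27010708,
 17010405, 17010405, 31020809, 18010505, 25010707, 37021011, 31020809, 37021011, 17010405,
 47031313, 14010304, 17010405, 19010505, 35020910, 31020809, 19010505, 27020707, 25020607,
 25020607, 39031011, 25020607, 27020708, 38031011, 25020707, 16010405, 22010607, 29010809,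
 32010910, 43011214, 26010708, 70031923, 25010708, 32010910, 85032428, 53021517, 76032125,
 47021315, 19010506, 23010607, 49021316, 64031721, 26010708, 41021113, 59031619, 35020911,
 58031519, 52031317, 50031316, 23010607, 18010505, 26010708, 61031719, 39021112, 19010506,
 26010708, 19010506, 67041821, 15010404, 18010505, 26010708, 23010607, 33020910, 27020708,
 23010607, 29020709, 13010304, 43031113, 40031112, 43031213, 46031314, 13010304, 25020707,
 29020809, 25020707, 13010304, 13010304, 19010506, 22010607, 16010405, 16010405, 43031213,
 46031314, 29020809, 29020809, 11010303, 37031011, 40031112, 43031213, 25020707, 23020607,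
 25020707, 34030910, 47041314, 25020707, 23020607, 57051617, 28030708, 31030809, 34030910,
 37031011, 23020607, 23020607, 10010203, 49051314, 10010203, 23020607, 41041112, 19020505,
 43051112, 58071516, 10010203, 23020607, 35040910, 19020505, 27030708, 17020405, 19020505,
 17020405, 27030708, 26030707, 26030707, 42051112, 19020505, 11010303, 10010203, 17020405,
 8010202, 12010303, 8000202, 15010404, 11000303, 19010505]

set_option maxRecDepth 100000 in
theorem run27 : run table hints27 stk27 = stk28 := by decide +kernel

def stk29 : List St := [⟨1,19,2,9,5,21,1,2,5,0,1,1,2⟩,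
 ⟨1,15,4,19,5,21,1,2,5,0,1,1,2⟩,
 ⟨1,15,2,9,5,21,9,19,5,0,1,1,2⟩,
 ⟨1,15,2,9,1,4,10,21,5,0,1,1,2⟩,
 ⟨1,10,2,9,1,4,7,15,5,0,1,1,2⟩,
 ⟨1,10,2,9,2,9,1,2,5,0,1,1,2⟩,
 ⟨1,10,1,4,1,4,4,9,5,0,1,1,2⟩,
 ⟨1,4,1,3,1,3,1,3,1,0,0,0,0⟩,
 ⟨1,4,1,3,1,2,1,2,3,0,0,1,1⟩,
 ⟨1,4,1,3,1,2,1,1,2,0,0,0,1⟩]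

def hints28 : List ℕ := [
 18010505, 19010505, 27020707, 25020607, 25020607, 39031011, 25020607, 19020505, 11010303,
 43051112, 58071516, 11010303, 11010303, 8010202, 4000101, 10010202, 10000203, 9000202, 20010405,
 11000203, 25010506, 15000304, 39010810, 19000405, 53011114, 43010911, 51011113, 73011619,
 23000506, 61011316, 59011315, 55011214, 43010911, 47011012, 61011316, 55011214, 91022023,
 41010910, 23000506, 35010709, 49011013, 55021114, 33010708, 37010809, 51011113, 41010910,
 91022023, 79021720, 75021619, 43010911, 29010607, 67021417, 91031923, 59021215, 83031721,
 59021314, 55021213, 29010607, 28010607, 28010607, 19000405, 29010607, 32010708, 23000506,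
 68021517, 33010708, 65021417, 29010607, 34010709, 31010608, 27010507, 19000405, 28010607,
 23010505, 47021011, 55021213, 51021112, 51021112, 73031617, 43020910, 47021011, 24010506,
 15000304, 28010607, 42010911, 19000405, 19000405, 26010507, 28010607, 15000304, 23010406,
 49021013, 21010405, 21010405, 23010506, 7000102, 29010608, 23010506, 25010507, 23010506,
 24010507, 15010303, 21010405, 29010607, 37010809, 33010708, 25010506, 23010505, 47021011,
 55021213, 51021112, 51021112, 73031617, 25010506, 47021011, 43020910, 23010505, 19010404,
 23010505, 51021112, 73031617, 47021011, 43020910, 39020809, 43020910, 61031314, 35020708,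
 39020809, 55031113, 49031011, 53031112, 63041314, 17010304, 17010304, 17010304, 41020910,
 37020809, 19010404, 19010404, 19010404, 33020708, 37020809, 47031011, 14010303, 33020708,
 29020607, 46031011, 25020506, 29020607, 41030810, 13010203, 13010203, 11010202, 13010203,
 24020505, 35030708, 24020505, 34030708, 34030708, 21020405, 43040910, 31030607, 21020405,
 33030708, 15010304, 7000102, 19010405, 25010507, 23010506, 29010608, 23010506, 25010507,
 34020709, 16010304, 39020811, 16010304, 24010507, 17010305, 19010405, 32020709, 17010305,
 32020709, 12010203, 16010304, 19010405, 14010303, 14010303, 19010405, 19010405, 14010303,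
 25020506, 34030708, 21020405, 33030708, 23020506, 34030709, 15010303, 19010404, 11010202,
 14010303, 15010304, 22010506, 7000102, 30010708, 37010910, 25000607, 41011011, 46011113,
 39010911, 34010809, 33010809, 32010709, 26010607, 23010506, 26010607, 25010606, 34010809,
 53021314, 26010607, 33010809, 25010607, 29010708, 17000405, 38010911, 33010809, 31010709,
 17000405, 26010607, 25010607, 27010608, 24010507, 25010607, 61021518, 7000102, 19010405,
 23010506, 25010507, 25010507, 40020911, 25010507, 16010304, 39020811, 16010304, 18010405,
 24010507, 17010305, 19010405, 31010709, 18010405, 32020709, 18010405, 17010305, 32020709,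
 21010505, 30010708, 34010809, 25010606, 34010809, 23010506, 49021213, 26010607, 45021112,
 19010405, 23010506, 35020809, 39020910, 16010304, 16010304, 17010404, 17010404, 19010405,
 45021112, 54031314, 41021011, 19010405, 37020910, 18010405, 25010607, 47021114, 38020911,
 33020809, 13010303, 17010404, 21010505, 25010606, 34010809, 23010506, 49021213, 23010506,
 39020910, 19010405, 54031314, 16010304, 23010506, 35020809, 14010303, 30020707, 31020708,
 35020809, 14010303, 19010405, 14010303, 44031011, 19010405, 42031011, 27020607, 12010203,
 14010303, 16010304, 23010506, 31020708, 19010405, 16010304, 19010405, 19010405, 27020607,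
 40030910, 27020607, 14010303, 21020405, 25020506, 22020505, 45041011, 33030708, 41040910,
 32030708, 27020607, 22020505, 42040911, 23020506, 14010303, 10010202, 9000202, 15010303,
 21010405, 29010607, 37010809, 33010708, 25010506, 23010505, 47021011, 55021213, 51021112,
 51021112, 73031617, 25010506, 47021011, 43020910, 23010505, 19010404]

set_option maxRecDepth 100000 in
theorem run28 : run table hints28 stk28 = stk29 := by decide +kernel

def stk30 : List St := [⟨1,5,7,33,2,7,8,26,11,2,2,3,3⟩,
 ⟨1,5,3,13,2,7,10,33,11,2,2,3,3⟩,
 ⟨6,32,7,32,9,32,10,32,11,2,2,3,3⟩,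
 ⟨1,5,3,13,2,7,1,3,19,3,4,5,6⟩,
 ⟨1,5,1,4,2,7,4,13,1,0,0,0,0⟩,
 ⟨1,5,1,4,2,7,1,3,13,2,3,3,4⟩,
 ⟨1,5,1,4,2,7,2,7,1,0,0,0,0⟩,
 ⟨1,5,1,4,1,3,1,3,7,1,1,2,2⟩,
 ⟨1,5,1,5,1,3,1,3,1,0,0,0,0⟩,
 ⟨1,4,1,4,1,3,1,3,5,1,1,1,1⟩,
 ⟨1,4,1,4,1,4,1,3,1,0,0,0,0⟩,
 ⟨1,4,1,3,1,3,1,3,4,0,1,1,1⟩,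
 ⟨1,4,1,3,1,2,1,2,3,0,0,1,1⟩,
 ⟨1,4,1,3,1,2,1,1,2,0,0,0,1⟩]

def hints29 : List ℕ := [
 23010505, 51021112, 73031617, 47021011, 43020910, 39020809, 43020910, 61031314, 35020708,
 39020809, 55031113, 49031011, 53031112, 63041314, 17010304, 17010304, 17010304, 41020910,
 37020809, 19010404, 19010404, 19010404, 33020708, 37020809, 47031011, 14010303, 33020708,
 29020607, 46031011, 25020506, 29020607, 41030810, 13010203, 13010203, 11010202, 13010203,
 24020505, 35030708, 24020505, 34030708, 34030708, 21020405, 43040910, 31030607, 21020405,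
 33030708, 15010303, 19010404, 11010202, 14010303, 13010303, 17010404, 21010505, 14010303,
 30020707, 14010303, 21020405, 25020506, 22020505, 45041011, 33030708, 41040910, 14010303,
 4000101, 5010101, 7010102, 10010203, 13010304, 25020608, 22020507, 73071823, 22020507, 16020305,
 22030407, 31040610, 25030607, 61071518, 37040911, 17020405, 31040709, 17020405, 34040810,
 37050811, 64091419, 22030506, 38050911, 46061113, 43061012, 52071215, 88122125, 17020405,
 22030506, 44061013, 51071215, 22030506, 22030506, 17020405, 61081418, 52071215, 38050911,
 52071215, 58081317, 22030506, 37050910, 29040708, 17020405, 29040708, 38050911, 45061113,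
 22030506, 45061113, 38050911, 41051012, 45061113, 29040708, 51071215, 37050911, 65091619,
 22030506, 17020405, 46061113, 49061214, 55071316, 31040709, 61081517, 38050911, 31040709,
 53071315, 19020406, 13010304, 22020507, 16020305, 25030508, 17020405, 13010304, 37040911,
 46051114, 23030507, 40050912, 13010304, 49061115, 67081521, 43051013, 16020305, 55071217,
 13010304, 16020305, 16020305, 43060913, 52071116, 40050912, 37050811, 31040709, 22030506,
 30040709, 13010304, 17020405, 23030507, 13010304, 13020303, 22030506, 25030607, 46061113,
 61081517, 40060911, 46071013, 34050809, 49071213, 37050910, 41061011, 61091516, 46071112,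
 53081314, 41061011, 53081314, 41061011, 67101618, 46071112, 61091516, 49071213, 29040708,
 54081315, 57081416, 33050809, 61091517, 29040708, 37050910, 25030607, 43061012, 40060911,
 61091417, 34050809, 55081315, 40060911, 47071113, 34050809, 46071113, 34050809, 37050910,
 41061011, 25030607, 19030405, 40060911, 46071013, 32050709, 58091316, 22030506, 46071013,
 32050709, 16030304, 11020203, 25040507, 46080913, 61111217, 40070811, 34060709, 62111317,
 34060709, 29050608, 61111217, 40070811, 43070912, 82141723, 64111318, 46080913, 29050608,
 34060709, 49091013, 67121418, 22040406, 29050608, 11020203, 26050507, 29050608, 36070710,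
 53101115, 11020203, 31060608, 49091013, 37070710, 79151621, 58111215, 43080911, 34060709,
 26050507, 82161721, 26050507, 72141519, 41080811, 16030304, 28050607, 35060809, 58101315,
 23040506, 31050708, 31050708, 23040506, 31050708, 40070910, 22040505, 49091112, 22040505,
 44081011, 40070910, 23040506, 43080911, 43080911, 55101214, 67121517, 103192326, 50091113,
 22040505, 37070809, 22040505, 49091112, 22040505, 46091011, 31060707, 76151718, 91182022,
 31060707, 58111314, 41080910, 22040505, 31060707, 22040505, 81161820, 22040505, 41080910,
 58111314, 49091112, 73141618, 61121315, 46091011, 31060707, 36070809, 23040506, 27050607,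
 27050607, 71141618, 32060708, 43080911, 31060608, 82161721, 28050607, 52101113, 67131417,
 47091012, 31060608, 23040506, 28050607, 11020203, 18030405, 29050608, 23040506, 39070811,
 23040506, 39070811, 23040506, 45081012, 40070911, 40070911, 36060810, 40070911, 32050709,
 23040506, 26050507, 16030304, 42080911, 52101114, 16030304, 16030304, 36070809, 31060708,
 71141618, 32060708, 27050607, 31060708, 37070810, 41080911, 27050607, 45081012, 42080911,
 16030304, 46091012, 26050507, 33060709, 26050507, 39070811, 16030304]

set_option maxRecDepth 100000 in
theorem run29 : run table hints29 stk29 = stk30 := by decide +kernel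

def stk31 : List St := [⟨3,14,6,25,9,35,5,17,5,1,1,1,1⟩,
 ⟨3,14,6,25,4,15,10,35,5,1,1,1,1⟩,
 ⟨7,34,8,34,9,34,10,34,5,1,1,1,1⟩,
 ⟨3,14,1,4,4,15,7,25,5,1,1,1,1⟩,
 ⟨5,24,1,4,6,24,7,24,5,1,1,1,1⟩,
 ⟨3,14,3,14,4,15,1,3,5,1,1,1,1⟩,
 ⟨1,4,1,4,4,15,4,14,5,1,1,1,1⟩,
 ⟨3,13,3,13,3,13,4,13,5,1,1,1,1⟩,
 ⟨1,4,1,4,4,15,4,15,5,1,1,1,1⟩,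
 ⟨3,14,3,14,4,14,4,14,5,1,1,1,1⟩,
 ⟨1,4,1,4,1,4,1,3,1,0,0,0,0⟩,
 ⟨1,4,1,3,1,3,1,3,4,0,1,1,1⟩,
 ⟨1,4,1,3,1,2,1,2,3,0,0,1,1⟩,
 ⟨1,4,1,3,1,2,1,1,2,0,0,0,1⟩]

def hints30 : List ℕ := [
 36070710, 53101115, 43080912, 18030405, 37070810, 32060709, 57111216, 47091013, 32060709,
 51101114, 41080911, 27050607, 37070810, 31060708, 23040506, 23040506, 37060810, 32050709,
 22030506, 58091316, 25040507, 25040507, 29050608, 47081013, 31050708, 64111417, 49081113,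
 18030405, 32050709, 22030506, 29050608, 25040507, 32050709, 41070911, 22030506, 31050708,
 38070810, 29050608, 25040507, 47081013, 37060810, 34060709, 52091114, 11020203, 25040507,
 16030304, 11020203, 18030405, 33050809, 43071012, 46071113, 25040607, 37060910, 50081214,
 25040607, 53081315, 57091416, 37060910, 30050708, 33050809, 37060910, 23040506, 40070911,
 17030404, 23040506, 46081112, 34060809, 50091213, 23040506, 17030404, 41071011, 37060910,
 29050708, 45081112, 62111517, 41071011, 34060809, 17030404, 37060910, 59101416, 63111517,
 29050708, 53091314, 41071011, 23040506, 30050708, 36060810, 40070911, 39070911, 25040607,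
 47081113, 39070911, 39070911, 17030404, 46081113, 17030404, 29050708, 37060910, 17030404,
 17030404, 30050708, 23040506, 46081112, 37060910, 23040506, 53091314, 41071011, 27050607,
 23040506, 30050708, 23040506, 41080911, 43081011, 56111314, 31060708, 41080911, 26050607,
 31060708, 23040506, 48091113, 53101214, 30050708, 23040506, 41080911, 21040505, 38070910,
 41071011, 45081112, 49091213, 53101314, 59111416, 45081112, 48091113, 49091213, 31060708,
 26050607, 52101214, 26050607, 72141719, 26050607, 37070910, 53101314, 57111415, 41081011,
 46091112, 46091112, 53101314, 53101314, 61121516, 41081011, 78151921, 37070910, 46091112,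
 42081011, 31060708, 86172122, 66131617, 31060708, 27050607, 34060809, 50091213, 23040506,
 33060808, 30050708, 21040505, 33060808, 70131718, 37070909, 47091112, 36070809, 34060809,
 21040505, 38070910, 22040506, 37070810, 33060709, 18030405, 32060709, 33060709, 36070710,
 53101115, 43080912, 57111216, 47091013, 18030405, 32060709, 51101114, 41080911, 41080911,
 23040506, 18030405, 17030404, 26040607, 25040606, 34050809, 46071112, 58091415, 121193031,
 70111718, 19030405, 53081314, 31050708, 34050809, 40070910, 43071011, 52091213, 76131819,
 47081112, 35060809, 19030405, 19030405, 42071011, 19030405, 45071112, 19030405, 29050707,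
 54091314, 41071010, 65111617, 23040506, 19030405, 19030405, 26040607, 22040505, 31050708,
 28050607, 52091213, 40070910, 61111415, 35060809, 23040506, 19030405, 39070910, 19030405,
 26050606, 16030304, 22040505, 11020203, 18030405, 25040607, 26050607, 37070910, 53101314,
 57111415, 41081011, 46091112, 46091112, 53101314, 53101314, 61121516, 41081011, 78151921,
 37070910, 46091112, 22040506, 18030405, 14020304, 13020204, 16020305, 28040509, 22030407,
 10010203, 34050710, 11020203, 25040507, 10010203, 46070914, 34050710, 19030405, 17030305,
 37060711, 46070914, 40070712, 43070813, 82141525, 31050609, 52091015, 46080913, 47080914,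
 56091117, 76131523, 23040407, 31050609, 28050508, 31050609, 46080913, 10010203, 17030305,
 41070812, 23040407, 29050608, 24040507, 19030405, 35060710, 35060710, 17030305, 17030305,
 24040507, 17030305, 17030305, 11020203, 10010203, 17030305, 10010203, 7010102, 16020305,
 22030407, 31040610, 16030304, 11020203, 46080913, 61111217, 22040406, 11020203, 31060608,
 13020204, 22030407, 28040509, 16020305, 11020203, 17030305, 37060711, 46070914, 40070712,
 43070813, 82141525, 31050609, 52091015, 46080913, 47080914, 56091117, 76131523, 23040407,
 31050609, 28050508, 31050609, 46080913, 17030305, 11020203, 15030304, 14030303, 10020202,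
 25050606, 35070809, 24050506, 27050607, 19040405, 17030404, 24050506, 44091011]

set_option maxRecDepth 100000 in
theorem run30 : run table hints30 stk30 = stk31 := by decide +kernel

def stk32 : List St := [⟨1,12,1,9,2,5,13,31,3,0,0,1,1⟩,
 ⟨2,28,3,28,11,28,6,14,3,0,0,1,1⟩,
 ⟨1,12,1,6,2,5,4,9,3,0,0,1,1⟩,
 ⟨1,12,1,12,2,5,1,2,3,0,0,1,1⟩,
 ⟨1,6,1,6,2,5,5,12,3,0,0,1,1⟩,
 ⟨1,6,1,6,2,5,2,5,3,0,0,1,1⟩,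
 ⟨1,4,1,3,1,2,1,1,2,0,0,0,1⟩]

def hints31 : List ℕ := [
 52111213, 59121415, 24050506, 39080910, 19040405, 31060708, 29060707, 69141718, 54111314,
 19040405, 34070809, 77161920, 33070808, 85182122, 21040505, 10020202, 9020202, 29060707,
 25050606, 69141718, 54111314, 43091011, 39080910, 19040405, 32070708, 23050506, 60131415,
 32070708, 25050606, 19040405, 51111213, 23050506, 39080910, 19040405, 77161920, 34070809,
 37080909, 33070808, 62131516, 85182122, 23050506, 55121314, 42091011, 23050506, 78171920,
 105232627, 41091010, 25050606, 9020202, 9020202, 23050506, 19040405, 11020203, 5010101, 13020303,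
 37070809, 22040505, 49091112, 22040505, 46091011, 31060707, 76151718, 91182022, 31060707,
 58111314, 41080910, 22040505, 31060707, 22040505, 81161820, 22040505, 41080910, 58111314,
 49091112, 73141618, 61121315, 46091011, 31060707, 17030404, 21040505, 17030404, 25040606,
 22040505, 61111415, 26050606, 22040505, 14030303, 10020202, 21040505, 17030404, 25050606,
 10020202, 9020202, 29060707, 25050606, 9020202, 8010202, 7000202, 13010304, 19010506, 22010607,
 16010405, 16010405, 43031213, 46031314, 29020809, 29020809, 11010303, 37031011, 40031112,
 43031213, 25020707, 23020607, 25020707, 34030910, 47041314, 25020707, 23020607, 57051617,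
 28030708, 31030809, 34030910, 37031011, 23020607, 23020607, 10010203, 49051314, 10010203,
 23020607, 41041112, 19020505, 43051112, 58071516, 10010203, 23020607, 35040910, 19020505,
 27030708, 17020405, 19020505, 17020405, 27030708, 26030707, 26030707, 42051112, 19020505,
 11010303, 10010203, 17020405, 19020505, 11010303, 43051112, 58071516, 11010303, 11010303,
 6000102, 5000002, 12010104, 9000103, 11000104, 17010106, 13000105, 21010108, 31010212, 41010316,
 53010421, 33010213, 43010317, 73020529, 23010109, 33010213, 51020320, 53020321, 71030428,
 49020319, 49020319, 67030426, 29010211, 47020318, 27010210, 43020316, 28010211, 23010109,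
 23010109, 19010107, 27010210, 29010211, 61030423, 45020317, 43020316, 45020317, 59030422,
 55030420, 28010211, 18010107, 58030423, 19010107, 19010107, 18010107, 18010107, 27010210,
 35010313, 45010417, 81020731, 37010314, 37010314, 29010211, 63020524, 61020523, 19010107,
 29010211, 45020317, 21010108, 61030423, 43020316, 45020317, 59030422, 55030420, 25010209,
 57020521, 41020315, 71040526, 39020314, 55030420, 23010208, 37020313, 39020314, 19010107,
 24010209, 40020315, 37020314, 19010107, 23010208, 23010209, 18010107, 38020315, 24010209,
 24010209, 21010108, 23010109, 53020321, 71030428, 15010105, 23010208, 35020312, 49030417,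
 63040522, 35020312, 47030416, 47030416, 16010106, 13000105, 18010107, 28010211, 24010209,
 37020314, 18010107, 23010209, 38020315, 24010209, 35020313, 14010105, 15010105, 35020313,
 46030417, 35020313, 13010104, 14010105, 13010105, 15010105, 21010207, 31010311, 39010414,
 47010517, 37010413, 23010208, 53020519, 25010209, 29010310, 37010413, 23010208, 51020518,
 47020516, 28010310, 23010208, 23010208, 25010209, 17010106, 25010209, 39020314, 37020313,
 39020314, 35020312, 49030417, 63040522, 33020311, 35020312, 53030518, 35020312, 47030416,
 47030416, 17010106, 20010207, 28010310, 17010106, 31020311, 32020311, 20010207, 14010105,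
 31020311, 13010104, 31020311, 31020311, 29020310, 13010104, 13010104, 37030412, 14010105,
 29020310, 14010105, 21010208, 29010311, 31010312, 23010209, 31010312, 23010209, 28010311,
 16010106, 23010209, 18010107, 34020313, 33020313, 19010207, 16010106, 20010207, 31020311,
 30020311, 47030517, 20010207, 19010207, 31020312, 48030519, 29020310, 31020312, 19010207,
 13010105, 33020313, 29020311, 13010105, 19010207]

set_option maxRecDepth 100000 in
theorem run31 : run table hints31 stk31 = stk32 := by decide +kernel

def stk33 : List St := [⟨1,25,1,8,2,11,17,26,2,0,0,0,1⟩,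
 ⟨1,19,3,25,2,11,17,26,2,0,0,0,1⟩,
 ⟨1,13,2,19,2,11,2,3,2,0,0,0,1⟩,
 ⟨1,13,1,8,3,19,2,3,2,0,0,0,1⟩,
 ⟨1,13,1,8,2,11,12,19,2,0,0,0,1⟩,
 ⟨1,13,1,8,1,5,7,11,2,0,0,0,1⟩,
 ⟨1,13,1,7,1,5,5,8,2,0,0,0,1⟩,
 ⟨1,13,1,13,1,5,2,3,2,0,0,0,1⟩,
 ⟨1,9,1,7,2,13,2,3,2,0,0,0,1⟩,
 ⟨1,9,1,7,1,5,8,13,2,0,0,0,1⟩,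
 ⟨1,9,1,7,1,7,2,3,2,0,0,0,1⟩,
 ⟨1,9,1,6,1,5,4,7,2,0,0,0,1⟩,
 ⟨1,9,1,6,1,4,3,5,2,0,0,0,1⟩,
 ⟨1,9,1,9,1,4,2,3,2,0,0,0,1⟩,
 ⟨1,6,1,6,1,4,5,9,2,0,0,0,1⟩,
 ⟨1,6,1,6,1,6,2,3,2,0,0,0,1⟩]

def hints32 : List ℕ := [
 13010105, 29020311, 28020311, 19010207, 8000103, 19010207, 26010310, 33010413, 28010311,
 34010413, 34010413, 21010208, 28010311, 23010209, 25010309, 21010208, 21010208, 41020516,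
 14010105, 21010208, 16010106, 23010209, 33020313, 16010106, 31020312, 13010105, 31020312,
 33020313, 29020311, 29020311, 14010105, 17010206, 44030516, 26020309, 17010206, 37030413,
 17010206, 18010207, 41020516, 13010105, 41030416, 29020311, 31020312, 28020311, 29020311,
 27020310, 17010206, 29020311, 29020311, 13010105, 25020309, 17010206, 15010205, 7000102,
 17010206, 23010308, 30010411, 25010309, 19010207, 22010308, 19010207, 36020513, 19010207,
 23010308, 16010205, 20010307, 25010409, 33010512, 19000307, 19000307, 27010410, 22010308,
 27010410, 19000307, 26010409, 26010409, 26010409, 22010308, 17010206, 17010206, 36020513,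
 27010410, 19010306, 26010409, 32020511, 43020715, 19010307, 31020511, 17010206, 25010309,
 19010207, 23010308, 23010308, 14010105, 19010207, 44030516, 26020309, 37030413, 19010207,
 16010205, 26020309, 40030514, 26020309, 38030513, 27020310, 14010205, 19010307, 33020512,
 31020511, 33020512, 38030514, 13010204, 31020511, 14010205, 17010106, 21010108, 29010211,
 13000105, 33010213, 41010316, 53010421, 43010317, 73020529, 31010212, 41010316, 37010314,
 63020524, 33010213, 23010109, 51020320, 53020321, 71030428, 31010212, 49020319, 23010109,
 67030426, 47020318, 23010109, 27010210, 43020316, 25010209, 13000105, 28010211, 23010109,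
 23010109, 27010210, 29010211, 19010107, 29010211, 61030423, 45020317, 43020316, 45020317,
 59030422, 55030420, 39020314, 25010209, 41020315, 19010107, 55030420, 37020313, 25010209,
 19010107, 13000105, 28010211, 18010107, 58030423, 19010107, 19010107, 18010107, 18010107,
 55030421, 19010107, 38020315, 21010108, 23010109, 53020321, 71030428, 15010105, 63040522,
 49030417, 16010106, 18010107, 13000105, 28010211, 37020314, 13000105, 37020314, 14010105,
 15010105, 13010105, 9010103, 8000103, 11010104, 13010105, 18010207, 28020311, 29020311, 29020311,
 42030516, 27020310, 17010206, 37030414, 29020311, 17010206, 35030413, 25020309, 34030413,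
 17010206, 10010103, 17010206, 25020309, 15010205, 20010307, 25010409, 22010308, 22010308,
 27010410, 32020511, 19010307, 31020511, 11010104, 25020309, 17010206, 27020310, 27020310,
 17010206, 17010206, 10010103, 17010206, 32030411, 25020309, 32030411, 31030411, 28030310,
 14010205, 19010307, 33020512, 31020511, 33020512, 11010104, 38030514, 23020308, 36030513,
 23020308, 48050617, 28030310, 29030410, 29030410, 31030411, 31030411, 21020307, 13010204,
 31020511, 23020308, 37030613, 23020308, 29030410, 29030410, 20020307, 32030511, 19020306,
 32030511, 14010205, 11010104, 20020307, 19020306, 11010104, 13010105, 28020311, 29020311,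
 37030414, 29020311, 10010103, 9010103, 8000103, 11010104, 13010105, 18010207, 34030413, 14010205,
 19010307, 33020512, 31020511, 33020512, 11010104, 38030514, 23020308, 36030513, 23020308,
 48050617, 28030310, 29030410, 29030410, 31030411, 31030411, 21020307, 13010204, 31020511,
 23020308, 37030613, 23020308, 29030410, 29030410, 20020307, 32030511, 19020306, 32030511,
 14010205, 11010104, 20020307, 19020306, 11010104, 13010105, 3000000, 6000101, 4000001, 9010101,
 5000001, 7000101, 13010102, 8000101, 11000102, 17010103, 26010205, 41020308, 23010204, 38020307,
 37020307, 14010102, 47030408, 16010103, 36020307, 14010102, 19010203, 26010304, 17000203,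
 62020711, 29010305, 35010406, 59020710, 29010305, 23010204, 20010203, 47020508, 107051218,
 44020507, 28010305, 20010203, 25010304]

set_option maxRecDepth 100000 in
theorem run32 : run table hints32 stk32 = stk33 := by decide +kernel

def stk34 : List St := [⟨1,16,1,6,4,20,4,7,2,0,0,0,1⟩,
 ⟨1,15,1,6,2,9,11,20,2,0,0,0,1⟩,
 ⟨1,11,2,15,2,9,4,7,2,0,0,0,1⟩,
 ⟨1,11,1,6,3,15,4,7,2,0,0,0,1⟩,
 ⟨1,11,1,6,2,9,8,15,2,0,0,0,1⟩,
 ⟨1,11,1,6,1,4,5,9,2,0,0,0,1⟩,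
 ⟨1,11,1,11,1,4,3,5,2,0,0,0,1⟩,
 ⟨1,9,1,6,2,11,3,5,2,0,0,0,1⟩,
 ⟨1,9,1,6,1,4,6,11,2,0,0,0,1⟩,
 ⟨1,9,1,9,1,4,2,3,2,0,0,0,1⟩,
 ⟨1,6,1,6,1,4,5,9,2,0,0,0,1⟩,
 ⟨1,6,1,6,1,6,2,3,2,0,0,0,1⟩]

def hints33 : List ℕ := [
 17000203, 28010305, 45020508, 42020507, 20010203, 17000203, 14010102, 23010204, 17010103,
 29020205, 32020305, 20010203, 53030509, 47030408, 44030407, 31020305, 20010203, 17010103,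
 31020305, 31020305, 30020305, 30020305, 41030407, 20010203, 14010102, 17010202, 35020405,
 29020304, 35020405, 14010102, 14010102, 33020405, 17010202, 27020304, 18010203, 28020305,
 27020304, 18010203, 21010204, 26010305, 27010305, 43020508, 19010203, 27010305, 21010204,
 16010103, 29020305, 19010203, 16010103, 16010103, 16010103, 71050713, 27020205, 31020306,
 28020305, 28020305, 19010203, 27020304, 17010203, 27020305, 61040712, 17010203, 23010304,
 31010406, 36010507, 29010405, 26010305, 26010305, 18010203, 58030711, 39020507, 41020508,
 18010203, 22010304, 38020507, 37020507, 18010203, 21010204, 28020305, 31020306, 28020305,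
 28020305, 27020305, 61040712, 18010203, 31020405, 15010202, 15010202, 16010203, 17010103,
 41020308, 14010102, 8000101, 11010101, 14010102, 17010202, 20010203, 35020405, 20010203,
 35020405, 29020304, 17010202, 38030405, 29020304, 26020303, 23020203, 29020304, 26020303,
 47040506, 35030404, 23020203, 37030405, 29020304, 36030405, 29020304, 25020303, 36030405,
 27020304, 36030405, 35030405, 14010102, 10010101, 35030405, 27020304, 21020203, 43040506,
 41040505, 21020203, 34030405, 27020304, 11010101, 26020303, 17010202, 10010101, 15010202,
 34030405, 23020303, 23020303, 21020203, 54050708, 33030405, 22020303, 46050607, 12010102,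
 17010203, 22010304, 36010507, 23010304, 41020508, 38020507, 37020507, 28020305, 18010203,
 43030508, 31020306, 51040510, 27020305, 37030407, 18010203, 15010202, 18010203, 18010203,
 25020304, 23010304, 29020405, 16010203, 29020405, 10010101, 15010202, 25020304, 31030305,
 33030405, 23020303, 32030405, 37030506, 43040607, 39040506, 22020303, 37030506, 32030405,
 31030405, 19020203, 32030405, 22020303, 46050607, 19020203, 31030405, 29030404, 19020203,
 11010102, 16010203, 23020304, 38030507, 23020304, 40040507, 19020203, 30030405, 31030405,
 19020203, 19020203, 29030405, 11010101, 8000101, 17010202, 38030405, 29020304, 26020303,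
 23020203, 29020304, 26020303, 47040506, 35030404, 23020203, 37030405, 29020304, 36030405,
 29020304, 25020303, 36030405, 26020303, 17010202, 15010202, 23020303, 8000101, 10010101, 8000101,
 43040506, 41040505, 10010101, 10010101, 8000101, 15010202, 13010202, 16010203, 37020607,
 44030708, 31020506, 27020405, 11010102, 16010203, 23020304, 27020405, 36030507, 46040709,
 29030405, 23020304, 20020303, 34030506, 23020304, 20020303, 30030405, 41040607, 23020304,
 21020304, 28030405, 21020304, 32030506, 19020303, 32030506, 31030506, 11010102, 9000102,
 14010103, 21010205, 29010307, 22010205, 22010205, 17010104, 22010205, 22010205, 45030411,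
 33020308, 22010205, 17010104, 19010204, 32020307, 19010204, 31020307, 30020307, 12010102,
 29020306, 49040510, 37030407, 13010103, 30020307, 29020307, 23020205, 37030408, 7000101,
 16010203, 24010305, 29010406, 32010407, 19010204, 22010304, 17010203, 54030711, 37020507,
 36020507, 17010203, 23010305, 19010204, 33020407, 19010204, 14010103, 12010102, 39030408,
 49040510, 26020305, 17010203, 44030509, 27020305, 29020306, 12010102, 29020306, 27020305,
 37030407, 35030407, 12010102, 17010203, 25020305, 17010203, 14010103, 25020305, 35030407,
 25020305, 23020205, 37030408, 17010203, 12010102, 29020405, 37030506, 23020304, 38030507,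
 12010102, 15010203, 24020305, 25020305, 25020305, 15010203, 20010304, 25010405, 32010507,
 23010305, 23010305, 16010203, 34020507, 34020507, 16010203, 16010203]

set_option maxRecDepth 100000 in
theorem run33 : run table hints33 stk33 = stk34 := by decide +kernel

def stk35 : List St := [⟨1,10,1,10,1,4,5,9,2,0,0,0,1⟩,
 ⟨1,6,1,6,2,10,5,9,2,0,0,0,1⟩,
 ⟨1,6,1,6,1,6,2,3,2,0,0,0,1⟩]

def hints34 : List ℕ := [
 37020607, 19010304, 25020305, 16010203, 23020205, 37030408, 24020305, 16010203, 13010202,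
 16010203, 37020607, 44030708, 31020506, 27020405, 16010203, 23020304, 27020405, 36030507,
 46040709, 14010203, 25020405, 15010203, 21010305, 13000203, 29010407, 73031118, 22010305,
 22010305, 25010406, 17010204, 22010305, 37020509, 22010305, 19010304, 13000203, 20010304,
 22010305, 20010304, 22010305, 20010304, 33020507, 35020508, 17010204, 13000203, 33020508,
 25010406, 17010204, 13010103, 29020307, 24020305, 40030509, 13010103, 13010103, 49040611,
 13010103, 25020306, 13010202, 46040709, 14010203, 21010305, 19010304, 17010204, 31020507,
 33020508, 25010406, 31020507, 45030711, 25020306, 29020407, 17010204, 23020305, 17010204,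
 37030509, 25020405, 14010103, 17010104, 29020207, 13010103, 7000101, 12010102, 17010203,
 29020405, 39040506, 22020303, 37030506, 32030405, 31030405, 19020203, 32030405, 22020303,
 46050607, 19020203, 31030405, 29030404, 19020203, 23020304, 40040507, 19020203, 30030405,
 31030405, 19020203, 19020203, 29030405, 13010202, 29030405, 23020304, 20020303, 34030506,
 23020304, 20020303, 30030405, 41040607, 23020304, 14010203, 21010305, 13000203, 25010406,
 17010204, 19010304, 13000203, 15010203, 35020508, 17010204, 13000203, 17010204, 31020507,
 33020508, 25010406, 31020507, 45030711, 10010102, 17010204, 13010103, 21020205, 43040510,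
 23020305, 15010203, 13010103, 32030407, 13010103, 24020305, 13010103, 35030408, 15010203,
 15010203, 25020306, 29020407, 23020305, 22020305, 22020305, 37030509, 33030408, 41040510,
 21020304, 15010203, 13010202, 32030506, 25020405, 34030507, 10010102, 15010203, 13010202,
 28030405, 19020303, 32030506, 10010102, 25020405, 31030506, 31030506, 10010102, 5000001,
 13010102, 11000102, 17010103, 26010205, 41020308, 23010204, 38020307, 37020307, 14010102,
 47030408, 16010103, 36020307, 14010102, 20010203, 29010305, 23010204, 41020407, 14010102,
 23010204, 17010103, 29020205, 32020305, 53030509, 47030408, 44030407, 31020305, 31020305,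
 17010103, 41030407, 14010102, 30020305, 19010203, 17010103, 31020305, 14010102, 45030408,
 41030407, 14010102, 28020305, 19010203, 21010204, 16010103, 29020305, 19010203, 16010103,
 16010103, 16010103, 71050713, 27020205, 31020306, 28020305, 28020305, 17010103, 41020308,
 14010102, 11010101, 14010102, 20010203, 23020203, 29020304, 37030405, 14010102, 10010101,
 21020203, 12010102, 41030408, 28020305, 31020306, 38030407, 10010101, 11010102, 14010103,
 21010205, 29010307, 22010205, 22010205, 17010104, 22010205, 22010205, 45030411, 33020308,
 22010205, 17010104, 19010204, 32020307, 19010204, 31020307, 30020307, 11010102, 12010102,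
 29020306, 49040510, 37030407, 12010102, 13010103, 30020307, 29020307, 11010102, 23020205,
 37030408, 10010102, 10010102, 14010203, 21010305, 13000203, 29010407, 73031118, 22010305,
 22010305, 25010406, 17010204, 22010305, 37020509, 22010305, 19010304, 13000203, 20010304,
 22010305, 20010304, 22010305, 15010203, 15010203, 20010304, 33020507, 15010203, 35020508,
 17010204, 13000203, 17010204, 15010203, 31020507, 33020508, 25010406, 31020507, 45030711,
 17010204, 22010305, 37020509, 13010103, 29020307, 11010102, 21020205, 43040510, 15010203,
 22010305, 24020305, 40030509, 13010103, 11010102, 13010103, 49040611, 13010103, 35030408,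
 23020305, 32030407, 13010103, 13010103, 23020305, 25020306, 29020407, 23020305, 22020305,
 22020305, 37030509, 33030408, 41040510, 15010203, 19010304, 11010102, 13010202, 11010102,
 46040709, 32030506, 21020304, 25020405, 21020304, 34030507, 21020304, 31030506]

set_option maxRecDepth 100000 in
theorem run34 : run table hints34 stk34 = stk35 := by decide +kernel

def stk36 : List St := []

def hints35 : List ℕ := [
 11010102, 8010101, 13010202, 11010102, 46040709, 35040506, 20020303, 28030405, 17020203,
 42050607, 20020303, 17020203, 17020203, 21020304, 17020203, 37040507, 26030305, 28030405,
 17020203, 41050607, 17020203, 27030405, 27030405, 21020304, 32030506, 19020303, 32030506,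
 31030506, 17020203, 21020304, 21020304, 19020303, 17020203, 25030404, 26030405, 31030506,
 33040506, 21020304, 11010102, 9010101, 8000101, 11010101, 14010102, 20010203, 26010304, 32020305,
 17010202, 35020405, 35020405, 29020304, 19010203, 33020405, 17010202, 17010202, 38030405,
 29020304, 26020303, 23020203, 29020304, 26020303, 47040506, 35030404, 23020203, 37030405,
 29020304, 36030405, 29020304, 25020303, 36030405, 13010102, 19010203, 27020304, 27020304,
 27020304, 36030405, 35030405, 14010102, 10010101, 13010102, 19010203, 27020304, 35030405,
 27020304, 21020203, 43040506, 41040505, 21020203, 34030405, 27020304, 33030405, 43040507,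
 13010102, 19020203, 11010101, 26020303, 17010202, 7000101, 10010101, 15010202, 31020405,
 13010102, 31020405, 34030405, 23020303, 23020303, 21020203, 54050708, 33030405, 25020304,
 31030305, 33030405, 23020303, 32030405, 37030506, 43040607, 39040506, 22020303, 37030506,
 32030405, 31030405, 19020203, 32030405, 22020303, 46050607, 19020203, 31030405, 29030404,
 19020203, 10010101, 23020303, 15010202, 13010202, 20020303, 11010101, 14010102, 20010203,
 32020305, 23020203, 29020304, 37030405, 13010102, 14010102, 21020203, 13010102, 10010101,
 10010101, 10010101, 8010101, 13010202, 20020303]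

set_option maxRecDepth 100000 in
theorem run35 : run table hints35 stk35 = stk36 := by decide +kernel

theorem good_last : AllGood table stk36 := by
  intro s hs
  simp [stk36] at hs

theorem good_first : AllGood table stk0 := by
  have h := good_last
  replace h := sound_run hints35 stk35 (run35.symm ▸ h)
  replace h := sound_run hints34 stk34 (run34.symm ▸ h)
  replace h := sound_run hints33 stk33 (run33.symm ▸ h)
  replace h := sound_run hints32 stk32 (run32.symm ▸ h)
  replace h := sound_run hints31 stk31 (run31.symm ▸ h)
  replace h := sound_run hints30 stk30 (run30.symm ▸ h)
  replace h := sound_run hints29 stk29 (run29.symm ▸ h)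
  replace h := sound_run hints28 stk28 (run28.symm ▸ h)
  replace h := sound_run hints27 stk27 (run27.symm ▸ h)
  replace h := sound_run hints26 stk26 (run26.symm ▸ h)
  replace h := sound_run hints25 stk25 (run25.symm ▸ h)
  replace h := sound_run hints24 stk24 (run24.symm ▸ h)
  replace h := sound_run hints23 stk23 (run23.symm ▸ h)
  replace h := sound_run hints22 stk22 (run22.symm ▸ h)
  replace h := sound_run hints21 stk21 (run21.symm ▸ h)
  replace h := sound_run hints20 stk20 (run20.symm ▸ h)
  replace h := sound_run hints19 stk19 (run19.symm ▸ h)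
  replace h := sound_run hints18 stk18 (run18.symm ▸ h)
  replace h := sound_run hints17 stk17 (run17.symm ▸ h)
  replace h := sound_run hints16 stk16 (run16.symm ▸ h)
  replace h := sound_run hints15 stk15 (run15.symm ▸ h)
  replace h := sound_run hints14 stk14 (run14.symm ▸ h)
  replace h := sound_run hints13 stk13 (run13.symm ▸ h)
  replace h := sound_run hints12 stk12 (run12.symm ▸ h)
  replace h := sound_run hints11 stk11 (run11.symm ▸ h)
  replace h := sound_run hints10 stk10 (run10.symm ▸ h)
  replace h := sound_run hints9 stk9 (run9.symm ▸ h)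
  replace h := sound_run hints8 stk8 (run8.symm ▸ h)
  replace h := sound_run hints7 stk7 (run7.symm ▸ h)
  replace h := sound_run hints6 stk6 (run6.symm ▸ h)
  replace h := sound_run hints5 stk5 (run5.symm ▸ h)
  replace h := sound_run hints4 stk4 (run4.symm ▸ h)
  replace h := sound_run hints3 stk3 (run3.symm ▸ h)
  replace h := sound_run hints2 stk2 (run2.symm ▸ h)
  replace h := sound_run hints1 stk1 (run1.symm ▸ h)
  replace h := sound_run hints0 stk0 (run0.symm ▸ h)
  exact h


theorem main_tree {b0 b1 b2 b3 : ℝ} (H : Hyp b0 b1 b2 b3) : InT table b0 b1 b2 b3 := by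
  have h := good_first _ (List.mem_cons_self : _ ∈ stk0)
  refine h b0 b1 b2 b3 H ?_
  have := H.m01
  have := H.m12
  have := H.m23
  have := H.sum
  have := H.pos
  refine ⟨by decide, by decide, by decide, by decide, ?_, ?_, ?_, ?_, ⟨by decide, ?_, ?_, ?_, ?_⟩,
    Or.inl rfl⟩ <;> norm_num <;> linarith


/-! ### The second tree: weights that do not occur -/

/-- A region for the second interior point: upper bounds `n i / d i`. -/
structure CS : Type where
  n0 : ℕ
  d0 : ℕ
  n1 : ℕ
  d1 : ℕ
  n2 : ℕ
  d2 : ℕ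
  n3 : ℕ
  d3 : ℕ

/-- Weights. -/
structure Wt : Type where
  l0 : ℕ
  l1 : ℕ
  l2 : ℕ
  l3 : ℕ

def Wt.h (w : Wt) : ℕ := w.l0 + w.l1 + w.l2 + w.l3

def CS.closed (w : Wt) (s : CS) : Bool :=
  s.n0 == 0 || s.n1 == 0 || s.n2 == 0 || s.n3 == 0 ||
  Nat.blt ((s.n0 * s.d1 + s.n1 * s.d0) * (s.d2 * s.d3) + (s.n2 * s.d3 + s.n3 * s.d2) * (s.d0 * s.d1))
    ((s.d0 * s.d1) * (s.d2 * s.d3)) ||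
  (s.n0 * w.h == w.l0 * s.d0 && s.n1 * w.h == w.l1 * s.d1 && s.n2 * w.h == w.l2 * s.d2 &&
    s.n3 * w.h == w.l3 * s.d3)

def CS.min0 (s : CS) (a k : ℕ) : CS :=
  minF s.n0 s.d0 a k fun n d => ⟨n, d, s.n1, s.d1, s.n2, s.d2, s.n3, s.d3⟩
def CS.min1 (s : CS) (a k : ℕ) : CS :=
  minF s.n1 s.d1 a k fun n d => ⟨s.n0, s.d0, n, d, s.n2, s.d2, s.n3, s.d3⟩
def CS.min2 (s : CS) (a k : ℕ) : CS :=
  minF s.n2 s.d2 a k fun n d => ⟨s.n0, s.d0, s.n1, s.d1, n, d, s.n3, s.d3⟩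
def CS.min3 (s : CS) (a k : ℕ) : CS :=
  minF s.n3 s.d3 a k fun n d => ⟨s.n0, s.d0, s.n1, s.d1, s.n2, s.d2, n, d⟩

def CS.push (w : Wt) (s : CS) (r : List CS) : List CS := cond (s.closed w) r (s :: r)

def CS.stepN (w : Wt) (s : CS) (k l a0 a1 a2 a3 : ℕ) (r : List CS) : List CS :=
  CS.push w (s.min0 (a0 * w.h - l * w.l0) (k * w.h)) <|
  CS.push w (s.min1 (a1 * w.h - l * w.l1) (k * w.h)) <|
  CS.push w (s.min2 (a2 * w.h - l * w.l2) (k * w.h)) <|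
  CS.push w (s.min3 (a3 * w.h - l * w.l3) (k * w.h)) <|
  CS.push w ((((s.min0 (a0 * w.h + w.l0 - l * w.l0) (k * w.h)).min1
    (a1 * w.h + w.l1 - l * w.l1) (k * w.h)).min2
    (a2 * w.h + w.l2 - l * w.l2) (k * w.h)).min3 (a3 * w.h + w.l3 - l * w.l3) (k * w.h)) <|
  cond (k == 1) r <|
  CS.push w ((((s.min0 (a0 * w.h - l * w.l0) ((k - 1) * w.h)).min1
    (a1 * w.h - l * w.l1) ((k - 1) * w.h)).min2
    (a2 * w.h - l * w.l2) ((k - 1) * w.h)).min3 (a3 * w.h - l * w.l3) ((k - 1) * w.h)) r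

def CS.okHint (w : Wt) (k l a0 a1 a2 a3 : ℕ) : Bool :=
  a0 + a1 + a2 + a3 + 1 == k + l && Nat.blt 0 k &&
    (Nat.blt 1 k || (l * w.l0) % w.h != 0 || (l * w.l1) % w.h != 0 || (l * w.l2) % w.h != 0 ||
      (l * w.l3) % w.h != 0)

def CS.step (w : Wt) (x : ℕ) (s : CS) (r : List CS) : List CS :=
  force (x / 10000000000) fun k => force (x / 100000000 % 100) fun l =>
  force (x / 1000000 % 100) fun a0 => force (x / 10000 % 100) fun a1 =>
  force (x / 100 % 100) fun a2 => force (x % 100) fun a3 =>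
  cond (CS.okHint w k l a0 a1 a2 a3) (CS.stepN w s k l a0 a1 a2 a3 r) (s :: r)

def CS.run (w : Wt) : List ℕ → List CS → Bool
  | _, [] => true
  | [], _ :: _ => false
  | x :: xs, s :: r => CS.run w xs (CS.step w x s r)

structure HypC (w : Wt) (c0 c1 c2 c3 : ℝ) : Prop where
  pos0 : 0 < c0
  pos1 : 0 < c1
  pos2 : 0 < c2
  pos3 : 0 < c3
  sum : c0 + c1 + c2 + c3 = 1
  hp : 0 < w.h
  ne : ¬ (c0 * w.h = w.l0 ∧ c1 * w.h = w.l1 ∧ c2 * w.h = w.l2 ∧ c3 * w.h = w.l3)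
  two : ∀ k l a0 a1 a2 a3 : ℕ, a0 + a1 + a2 + a3 + 1 = k + l →
    (a0 * w.h : ℝ) < k * (c0 * w.h) + l * w.l0 → (a1 * w.h : ℝ) < k * (c1 * w.h) + l * w.l1 →
    (a2 * w.h : ℝ) < k * (c2 * w.h) + l * w.l2 → (a3 * w.h : ℝ) < k * (c3 * w.h) + l * w.l3 →
    ((k * (c0 * w.h) + l * w.l0 - a0 * w.h = w.l0 ∧ k * (c1 * w.h) + l * w.l1 - a1 * w.h = w.l1 ∧
      k * (c2 * w.h) + l * w.l2 - a2 * w.h = w.l2 ∧ k * (c3 * w.h) + l * w.l3 - a3 * w.h = w.l3) ∨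
     (k * (c0 * w.h) + l * w.l0 - a0 * w.h = c0 * w.h ∧
      k * (c1 * w.h) + l * w.l1 - a1 * w.h = c1 * w.h ∧
      k * (c2 * w.h) + l * w.l2 - a2 * w.h = c2 * w.h ∧
      k * (c3 * w.h) + l * w.l3 - a3 * w.h = c3 * w.h))

structure CS.In (s : CS) (c0 c1 c2 c3 : ℝ) : Prop where
  p0 : 0 < s.d0
  p1 : 0 < s.d1
  p2 : 0 < s.d2
  p3 : 0 < s.d3
  u0 : c0 * s.d0 ≤ s.n0
  u1 : c1 * s.d1 ≤ s.n1
  u2 : c2 * s.d2 ≤ s.n2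
  u3 : c3 * s.d3 ≤ s.n3

theorem CS.min0_in {s : CS} {c0 c1 c2 c3 : ℝ} {a k : ℕ} (h : s.In c0 c1 c2 c3) (hk : 0 < k)
    (hc : c0 * k ≤ a) : (s.min0 a k).In c0 c1 c2 c3 := by
  obtain ⟨p0, p1, p2, p3, u0, u1, u2, u3⟩ := h
  unfold CS.min0 minF
  cases Nat.ble (Nat.mul s.n0 k) (Nat.mul a s.d0) <;> constructor <;> assumption

theorem CS.min1_in {s : CS} {c0 c1 c2 c3 : ℝ} {a k : ℕ} (h : s.In c0 c1 c2 c3) (hk : 0 < k)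
    (hc : c1 * k ≤ a) : (s.min1 a k).In c0 c1 c2 c3 := by
  obtain ⟨p0, p1, p2, p3, u0, u1, u2, u3⟩ := h
  unfold CS.min1 minF
  cases Nat.ble (Nat.mul s.n1 k) (Nat.mul a s.d1) <;> constructor <;> assumption

theorem CS.min2_in {s : CS} {c0 c1 c2 c3 : ℝ} {a k : ℕ} (h : s.In c0 c1 c2 c3) (hk : 0 < k)
    (hc : c2 * k ≤ a) : (s.min2 a k).In c0 c1 c2 c3 := by
  obtain ⟨p0, p1, p2, p3, u0, u1, u2, u3⟩ := h
  unfold CS.min2 minF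
  cases Nat.ble (Nat.mul s.n2 k) (Nat.mul a s.d2) <;> constructor <;> assumption

theorem CS.min3_in {s : CS} {c0 c1 c2 c3 : ℝ} {a k : ℕ} (h : s.In c0 c1 c2 c3) (hk : 0 < k)
    (hc : c3 * k ≤ a) : (s.min3 a k).In c0 c1 c2 c3 := by
  obtain ⟨p0, p1, p2, p3, u0, u1, u2, u3⟩ := h
  unfold CS.min3 minF
  cases Nat.ble (Nat.mul s.n3 k) (Nat.mul a s.d3) <;> constructor <;> assumption

theorem CS.zero_aux {n d : ℕ} {c : ℝ} (hn : n = 0) (hd : 0 < d) (hc : 0 < c) (hu : c * d ≤ n) :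
    False := by
  subst hn
  have : (0 : ℝ) < d := by exact_mod_cast hd
  have := mul_pos hc this
  push_cast at hu
  linarith

theorem CS.le_aux {n d l h : ℕ} {c : ℝ} (e : n * h = l * d) (hd : 0 < d) (hu : c * d ≤ n) :
    c * h ≤ l := by
  have hd' : (0 : ℝ) < d := by exact_mod_cast hd
  have e' : (n : ℝ) * h = l * d := by exact_mod_cast e
  have : c * d * h ≤ n * h := by gcongr
  have : (c * h) * d ≤ l * d := by linarith
  exact le_of_mul_le_mul_right this hd'

theorem CS.closed_sound {w : Wt} {s : CS} {c0 c1 c2 c3 : ℝ} (h : s.closed w = true)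
    (H : HypC w c0 c1 c2 c3) (R : s.In c0 c1 c2 c3) : False := by
  unfold CS.closed at h
  simp only [Bool.or_eq_true, Bool.and_eq_true, beq_iff_eq, Nat.blt_eq] at h
  rcases h with ((((h | h) | h) | h) | h) | h
  · exact CS.zero_aux h R.p0 H.pos0 R.u0
  · exact CS.zero_aux h R.p1 H.pos1 R.u1
  · exact CS.zero_aux h R.p2 H.pos2 R.u2
  · exact CS.zero_aux h R.p3 H.pos3 R.u3
  · have h' : ((s.n0 * s.d1 + s.n1 * s.d0) * (s.d2 * s.d3) + (s.n2 * s.d3 + s.n3 * s.d2) *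
      (s.d0 * s.d1) : ℝ) < (s.d0 * s.d1) * (s.d2 * s.d3) := by exact_mod_cast h
    have v0 : c0 * s.d0 * (s.d1 * (s.d2 * s.d3)) ≤ s.n0 * (s.d1 * (s.d2 * s.d3)) := by
      gcongr; exact R.u0
    have v1 : c1 * s.d1 * (s.d0 * (s.d2 * s.d3)) ≤ s.n1 * (s.d0 * (s.d2 * s.d3)) := by
      gcongr; exact R.u1
    have v2 : c2 * s.d2 * (s.d3 * (s.d0 * s.d1)) ≤ s.n2 * (s.d3 * (s.d0 * s.d1)) := by
      gcongr; exact R.u2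
    have v3 : c3 * s.d3 * (s.d2 * (s.d0 * s.d1)) ≤ s.n3 * (s.d2 * (s.d0 * s.d1)) := by
      gcongr; exact R.u3
    have hs : c0 * s.d0 * (s.d1 * (s.d2 * s.d3)) + c1 * s.d1 * (s.d0 * (s.d2 * s.d3))
        + c2 * s.d2 * (s.d3 * (s.d0 * s.d1))
        + c3 * s.d3 * (s.d2 * (s.d0 * s.d1)) = s.d0 * s.d1 * (s.d2 * s.d3) := by
      have := H.sum
      linear_combination (s.d0 * s.d1 * (s.d2 * s.d3) : ℝ) * this
    linarith
  · obtain ⟨⟨⟨e0, e1⟩, e2⟩, e3⟩ := h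
    have f0 := CS.le_aux e0 R.p0 R.u0
    have f1 := CS.le_aux e1 R.p1 R.u1
    have f2 := CS.le_aux e2 R.p2 R.u2
    have f3 := CS.le_aux e3 R.p3 R.u3
    have hs : c0 * w.h + c1 * w.h + c2 * w.h + c3 * w.h = w.h := by
      linear_combination (w.h : ℝ) * H.sum
    have hw : (w.h : ℝ) = w.l0 + w.l1 + w.l2 + w.l3 := by unfold Wt.h; push_cast; ring
    apply H.ne
    refine ⟨?_, ?_, ?_, ?_⟩ <;> linarith

/-- No point satisfying the hypotheses is in a region of the stack. -/
def CS.None (c0 c1 c2 c3 : ℝ) (r : List CS) : Prop := ∀ s ∈ r, ¬ s.In c0 c1 c2 c3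

theorem CS.push_sound {w : Wt} {c0 c1 c2 c3 : ℝ} {s : CS} {r : List CS}
    (H : HypC w c0 c1 c2 c3) (h : CS.None c0 c1 c2 c3 (CS.push w s r)) :
    ¬ s.In c0 c1 c2 c3 ∧ CS.None c0 c1 c2 c3 r := by
  unfold CS.push at h
  cases e : s.closed w with
  | true => rw [e] at h; exact ⟨fun R => CS.closed_sound e H R, h⟩
  | false =>
    rw [e] at h
    exact ⟨h _ List.mem_cons_self, fun s hs => h s (List.mem_cons_of_mem _ hs)⟩

theorem CS.sub_aux {x : ℝ} {m n : ℕ} (h : x ≤ m - n) : x ≤ ((m - n : ℕ) : ℝ) := by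
  have : (m : ℝ) ≤ ((m - n : ℕ) : ℝ) + n := by exact_mod_cast (by omega : m ≤ m - n + n)
  linarith

theorem CS.k1_aux {l a m h : ℕ} {c : ℝ}
    (e : (1 : ℝ) * (c * h) + l * m - a * h = c * h) : (l * m) % h = 0 := by
  have : (l * m : ℝ) = a * h := by linarith
  have : l * m = a * h := by exact_mod_cast this
  rw [this]; simp

theorem CS.stepN_sound {w : Wt} {c0 c1 c2 c3 : ℝ} {s : CS} {r : List CS} {k l a0 a1 a2 a3 : ℕ}
    (hok : CS.okHint w k l a0 a1 a2 a3 = true)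
    (H : HypC w c0 c1 c2 c3) (h : CS.None c0 c1 c2 c3 (CS.stepN w s k l a0 a1 a2 a3 r)) :
    ¬ s.In c0 c1 c2 c3 ∧ CS.None c0 c1 c2 c3 r := by
  unfold CS.okHint at hok
  simp only [Bool.or_eq_true, Bool.and_eq_true, beq_iff_eq, Nat.blt_eq, bne_iff_ne] at hok
  obtain ⟨⟨hs, kp⟩, hk⟩ := hok
  unfold CS.stepN at h
  obtain ⟨C0, h⟩ := CS.push_sound H h
  obtain ⟨C1, h⟩ := CS.push_sound H h
  obtain ⟨C2, h⟩ := CS.push_sound H h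
  obtain ⟨C3, h⟩ := CS.push_sound H h
  obtain ⟨C4, h⟩ := CS.push_sound H h
  have hp := H.hp
  have khp : 0 < k * w.h := Nat.mul_pos kp hp
  have main : CS.None c0 c1 c2 c3 r ∧ (s.In c0 c1 c2 c3 →
     ¬ (k * (c0 * w.h) + l * w.l0 - a0 * w.h = c0 * w.h ∧
      k * (c1 * w.h) + l * w.l1 - a1 * w.h = c1 * w.h ∧
      k * (c2 * w.h) + l * w.l2 - a2 * w.h = c2 * w.h ∧
      k * (c3 * w.h) + l * w.l3 - a3 * w.h = c3 * w.h)) := by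
    by_cases k1 : k = 1
    · subst k1
      refine ⟨h, fun _ ⟨e0, e1, e2, e3⟩ => ?_⟩
      push_cast at e0 e1 e2 e3
      have f0 := CS.k1_aux e0
      have f1 := CS.k1_aux e1
      have f2 := CS.k1_aux e2
      have f3 := CS.k1_aux e3
      simp [f0, f1, f2, f3] at hk
    · have : (k == 1) = false := by simpa using k1
      rw [this] at h
      obtain ⟨C5, h⟩ := CS.push_sound H h
      refine ⟨h, fun R ⟨e0, e1, e2, e3⟩ => C5 ?_⟩
      have kp' : 0 < (k - 1) * w.h := Nat.mul_pos (by omega) hp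
      have kc : ((k - 1 : ℕ) : ℝ) = k - 1 := by
        rw [Nat.cast_sub (by omega)]; simp
      refine CS.min3_in (CS.min2_in (CS.min1_in (CS.min0_in R kp' ?_) kp' ?_) kp' ?_) kp' ?_ <;>
        (apply CS.sub_aux; push_cast [kc]; linarith)
  refine ⟨fun R => ?_, main.1⟩
  have g0 : (a0 * w.h : ℝ) < k * (c0 * w.h) + l * w.l0 := by
    by_contra hc
    refine C0 (CS.min0_in R khp ?_)
    apply CS.sub_aux; push_cast; linarith
  have g1 : (a1 * w.h : ℝ) < k * (c1 * w.h) + l * w.l1 := by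
    by_contra hc
    refine C1 (CS.min1_in R khp ?_)
    apply CS.sub_aux; push_cast; linarith
  have g2 : (a2 * w.h : ℝ) < k * (c2 * w.h) + l * w.l2 := by
    by_contra hc
    refine C2 (CS.min2_in R khp ?_)
    apply CS.sub_aux; push_cast; linarith
  have g3 : (a3 * w.h : ℝ) < k * (c3 * w.h) + l * w.l3 := by
    by_contra hc
    refine C3 (CS.min3_in R khp ?_)
    apply CS.sub_aux; push_cast; linarith
  rcases H.two k l a0 a1 a2 a3 hs g0 g1 g2 g3 with ⟨e0, e1, e2, e3⟩ | e
  · apply C4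
    refine CS.min3_in (CS.min2_in (CS.min1_in (CS.min0_in R khp ?_) khp ?_) khp ?_) khp ?_ <;>
        (apply CS.sub_aux; push_cast; linarith)
  · exact main.2 R e

theorem CS.step_sound {w : Wt} {c0 c1 c2 c3 : ℝ} {s : CS} {r : List CS} {x : ℕ}
    (H : HypC w c0 c1 c2 c3) (h : CS.None c0 c1 c2 c3 (CS.step w x s r)) :
    CS.None c0 c1 c2 c3 (s :: r) := by
  simp only [CS.step, force_eq] at h
  cases e : CS.okHint w (x / 10000000000) (x / 100000000 % 100) (x / 1000000 % 100)
      (x / 10000 % 100) (x / 100 % 100) (x % 100) with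
  | false => rw [e] at h; exact h
  | true =>
    rw [e] at h
    obtain ⟨h1, h2⟩ := CS.stepN_sound e H h
    intro y hy
    rcases List.mem_cons.1 hy with rfl | hy
    · exact h1
    · exact h2 y hy

theorem CS.sound_run {w : Wt} {c0 c1 c2 c3 : ℝ} (H : HypC w c0 c1 c2 c3) (xs : List ℕ) :
    ∀ r : List CS, CS.run w xs r = true → CS.None c0 c1 c2 c3 r := by
  induction xs with
  | nil =>
    intro r h
    cases r with
    | nil => intro s hs; simp at hs
    | cons s r => simp [CS.run] at h
  | cons x xs ih =>
    intro r h
    cases r with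
    | nil => intro s hs; simp at hs
    | cons s r =>
      rw [CS.run] at h
      exact CS.step_sound H (ih _ h)

def decW (x : ℕ) : Wt := ⟨q0 x, q1 x, q2 x, q3 x⟩

theorem excluded_of_run {x : ℕ} {c0 c1 c2 c3 : ℝ} (xs : List ℕ)
    (h : CS.run (decW x) xs [⟨1, 1, 1, 1, 1, 1, 1, 1⟩] = true) : ¬ HypC (decW x) c0 c1 c2 c3 := by
  intro H
  refine CS.sound_run H xs _ h _ List.mem_cons_self ?_
  have := H.pos0
  have := H.pos1
  have := H.pos2
  have := H.pos3
  have := H.sum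
  refine ⟨by decide, by decide, by decide, by decide, ?_, ?_, ?_, ?_⟩ <;> norm_num <;> linarith


/-- Certificates for the weights that do not occur. -/
def exCert : List (ℕ × List ℕ) := [
 (4244103, [
  11001020304, 10701010203, 20000000100, 20000000001, 10901010304, 21602030507, 30901020305,
  50901020406, 20801010304, 20901020304, 50801020405, 11601030507, 11601030507, 30801020304,
  40601010304, 11101020305, 30501010203, 11101020305, 11602020507, 11602020507, 20601010203,
  20601010203, 21001020305, 11602030407, 10200000101, 21602030507, 20901020304, 11602030506,
  11602030506, 30901020404, 30901020404, 10100000001, 10200000101, 20000000100, 20001000000,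
  10601010202, 20501010202, 11602030506, 11201020405, 10501010102, 20201000101, 10701010203,
  20000000001, 20000010000, 10400010102, 11602030407, 20701020203, 10901020204, 20001000000,
  20000010000, 30001010000, 11502030406, 10501010102]),
 (4277387, [
  11501030506, 11201020405, 11701030607, 20000000001, 22602050911, 22001040709, 12101040709,
  31301030506, 32602050912, 11601030507, 21101020405, 11601030507, 10100000001, 20000000100,
  20000000100, 20001000000, 11101020404, 10500010202, 20501010202, 11001020304]),
 (6357639, [
  20001000000, 20000010000, 20000000100, 20000000001, 11402030405, 10501010102, 30000000101,
  20601010203, 20501010202, 11102020304, 10501010102, 10801020203, 21803040507, 10701010203,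
  11302030305, 11502030406, 11302030305, 11802040507, 31202030405, 71703050609, 31202030405,
  20601010203, 10701010203, 11803030507, 20401010102, 21202030305, 11302030305, 30301010102,
  51002030306, 11803040407, 11803040407, 11803040506, 10300010101, 11102020304, 21102030304,
  10300010101, 10801020203, 11803040506, 30201010101, 10801020203, 30001010000, 10801020203,
  10401010101, 10401010101, 10100000001, 10601010202, 10801020203, 10501010102]),
 (6357898, [
  11702030507, 10701010203, 11201020405, 11802030508, 20100000101, 22303040710, 50901020406,
  11602020507, 21702030508, 51502030608, 30400010203, 21502020507, 11602020507, 31101020406,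
  10200000101, 10901010304, 11202020305, 11201020405, 10601010202, 20501010202, 11302020405,
  10701010203, 11802030508, 20000010000, 10400010102, 11101020305, 20100010001, 11202020305,
  20000010000, 12203040609]),
 (6357902, [
  10801010204, 12002030510, 10100000001, 10200000101, 30000000101, 22703040714, 51802030611,
  61302020509, 40701010305, 20701010204, 20701010204, 40701010305, 20100000101, 30701010304,
  20100000101]),
 (6358285, [
  12102030709, 10901010304, 12302030810, 11501020507, 22903041013, 32002030710, 22002030709,
  32202030811, 20000000100, 11502020506, 20000000100, 10801010303, 11401020506, 10701010203,
  11602020507]),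
 (6358289, [
  12402030712, 11001010305, 12602030813, 10100000001, 23303041017, 11601020508, 22502030813,
  22302030712, 71602020711, 20901010305, 11802020509, 10100000001, 21702020509]),
 (6374798, [
  11201020405, 12102030709, 11401020506, 20000000001, 31101020406, 23203051114, 11301020406,
  23203051114, 21101020405, 10100000001, 20000000100, 20000000100, 20001000000, 12002030708,
  22603040911]),
 (6374803, [
  11401020407, 12402030712, 11601020508, 10100000001, 23703051119, 41301020508, 21301020407,
  52202030813, 10801010204, 10100000001, 20701010204]),
 (6407178, [
  12002050607, 10801020203, 11101030304, 12102050608, 22703070810, 31902050608, 11001020304,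
  32703070811, 11401040405, 10300010101, 11402030405, 11401040405, 10701020202, 10300010101,
  11101030304, 11702040506, 12503060709]),
 (8471433, [
  11102020304, 11402030405, 12003040607, 20000000001, 11001020304, 20401010102, 22404050709,
  31002020305, 12103040608, 22404050709, 30000000101, 20901020304, 10601010202, 20501010202,
  10601010202, 10501010102, 12404040709, 10601010202, 10100000001, 11903040507, 20000000001,
  10501010102, 20000010000, 11402030405, 10601010202, 12003040607, 20001000000, 11002020303,
  20001000000, 20000010000, 10401010101]),
 (8472214, [
  13403041017, 11001010305, 13603041118, 10100000001, 43303041118, 23503041118, 24304051322,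
  11802020509, 10100000001, 21702020509]),
 (8472859, [
  11201010406, 14203041421, 10200000101, 10100000001, 25304051827]),
 (8487819, [
  10801020203, 10501010102, 11502030406, 11402030306, 12003040508, 30701020204, 22704060711,
  10901020204, 10400010102, 22704060711, 20701020203, 11402030405, 12303050609, 11402030405,
  20001000000, 12303050609, 11903040507, 20301010101]),
 (8487825, [
  11001020205, 11802030409, 10601010103, 10100000001, 12403040512, 23304060717, 32603050614,
  20901020205, 12803050614, 40501010204, 20701010204, 22303040512, 12803050614, 11602030308,
  20501010103, 11602030308]),
 (8504458, [
  10901020303, 12704060809, 12403060708, 11702040506, 20000000001, 11402030405, 10601010202,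
  12103050607, 22904070910, 10300010101, 11602040505, 22303060708, 10300010101, 10300010101,
  11302030404, 10601010202]),
 (10584969, [
  10902020203, 11202030304, 11803040506, 12304050608, 20000000001, 10501010102, 10401010101,
  22605060709, 40000010101, 12204050607, 21102030304, 12204050607, 12204050607, 11503030405,
  21403030405, 10401010101, 22004050507, 11503030405, 11503030405, 22104050607, 12605060708]),
 (10585099, [
  11903040507, 11102020304, 12504050709, 11502030406, 11803030507, 22905060811, 12604050710,
  22905060811, 20901020304, 21703030507, 10501010102, 11502030406, 11503030405, 11102020304,
  12504050709, 20000010000, 10300010101, 11503030405, 20000010000, 10401010101]),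
 (10585107, [
  12403040512, 13204050716, 12003030410, 10100000001, 11402020307, 23705060819, 11802030409,
  21302020307, 10601010103]),
 (10586913, [
  15404051827, 11201010406, 10200000101, 10100000001, 26505062233]),
 (10617995, [
  12103050607, 11502040405, 12604060709, 20000000001, 10801020203, 10300010101, 11202030304,
  23205080911, 10300010101, 10701020202, 13005070810, 11803040506]),
 (10618006, [
  11001020205, 13404060717, 12803050614, 10100000001, 24305080922, 13804070819, 21702030409,
  10601010103, 10100000001, 11602030308]),
 (14812300, [
  10902020203, 12705060709, 13206070811, 11202030304, 23507080912, 21102030304, 22004050507,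
  10401010101]),
 (14812441, [
  13004050615, 14406070922, 12003030410, 10100000001, 24907081025, 10601010103])]

set_option maxRecDepth 100000 in
theorem exCert_ok : ∀ p ∈ exCert,
    CS.run (decW p.1) p.2 [⟨1, 1, 1, 1, 1, 1, 1, 1⟩] = true := by decide +kernel

set_option maxRecDepth 100000 in
theorem table_ex : ∀ p ∈ table.toList, p.2 = 0 → ∃ q ∈ exCert, q.1 = p.1 := by decide +kernel

theorem excluded {p : ℕ × ℕ} (hp : p ∈ table.toList) (h0 : p.2 = 0) {c0 c1 c2 c3 : ℝ} :
    ¬ HypC (decW p.1) c0 c1 c2 c3 := by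
  obtain ⟨q, hq, e⟩ := table_ex p hp h0
  rw [← e]
  exact excluded_of_run _ (exCert_ok q hq)


/-! ### Geometry -/

theorem castPt_sum {ι : Type*} [Fintype ι] (x : ι → ℤ) (v : ι → Fin 3 → ℤ) :
    castPt (∑ i, x i • v i) = ∑ i, (x i : ℝ) • castPt (v i) := by
  ext j
  simp [castPt, Finset.sum_apply]

theorem castPt_inj {d : ℕ} {x y : Fin d → ℤ} (h : castPt x = castPt y) : x = y := by
  ext j
  have := congrFun h j
  simpa [castPt] using this

theorem affInd_iff (w : Fin 4 → Fin 3 → ℝ) :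
    AffineIndependent ℝ w ↔
      ∀ r : Fin 4 → ℝ, ∑ i, r i = 0 → ∑ i, r i • w i = 0 → ∀ i, r i = 0 := by
  rw [affineIndependent_iff_of_fintype]
  constructor
  · intro h r h1 h2
    exact h r h1 (by rw [Finset.weightedVSub_eq_linear_combination _ h1]; exact h2)
  · intro h r h1 h2
    rw [Finset.weightedVSub_eq_linear_combination _ h1] at h2
    exact h r h1 h2

theorem bary_unique {w : Fin 4 → Fin 3 → ℝ} (hw : AffineIndependent ℝ w) {r s : Fin 4 → ℝ}
    (h : ∑ i, r i = ∑ i, s i) (h' : ∑ i, r i • w i = ∑ i, s i • w i) : r = s := by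
  have := (affInd_iff w).1 hw (fun i => r i - s i) (by simp [h]) (by simp [sub_smul, h'])
  ext i
  linarith [this i]

theorem mem_interior_iff {w : Fin 4 → Fin 3 → ℝ} (hw : AffineIndependent ℝ w) (x : Fin 3 → ℝ) :
    x ∈ interior (convexHull ℝ (Set.range w)) ↔
      ∃ r : Fin 4 → ℝ, (∀ i, 0 < r i) ∧ ∑ i, r i = 1 ∧ ∑ i, r i • w i = x := by
  have htop : affineSpan ℝ (Set.range w) = ⊤ := by
    rw [hw.affineSpan_eq_top_iff_card_eq_finrank_add_one]
    simp
  let B : AffineBasis (Fin 4) ℝ (Fin 3 → ℝ) := ⟨w, hw, htop⟩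
  have hB : Set.range w = Set.range B := rfl
  rw [hB, B.interior_convexHull]
  constructor
  · intro h
    refine ⟨fun i => B.coord i x, h, B.sum_coord_apply_eq_one x, ?_⟩
    exact B.linear_combination_coord_eq_self x
  · rintro ⟨r, h1, h2, h3⟩ i
    have e : (Finset.univ.affineCombination ℝ w) r = x := by
      rw [Finset.affineCombination_eq_linear_combination _ _ _ h2, h3]
    have := B.coord_apply_combination_of_mem (Finset.mem_univ i) h2
    have e' : (Finset.univ.affineCombination ℝ B) r = x := e
    rw [e'] at this
    rw [this]
    exact h1 i

theorem mem_intLatPts_iff {v : Fin 4 → Fin 3 → ℤ} (hv : AffineIndependent ℝ (fun i => castPt (v i)))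
    (x : Fin 3 → ℤ) :
    x ∈ intLatPts (convexHull ℝ (Set.range fun i => castPt (v i))) ↔
      ∃ r : Fin 4 → ℝ, (∀ i, 0 < r i) ∧ ∑ i, r i = 1 ∧ ∑ i, r i • castPt (v i) = castPt x :=
  mem_interior_iff hv _

/-! ### Construction of the simplices -/

theorem construct (L c x0 : Fin 4 → ℤ) (g h D kk ll : ℤ) (hL : ∀ i, 0 < L i) (hg : 0 < g)
    (hh : ∑ i, L i = h) (hD : D = h * g) (hc : g ∣ ∑ i, c i)
    (hx0 : ∀ i, D ∣ x0 i - (kk * (L i * g) + ll * (c i * h))) (hx0p : ∀ i, 0 < x0 i)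
    (hx0s : ∑ i, x0 i = D) (hx0n : x0 ≠ fun i => g * L i)
    (hchk : ∀ (x : Fin 4 → ℤ) (k l : ℤ), (∀ i, D ∣ x i - (k * (L i * g) + l * (c i * h))) →
      (∀ i, 0 < x i) → ∑ i, x i = D → (x = fun i => g * L i) ∨ x = x0) :
    ∃ v : Fin 4 → Fin 3 → ℤ,
      AffineIndependent ℝ (fun i => castPt (v i)) ∧
      (intLatPts (convexHull ℝ (Set.range fun i => castPt (v i)))).ncard = 2 ∧
      (0 : Fin 3 → ℤ) ∈ intLatPts (convexHull ℝ (Set.range fun i => castPt (v i))) ∧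
      (∑ i, L i • v i) = 0 := by
  have hhp : 0 < h := by
    rw [← hh]; exact Finset.sum_pos (fun i _ => hL i) ⟨0, Finset.mem_univ _⟩
  have hDp : 0 < D := by rw [hD]; positivity
  have hDr : (0 : ℝ) < D := by exact_mod_cast hDp
  -- the lattice
  let M : Submodule ℤ (Fin 3 → ℤ) :=
    { carrier := {m | ∃ k l : ℤ, ∀ j : Fin 3,
        D ∣ m j - (k * (L j.castSucc * g) + l * (c j.castSucc * h))}
      zero_mem' := ⟨0, 0, fun j => by simp⟩
      add_mem' := by
        rintro a b ⟨k, l, h1⟩ ⟨k', l', h2⟩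
        refine ⟨k + k', l + l', fun j => ?_⟩
        have := dvd_add (h1 j) (h2 j)
        have e : (a + b) j - ((k + k') * (L j.castSucc * g) + (l + l') * (c j.castSucc * h)) =
            a j - (k * (L j.castSucc * g) + l * (c j.castSucc * h)) +
            (b j - (k' * (L j.castSucc * g) + l' * (c j.castSucc * h))) := by
          simp only [Pi.add_apply]; ring
        rw [e]; exact this
      smul_mem' := by
        rintro s a ⟨k, l, h1⟩
        refine ⟨s * k, s * l, fun j => ?_⟩
        have := Dvd.dvd.mul_left (h1 j) s
        have e : (s • a) j - ((s * k) * (L j.castSucc * g) + (s * l) * (c j.castSucc * h)) =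
            s * (a j - (k * (L j.castSucc * g) + l * (c j.castSucc * h))) := by
          simp only [Pi.smul_apply, smul_eq_mul]; ring
        rw [e]; exact this }
  have hM (m : Fin 3 → ℤ) : m ∈ M ↔ ∃ k l : ℤ, ∀ j : Fin 3,
        D ∣ m j - (k * (L j.castSucc * g) + l * (c j.castSucc * h)) := Iff.rfl
  have hfr : Module.finrank ℤ M = 3 := by
    apply le_antisymm
    · have := Submodule.finrank_le M
      simpa using this
    · let f : (Fin 3 → ℤ) →ₗ[ℤ] M := LinearMap.codRestrict M (D • LinearMap.id) (by
        intro m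
        refine ⟨0, 0, fun j => ?_⟩
        simp)
      have hf : Function.Injective f := by
        intro a b hab
        have h1 : (f a : Fin 3 → ℤ) = f b := by rw [hab]
        have h2 : D • a = D • b := h1
        exact smul_right_injective _ hDp.ne' h2
      have := LinearMap.finrank_le_finrank_of_injective hf
      simpa using this
  let B : Module.Basis (Fin 3) ℤ M := Module.finBasisOfFinrankEq ℤ M hfr
  let φ : M ≃ₗ[ℤ] (Fin 3 → ℤ) := B.equivFun
  -- vertices
  let wv : Fin 4 → Fin 3 → ℤ := fun i j => (if i = j.castSucc then D else 0) - g * L j.castSucc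
  have hwM (i : Fin 4) : wv i ∈ M := by
    refine ⟨-1, 0, fun j => ?_⟩
    have : wv i j - (-1 * (L j.castSucc * g) + 0 * (c j.castSucc * h)) =
        if i = j.castSucc then D else 0 := by simp only [wv]; ring
    rw [this]
    split_ifs <;> simp
  have hcomb (x : Fin 4 → ℤ) (hx : ∑ i, x i = D) (j : Fin 3) :
      ∑ i, x i * wv i j = D * (x j.castSucc - g * L j.castSucc) := by
    simp only [wv, mul_sub, Finset.sum_sub_distrib, ← Finset.sum_mul, hx]
    simp [mul_comm]
  have hcombr (x : Fin 4 → ℝ) (j : Fin 3) :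
      ∑ i, x i * (wv i j : ℝ) = D * x j.castSucc - (∑ i, x i) * (g * L j.castSucc) := by
    simp only [wv]
    push_cast
    simp only [mul_sub, Finset.sum_sub_distrib, ← Finset.sum_mul]
    simp [mul_comm]
  let v : Fin 4 → Fin 3 → ℤ := fun i => φ ⟨wv i, hwM i⟩
  let Ψ : (Fin 3 → ℝ) →ₗ[ℝ] (Fin 3 → ℝ) :=
    ∑ j, (LinearMap.proj j : (Fin 3 → ℝ) →ₗ[ℝ] ℝ).smulRight (castPt (B j : Fin 3 → ℤ))
  have hΨ (m : M) : Ψ (castPt (φ m)) = castPt (m : Fin 3 → ℤ) := by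
    have h1 : ∑ j, φ m j • B j = m := B.sum_equivFun m
    have h2 : ∑ j, φ m j • (B j : Fin 3 → ℤ) = m := by
      conv_rhs => rw [← h1]
      push_cast
      rfl
    rw [← h2, castPt_sum]
    simp [Ψ, castPt]
  have hΨv (i : Fin 4) : Ψ (castPt (v i)) = castPt (wv i) := hΨ ⟨wv i, hwM i⟩
  have hwind : AffineIndependent ℝ (fun i => castPt (wv i)) := by
    rw [affInd_iff]
    intro r hr hr'
    have h3 (j : Fin 3) : r j.castSucc = 0 := by
      have h4 := congrFun hr' j
      have h5 : ∑ i, r i * (wv i j : ℝ) = 0 := by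
        simpa [Finset.sum_apply, castPt] using h4
      rw [hcombr, hr] at h5
      have h6 : (D : ℝ) * r j.castSucc = 0 := by linarith
      rcases mul_eq_zero.1 h6 with h7 | h7
      · exact absurd h7 hDr.ne'
      · exact h7
    rw [Fin.sum_univ_castSucc] at hr
    simp only [h3, Finset.sum_const_zero, zero_add] at hr
    intro i
    refine Fin.lastCases hr h3 i
  have hvind : AffineIndependent ℝ (fun i => castPt (v i)) := by
    apply AffineIndependent.of_comp Ψ.toAffineMap
    have : (Ψ.toAffineMap ∘ fun i => castPt (v i)) = fun i => castPt (wv i) := by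
      ext1 i
      exact hΨv i
    rw [this]
    exact hwind
  -- points of the simplex
  have hpt (x : Fin 4 → ℤ) (hxp : ∀ i, 0 < x i) (hxs : ∑ i, x i = D) (m : M)
      (hm : ∀ j, (m : Fin 3 → ℤ) j = x j.castSucc - g * L j.castSucc) :
      φ m ∈ intLatPts (convexHull ℝ (Set.range fun i => castPt (v i))) := by
    rw [mem_intLatPts_iff hvind]
    have e1 : ∑ i, x i • v i = D • φ m := by
      have : ∑ i, x i • (⟨wv i, hwM i⟩ : M) = D • m := by
        apply Subtype.ext
        push_cast
        ext j
        simp only [Finset.sum_apply, Pi.smul_apply, smul_eq_mul]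
        rw [hcomb x hxs, hm]
      rw [← map_smul, ← this, map_sum]
      simp only [map_smul]
      rfl
    refine ⟨fun i => x i / D, fun i => ?_, ?_, ?_⟩
    · have : (0 : ℝ) < x i := by exact_mod_cast hxp i
      positivity
    · rw [← Finset.sum_div, div_eq_one_iff_eq hDr.ne']
      exact_mod_cast hxs
    · have e2 := congrArg castPt e1
      rw [castPt_sum] at e2
      have e3 : castPt (D • φ m) = (D : ℝ) • castPt (φ m) := by
        ext j; simp [castPt]
      rw [e3] at e2
      have e4 : castPt (φ m) = (D : ℝ)⁻¹ • ∑ i, (x i : ℝ) • castPt (v i) := by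
        rw [e2, smul_smul, inv_mul_cancel₀ hDr.ne', one_smul]
      rw [e4, Finset.smul_sum]
      refine Finset.sum_congr rfl fun i _ => ?_
      change ((x i : ℝ) / D) • _ = _
      rw [smul_smul, div_eq_inv_mul]
  have hgL : ∑ i, g * L i = D := by rw [← Finset.mul_sum, hh, hD, mul_comm]
  have hm0 : (fun j : Fin 3 => x0 j.castSucc - g * L j.castSucc) ∈ M := by
    refine ⟨kk - 1, ll, fun j => ?_⟩
    convert hx0 j.castSucc using 1
    ring
  let m0 : M := ⟨_, hm0⟩
  have hin0 : (0 : Fin 3 → ℤ) ∈ intLatPts (convexHull ℝ (Set.range fun i => castPt (v i))) := by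
    have := hpt (fun i => g * L i) (fun i => mul_pos hg (hL i)) hgL 0 (fun j => by simp)
    simpa using this
  have hin1 : φ m0 ∈ intLatPts (convexHull ℝ (Set.range fun i => castPt (v i))) :=
    hpt x0 hx0p hx0s m0 (fun j => rfl)
  have hne : φ m0 ≠ 0 := by
    intro h0
    have h1 : m0 = 0 := by simpa using h0
    have h2 : (m0 : Fin 3 → ℤ) = 0 := by rw [h1]; rfl
    have h3 (j : Fin 3) : x0 j.castSucc = g * L j.castSucc := by
      have h4 : x0 j.castSucc - g * L j.castSucc = 0 := congrFun h2 j
      linarith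
    apply hx0n
    rw [Fin.sum_univ_castSucc] at hx0s hgL
    simp only [h3] at hx0s
    ext i
    refine Fin.lastCases ?_ h3 i
    linarith
  have hset : intLatPts (convexHull ℝ (Set.range fun i => castPt (v i))) = {φ m0, 0} := by
    apply Set.Subset.antisymm
    · intro z hz
      obtain ⟨r, hr, hrs, hrz⟩ := (mem_intLatPts_iff hvind z).1 hz
      obtain ⟨m, rfl⟩ := φ.surjective z
      have h1 := congrArg Ψ hrz
      rw [hΨ, map_sum] at h1
      simp only [map_smul, hΨv] at h1
      let x : Fin 4 → ℤ := Fin.lastCases (D - ∑ j : Fin 3, ((m : Fin 3 → ℤ) j + g * L j.castSucc))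
        (fun j => (m : Fin 3 → ℤ) j + g * L j.castSucc)
      have hxc (j : Fin 3) : x j.castSucc = (m : Fin 3 → ℤ) j + g * L j.castSucc := by
        simp only [x, Fin.lastCases_castSucc]
      have hxl : x (Fin.last 3) = D - ∑ j : Fin 3, x j.castSucc := by
        simp only [hxc]
        simp only [x, Fin.lastCases_last]
      have hxs : ∑ i, x i = D := by
        rw [Fin.sum_univ_castSucc, hxl]; ring
      have hrc (j : Fin 3) : (D : ℝ) * r j.castSucc = x j.castSucc := by
        have h2 := congrFun h1 j
        have h3 : ∑ i, r i * (wv i j : ℝ) = (m : Fin 3 → ℤ) j := by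
          simpa [Finset.sum_apply, castPt] using h2
        rw [hcombr, hrs] at h3
        rw [hxc]
        push_cast
        linarith
      have hrl : (D : ℝ) * r (Fin.last 3) = x (Fin.last 3) := by
        rw [Fin.sum_univ_castSucc] at hrs
        have : (D : ℝ) * (∑ j : Fin 3, r j.castSucc + r (Fin.last 3)) = D := by rw [hrs, mul_one]
        rw [mul_add, Finset.mul_sum] at this
        simp only [hrc] at this
        rw [hxl, Int.cast_sub, Int.cast_sum]
        linarith
      have hxp (i : Fin 4) : 0 < x i := by
        have : (0 : ℝ) < x i := by
          refine Fin.lastCases ?_ (fun j => ?_) i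
          · rw [← hrl]; exact mul_pos hDr (hr _)
          · rw [← hrc]; exact mul_pos hDr (hr _)
        exact_mod_cast this
      obtain ⟨k, l, hkl⟩ := (hM m).1 m.2
      have hdv (i : Fin 4) : D ∣ x i - ((k + 1) * (L i * g) + l * (c i * h)) := by
        have hj (j : Fin 3) :
            D ∣ x j.castSucc - ((k + 1) * (L j.castSucc * g) + l * (c j.castSucc * h)) := by
          rw [hxc]
          convert hkl j using 1
          ring
        refine Fin.lastCases ?_ hj i
        have hsum : D ∣ ∑ i, (x i - ((k + 1) * (L i * g) + l * (c i * h))) := by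
          rw [Finset.sum_sub_distrib, hxs, Finset.sum_add_distrib, ← Finset.mul_sum,
            ← Finset.mul_sum, ← Finset.sum_mul, ← Finset.sum_mul, hh]
          obtain ⟨q, hq⟩ := hc
          rw [hq, hD]
          exact ⟨1 - (k + 1) - l * q, by ring⟩
        rw [Fin.sum_univ_castSucc] at hsum
        exact (dvd_add_right (Finset.dvd_sum fun j _ => hj j)).1 hsum
      rcases hchk x (k + 1) l hdv hxp hxs with hx | hx
      · right
        have : m = 0 := by
          apply Subtype.ext
          ext j
          have h2 := hxc j
          rw [hx] at h2
          simp only [ZeroMemClass.coe_zero, Pi.zero_apply]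
          linarith
        rw [this]; simp
      · left
        have : m = m0 := by
          apply Subtype.ext
          ext j
          have h2 := hxc j
          rw [hx] at h2
          change (m : Fin 3 → ℤ) j = x0 j.castSucc - g * L j.castSucc
          linarith
        rw [this]
    · rintro z (rfl | rfl)
      · exact hin1
      · exact hin0
  refine ⟨v, hvind, ?_, hin0, ?_⟩
  · rw [hset, Set.ncard_pair hne]
  · have h1 : ∑ i, (g * L i) • v i = D • φ 0 := by
      have : ∑ i, (g * L i) • (⟨wv i, hwM i⟩ : M) = 0 := by
        apply Subtype.ext
        push_cast
        ext j
        simp only [Finset.sum_apply, Pi.smul_apply, smul_eq_mul]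
        rw [hcomb (fun i => g * L i) hgL]
        simp
      rw [map_zero, smul_zero, ← map_zero φ, ← this, map_sum]
      simp only [map_smul]
      rfl
    simp only [mul_smul, ← Finset.smul_sum, map_zero, smul_zero] at h1
    rcases smul_eq_zero.1 h1 with h2 | h2
    · exact absurd h2 hg.ne'
    · exact h2


/-! ### Checking the witnesses -/

def allBelow (n : ℕ) (f : ℕ → Bool) : Bool :=
  Nat.rec (motive := fun _ => Bool) true (fun m ih => cond (f m) ih false) n

theorem allBelow_sound {n : ℕ} {f : ℕ → Bool} (h : allBelow n f = true) : ∀ m < n, f m = true := by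
  induction n with
  | zero => intro m hm; omega
  | succ n ih =>
    have h' : cond (f n) (allBelow n f) false = true := h
    intro m hm
    cases e : f n with
    | false => rw [e] at h'; simp at h'
    | true =>
      rw [e] at h'
      rcases Nat.lt_succ_iff_lt_or_eq.1 hm with h1 | rfl
      · exact ih h' m h1
      · exact e

/-- If the reduced combination is an interior point, it is `P` or `y`. -/
def one (D P0 P1 P2 P3 Q0 Q1 Q2 Q3 y0 y1 y2 y3 k l : ℕ) : Bool :=
  force ((k * P0 + l * Q0) % D) fun x0 => force ((k * P1 + l * Q1) % D) fun x1 =>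
  force ((k * P2 + l * Q2) % D) fun x2 => force ((k * P3 + l * Q3) % D) fun x3 =>
  cond (Nat.beq (x0 + x1 + x2 + x3) D)
    (Nat.beq x0 0 || Nat.beq x1 0 || Nat.beq x2 0 || Nat.beq x3 0 ||
      (Nat.beq x0 P0 && Nat.beq x1 P1 && Nat.beq x2 P2 && Nat.beq x3 P3) ||
      (Nat.beq x0 y0 && Nat.beq x1 y1 && Nat.beq x2 y2 && Nat.beq x3 y3)) true

def chk (L0 L1 L2 L3 c0 c1 c2 c3 g kk ll : ℕ) : Bool :=
  force (L0 + L1 + L2 + L3) fun h => force (h * g) fun D =>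
  force (L0 * g) fun P0 => force (L1 * g) fun P1 => force (L2 * g) fun P2 =>
  force (L3 * g) fun P3 =>
  force (c0 * h) fun Q0 => force (c1 * h) fun Q1 => force (c2 * h) fun Q2 =>
  force (c3 * h) fun Q3 =>
  force ((kk * P0 + ll * Q0) % D) fun y0 => force ((kk * P1 + ll * Q1) % D) fun y1 =>
  force ((kk * P2 + ll * Q2) % D) fun y2 => force ((kk * P3 + ll * Q3) % D) fun y3 =>
  Nat.blt 0 g && Nat.beq ((c0 + c1 + c2 + c3) % g) 0 &&
  Nat.blt 0 y0 && Nat.blt 0 y1 && Nat.blt 0 y2 && Nat.blt 0 y3 &&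
  Nat.beq (y0 + y1 + y2 + y3) D &&
  !(Nat.beq y0 P0 && Nat.beq y1 P1 && Nat.beq y2 P2 && Nat.beq y3 P3) &&
  allBelow h fun k => allBelow g fun l => one D P0 P1 P2 P3 Q0 Q1 Q2 Q3 y0 y1 y2 y3 k l

def chkEntry (p : ℕ × ℕ) : Bool :=
  force (q0 p.1) fun L0 => force (q1 p.1) fun L1 => force (q2 p.1) fun L2 =>
  force (q3 p.1) fun L3 =>
  cond (Nat.beq p.2 0) true <|
  cond (Nat.blt p.2 128) (chk L0 L1 L2 L3 0 0 0 0 1 p.2 0) <|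
  force (q0 p.2) fun c0 => force (q1 p.2) fun c1 => force (q2 p.2) fun c2 =>
  force (q3 p.2) fun c3 => force (c0 + c1 + c2 + c3) fun g =>
  chk L0 L1 L2 L3 c0 c1 c2 c3 g 0 1

def chkAll (t : BT) : Bool :=
  BT.rec (motive := fun _ => Bool) true
    (fun key tag _ _ ihl ihr => cond (chkEntry (key, tag)) (cond ihl ihr false) false) t

theorem chkAll_sound {t : BT} (h : chkAll t = true) : ∀ p ∈ t.toList, chkEntry p = true := by
  induction t with
  | e => intro p hp; simp [BT.toList] at hp
  | n key tag l r ihl ihr =>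
    have h' : cond (chkEntry (key, tag)) (cond (chkAll l) (chkAll r) false) false = true := h
    cases e : chkEntry (key, tag) with
    | false => rw [e] at h'; simp at h'
    | true =>
    cases e2 : chkAll l with
    | false => rw [e, e2] at h'; simp at h'
    | true =>
    rw [e, e2] at h'
    intro p hp
    simp only [BT.toList, List.mem_append, List.mem_cons] at hp
    rcases hp with hp | rfl | hp
    · exact ihl e2 p hp
    · exact e
    · exact ihr h' p hp

set_option maxRecDepth 100000 in
theorem table_chk : chkAll table = true := by decide +kernel

/-- Basic facts about the weights in the table. -/
def basic (x : ℕ) : Bool :=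
  Nat.blt 0 (q0 x) && Nat.ble (q0 x) (q1 x) && Nat.ble (q1 x) (q2 x) && Nat.ble (q2 x) (q3 x) &&
    Nat.beq (Nat.gcd (Nat.gcd (q0 x) (q1 x)) (Nat.gcd (q2 x) (q3 x))) 1

set_option maxRecDepth 100000 in
theorem table_basic : ∀ p ∈ table.toList, basic p.1 = true := by decide +kernel

/-- The keys of the weights that occur. -/
def keys : List ℕ := (table.toList.filter fun p => p.2 != 0).map Prod.fst

set_option maxRecDepth 100000 in
theorem keys_length : keys.length = 548 := by decide +kernel

set_option maxRecDepth 100000 in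
theorem keys_chain : keys.IsChain (· < ·) := by decide +kernel

theorem keys_nodup : keys.Nodup := by
  have := List.isChain_iff_pairwise.1 keys_chain
  exact this.imp fun h => h.ne


/-! ### The weights in the table occur -/

/-- Decoding of a key as a weight vector. -/
def dec (x : ℕ) : Fin 4 → ℤ := fun i => ((![q0 x, q1 x, q2 x, q3 x] i : ℕ) : ℤ)

theorem mod_aux {x : ℤ} {n D : ℕ} (h1 : 0 < x) (h2 : x < D) (h3 : (D : ℤ) ∣ x - n) :
    x = ((n % D : ℕ) : ℤ) := by
  have h4 : (n : ℤ) ≡ x [ZMOD D] := Int.modEq_iff_dvd.2 h3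
  have h5 : (n : ℤ) % D = x % D := h4
  rw [Int.emod_eq_of_lt h1.le h2] at h5
  rw [← h5]
  norm_cast

theorem one_sound {D P0 P1 P2 P3 Q0 Q1 Q2 Q3 y0 y1 y2 y3 k l x0 x1 x2 x3 : ℕ}
    (h : one D P0 P1 P2 P3 Q0 Q1 Q2 Q3 y0 y1 y2 y3 k l = true)
    (e0 : x0 = (k * P0 + l * Q0) % D) (e1 : x1 = (k * P1 + l * Q1) % D)
    (e2 : x2 = (k * P2 + l * Q2) % D) (e3 : x3 = (k * P3 + l * Q3) % D)
    (p0 : 0 < x0) (p1 : 0 < x1) (p2 : 0 < x2) (p3 : 0 < x3) (hs : x0 + x1 + x2 + x3 = D) :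
    (x0 = P0 ∧ x1 = P1 ∧ x2 = P2 ∧ x3 = P3) ∨ (x0 = y0 ∧ x1 = y1 ∧ x2 = y2 ∧ x3 = y3) := by
  simp only [one, force_eq] at h
  rw [← e0, ← e1, ← e2, ← e3] at h
  have : Nat.beq (x0 + x1 + x2 + x3) D = true := by rw [Nat.beq_eq]; exact hs
  rw [this] at h
  simp only [cond_true, Bool.or_eq_true, Bool.and_eq_true, Nat.beq_eq] at h
  omega

theorem chk_sound {L0 L1 L2 L3 c0 c1 c2 c3 g kk ll : ℕ} (l0 : 0 < L0) (l1 : 0 < L1) (l2 : 0 < L2)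
    (l3 : 0 < L3) (hc : chk L0 L1 L2 L3 c0 c1 c2 c3 g kk ll = true) :
    ∃ v : Fin 4 → Fin 3 → ℤ,
      AffineIndependent ℝ (fun i => castPt (v i)) ∧
      (intLatPts (convexHull ℝ (Set.range fun i => castPt (v i)))).ncard = 2 ∧
      (0 : Fin 3 → ℤ) ∈ intLatPts (convexHull ℝ (Set.range fun i => castPt (v i))) ∧
      (∑ i, ((![L0, L1, L2, L3] i : ℕ) : ℤ) • v i) = 0 := by
  simp only [chk, force_eq, Bool.and_eq_true, Nat.beq_eq, Nat.blt_eq, Bool.not_eq_true',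
    ← Bool.not_eq_true] at hc
  obtain ⟨⟨⟨⟨⟨⟨⟨⟨hg, hcg⟩, y0⟩, y1⟩, y2⟩, y3⟩, ys⟩, yn⟩, hall⟩ := hc
  set h := L0 + L1 + L2 + L3 with hh
  set D := h * g with hD
  have hhp : 0 < h := by omega
  have hDp : 0 < D := Nat.mul_pos hhp hg
  let L : Fin 4 → ℕ := ![L0, L1, L2, L3]
  let c : Fin 4 → ℕ := ![c0, c1, c2, c3]
  refine construct (fun i => (L i : ℤ)) (fun i => (c i : ℤ))
    (fun i => (((kk * (L i * g) + ll * (c i * h)) % D : ℕ) : ℤ)) g h D kk ll ?_ ?_ ?_ ?_ ?_ ?_ ?_ ?_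
    ?_ ?_
  · intro i
    fin_cases i <;> simp [L] <;> assumption
  · exact_mod_cast hg
  · simp [Fin.sum_univ_four, L, hh]
  · exact_mod_cast hD
  · have : g ∣ c0 + c1 + c2 + c3 := Nat.dvd_of_mod_eq_zero hcg
    simp only [Fin.sum_univ_four, c]
    simp
    exact_mod_cast this
  · intro i
    push_cast
    exact dvd_sub_comm.1 Int.dvd_self_sub_emod
  · intro i
    have : 0 < (kk * (L i * g) + ll * (c i * h)) % D := by
      fin_cases i <;> simp only [L, c] <;> assumption
    exact_mod_cast this
  · simp only [Fin.sum_univ_four]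
    exact_mod_cast ys
  · intro he
    apply yn
    have (i : Fin 4) : (kk * (L i * g) + ll * (c i * h)) % D = L i * g := by
      have := congrFun he i
      rw [mul_comm (L i) g]
      rw [mul_comm (L i) g] at this
      exact_mod_cast this
    exact ⟨⟨⟨this 0, this 1⟩, this 2⟩, this 3⟩
  · intro x k l hdvd hxp hxs
    have hh0 : (0 : ℤ) < h := by exact_mod_cast hhp
    have hg0 : (0 : ℤ) < g := by exact_mod_cast hg
    obtain ⟨k', hk'⟩ := Int.eq_ofNat_of_zero_le (Int.emod_nonneg k hh0.ne')
    obtain ⟨l', hl'⟩ := Int.eq_ofNat_of_zero_le (Int.emod_nonneg l hg0.ne')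
    have hkl : k' < h := by
      have := Int.emod_lt_of_pos k hh0
      rw [hk'] at this
      exact_mod_cast this
    have hll : l' < g := by
      have := Int.emod_lt_of_pos l hg0
      rw [hl'] at this
      exact_mod_cast this
    have hlt (i : Fin 4) : x i < D := by
      have a0 := hxp 0
      have a1 := hxp 1
      have a2 := hxp 2
      have a3 := hxp 3
      rw [Fin.sum_univ_four] at hxs
      fin_cases i <;> simp <;> omega
    have hx (i : Fin 4) : x i = (((k' * (L i * g) + l' * (c i * h)) % D : ℕ) : ℤ) := by
      apply mod_aux (hxp i) (hlt i)
      have h1 : k = h * (k / h) + k' := by rw [← hk']; exact (Int.mul_ediv_add_emod k h).symm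
      have h2 : l = g * (l / g) + l' := by rw [← hl']; exact (Int.mul_ediv_add_emod l g).symm
      have h3 := hdvd i
      have h4 : x i - ((k' * (L i * g) + l' * (c i * h) : ℕ) : ℤ) =
          x i - (k * (L i * g) + l * (c i * h)) + D * ((k / h) * L i + (l / g) * c i) := by
        conv_rhs => rw [h1, h2]
        rw [hD]
        push_cast
        have e1 : ((h : ℤ) * (k / h) + k') / h = k / h := by rw [← h1]
        have e2 : ((g : ℤ) * (l / g) + l') / g = l / g := by rw [← h2]
        rw [e1, e2]
        ring
      rw [h4]
      exact dvd_add h3 (dvd_mul_right _ _)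
    have H := allBelow_sound (allBelow_sound hall k' hkl) l' hll
    have hpos (i : Fin 4) : 0 < (k' * (L i * g) + l' * (c i * h)) % D := by
      have := hxp i
      rw [hx i] at this
      exact_mod_cast this
    have hsum : (k' * (L 0 * g) + l' * (c 0 * h)) % D + (k' * (L 1 * g) + l' * (c 1 * h)) % D +
        (k' * (L 2 * g) + l' * (c 2 * h)) % D + (k' * (L 3 * g) + l' * (c 3 * h)) % D = D := by
      rw [Fin.sum_univ_four, hx 0, hx 1, hx 2, hx 3] at hxs
      exact_mod_cast hxs
    rcases one_sound H rfl rfl rfl rfl (hpos 0) (hpos 1) (hpos 2) (hpos 3) hsum with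
      ⟨r0, r1, r2, r3⟩ | ⟨r0, r1, r2, r3⟩
    · left
      have hr (i : Fin 4) : (k' * (L i * g) + l' * (c i * h)) % D = L i * g := by
        fin_cases i
        · exact r0
        · exact r1
        · exact r2
        · exact r3
      ext i
      rw [hx i, hr i]
      push_cast
      ring
    · right
      have hr (i : Fin 4) : (k' * (L i * g) + l' * (c i * h)) % D =
          (kk * (L i * g) + ll * (c i * h)) % D := by
        fin_cases i
        · exact r0
        · exact r1
        · exact r2
        · exact r3
      ext i
      rw [hx i, hr i]

theorem gcd_dec {x : ℕ} (h : Nat.gcd (Nat.gcd (q0 x) (q1 x)) (Nat.gcd (q2 x) (q3 x)) = 1) :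
    Finset.univ.gcd (dec x) = 1 := by
  have hd (i : Fin 4) : (Finset.univ.gcd (dec x)).natAbs ∣ ![q0 x, q1 x, q2 x, q3 x] i := by
    have : Finset.univ.gcd (dec x) ∣ dec x i := Finset.gcd_dvd (Finset.mem_univ i)
    have := Int.natAbs_dvd_natAbs.2 this
    simpa [dec] using this
  have h1 : (Finset.univ.gcd (dec x)).natAbs ∣ 1 := by
    rw [← h]
    exact Nat.dvd_gcd (Nat.dvd_gcd (hd 0) (hd 1)) (Nat.dvd_gcd (hd 2) (hd 3))
  have h2 : IsUnit (Finset.univ.gcd (dec x)) := by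
    rw [Int.isUnit_iff_natAbs_eq]
    exact Nat.dvd_one.1 h1
  rw [← Finset.normalize_gcd]
  exact normalize_eq_one.2 h2

theorem basic_spec {x : ℕ} (h : basic x = true) : 0 < q0 x ∧ q0 x ≤ q1 x ∧ q1 x ≤ q2 x ∧
    q2 x ≤ q3 x ∧ Nat.gcd (Nat.gcd (q0 x) (q1 x)) (Nat.gcd (q2 x) (q3 x)) = 1 := by
  simp only [basic, Bool.and_eq_true, Nat.blt_eq, Nat.ble_eq, Nat.beq_eq] at h
  tauto

theorem mem_keys {x : ℕ} : x ∈ keys ↔ ∃ p ∈ table.toList, p.2 ≠ 0 ∧ p.1 = x := by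
  simp only [keys, List.mem_map, List.mem_filter, bne_iff_ne, and_assoc]

theorem dec_mem {x : ℕ} (hx : x ∈ keys) : dec x ∈ W32 := by
  obtain ⟨p, hp, hp0, rfl⟩ := mem_keys.1 hx
  obtain ⟨b0, b1, b2, b3, b4⟩ := basic_spec (table_basic p hp)
  have hc := chkAll_sound table_chk p hp
  simp only [chkEntry, force_eq] at hc
  have e : Nat.beq p.2 0 = false := by
    rw [← Bool.not_eq_true, Nat.beq_eq]; exact hp0
  rw [e] at hc
  have hv : ∃ v : Fin 4 → Fin 3 → ℤ,
      AffineIndependent ℝ (fun i => castPt (v i)) ∧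
      (intLatPts (convexHull ℝ (Set.range fun i => castPt (v i)))).ncard = 2 ∧
      (0 : Fin 3 → ℤ) ∈ intLatPts (convexHull ℝ (Set.range fun i => castPt (v i))) ∧
      (∑ i, dec p.1 i • v i) = 0 := by
    cases e2 : Nat.blt p.2 128 with
    | true =>
      rw [e2] at hc
      exact chk_sound b0 (by omega) (by omega) (by omega) hc
    | false =>
      rw [e2] at hc
      exact chk_sound b0 (by omega) (by omega) (by omega) hc
  obtain ⟨v, h1, h2, h3, h4⟩ := hv
  refine ⟨v, h1, h2, h3, ?_, h4, gcd_dec b4, ?_⟩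
  · intro i
    fin_cases i <;> simp [dec] <;> omega
  · rw [Fin.monotone_iff_le_succ]
    intro i
    fin_cases i <;> simp [dec] <;> omega

/-! ### All weights are in the table -/

theorem two_pts {α : Type*} {S : Set α} (h : S.ncard = 2) {x y z : α} (hx : x ∈ S) (hy : y ∈ S)
    (hz : z ∈ S) : x = y ∨ x = z ∨ y = z := by
  obtain ⟨a, b, -, rfl⟩ := Set.ncard_eq_two.1 h
  rcases hx with rfl | rfl <;> rcases hy with rfl | rfl <;> rcases hz with rfl | rfl <;> simp

theorem pt_aux {v : Fin 4 → Fin 3 → ℤ} {b c : Fin 4 → ℝ} {o : Fin 3 → ℤ} (hb : ∑ i, b i = 1)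
    (hbw : ∑ i, b i • castPt (v i) = 0) (hc : ∑ i, c i = 1)
    (hcw : ∑ i, c i • castPt (v i) = castPt o) (k l : ℤ) (a : Fin 4 → ℤ)
    (ha : ∑ i, a i + 1 = k + l) :
    ∑ i, (k * c i + l * b i - a i : ℝ) = 1 ∧
    ∑ i, (k * c i + l * b i - a i : ℝ) • castPt (v i) = castPt (k • o - ∑ i, a i • v i) := by
  constructor
  · rw [Finset.sum_sub_distrib, Finset.sum_add_distrib, ← Finset.mul_sum, ← Finset.mul_sum, hb, hc]
    have : (∑ i, (a i : ℝ)) + 1 = k + l := by exact_mod_cast ha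
    linarith
  · have e : castPt (k • o - ∑ i, a i • v i) = (k : ℝ) • castPt o - castPt (∑ i, a i • v i) := by
      ext j
      simp [castPt]
    rw [e, castPt_sum, ← hcw]
    simp only [sub_smul, add_smul, Finset.sum_sub_distrib, Finset.sum_add_distrib, mul_smul,
      ← Finset.smul_sum, hbw]
    simp

theorem forward {lam : Fin 4 → ℤ} (hlam : lam ∈ W32) : ∃ x ∈ keys, dec x = lam := by
  obtain ⟨v, hv, h2, h0, hpos, hsum, hgcd, hmono⟩ := hlam
  set S := intLatPts (convexHull ℝ (Set.range fun i => castPt (v i))) with hS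
  have hhz : 0 < ∑ i, lam i := Finset.sum_pos (fun i _ => hpos i) ⟨0, Finset.mem_univ _⟩
  set hz := ∑ i, lam i with hhz_def
  have hhp : (0 : ℝ) < hz := by exact_mod_cast hhz
  let b : Fin 4 → ℝ := fun i => lam i / hz
  have hbl (i : Fin 4) : b i * hz = lam i := div_mul_cancel₀ _ hhp.ne'
  have hbp (i : Fin 4) : 0 < b i := div_pos (by exact_mod_cast hpos i) hhp
  have hbs : ∑ i, b i = 1 := by
    simp only [b]
    rw [← Finset.sum_div, div_eq_one_iff_eq hhp.ne', hhz_def]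
    push_cast; rfl
  have hbw : ∑ i, b i • castPt (v i) = 0 := by
    have h1 := congrArg castPt hsum
    rw [castPt_sum] at h1
    have h3 : castPt (0 : Fin 3 → ℤ) = 0 := by ext j; simp [castPt]
    rw [h3] at h1
    have h4 (i : Fin 4) : b i • castPt (v i) = (hz : ℝ)⁻¹ • ((lam i : ℝ) • castPt (v i)) := by
      rw [smul_smul]; simp only [b]; rw [div_eq_inv_mul]
    simp only [h4, ← Finset.smul_sum, h1, smul_zero]
  have hcast0 : castPt (0 : Fin 3 → ℤ) = 0 := by ext j; simp [castPt]
  have hmem (r : Fin 4 → ℝ) (z : Fin 3 → ℤ) (hr : ∀ i, 0 < r i)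
      (h : ∑ i, r i = 1 ∧ ∑ i, r i • castPt (v i) = castPt z) : z ∈ S :=
    (mem_intLatPts_iff hv z).2 ⟨r, hr, h.1, h.2⟩
  have huniq (r s : Fin 4 → ℝ) (z : Fin 3 → ℤ)
      (h : ∑ i, r i = 1 ∧ ∑ i, r i • castPt (v i) = castPt z)
      (h' : ∑ i, s i = 1 ∧ ∑ i, s i • castPt (v i) = castPt z) : r = s :=
    bary_unique hv (h.1.trans h'.1.symm) (h.2.trans h'.2.symm)
  have hb0 : ∑ i, b i = 1 ∧ ∑ i, b i • castPt (v i) = castPt 0 := ⟨hbs, by rw [hcast0]; exact hbw⟩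
  -- the first tree
  have H : Hyp (b 0) (b 1) (b 2) (b 3) := by
    have hm {i j : Fin 4} (hij : i ≤ j) : b i ≤ b j := by
      have : (lam i : ℝ) ≤ lam j := by exact_mod_cast hmono hij
      simp only [b]
      gcongr
    refine ⟨hm (by decide), hm (by decide), hm (by decide), ?_, hbp 0, ?_⟩
    · rw [← hbs, Fin.sum_univ_four]
    intro k a0 a1 a2 a3 k' a0' a1' a2' a3' K K'
    let a : Fin 4 → ℤ := ![a0, a1, a2, a3]
    let a' : Fin 4 → ℤ := ![a0', a1', a2', a3']
    have hs : ∑ i, a i + 1 = 0 + (k : ℤ) := by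
      have := K.sum
      simp only [Fin.sum_univ_four, a, zero_add]
      simp
      exact_mod_cast this
    have hs' : ∑ i, a' i + 1 = 0 + (k' : ℤ) := by
      have := K'.sum
      simp only [Fin.sum_univ_four, a', zero_add]
      simp
      exact_mod_cast this
    have P := pt_aux hbs hbw hbs (o := 0) hb0.2 0 k a hs
    have P' := pt_aux hbs hbw hbs (o := 0) hb0.2 0 k' a' hs'
    have m := hmem _ _ (by
      have := K.l0
      have := K.l1
      have := K.l2
      have := K.l3
      intro i
      fin_cases i <;> simp [a] <;> linarith) P
    have m' := hmem _ _ (by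
      have := K'.l0
      have := K'.l1
      have := K'.l2
      have := K'.l3
      intro i
      fin_cases i <;> simp [a'] <;> linarith) P'
    rcases two_pts h2 m h0 m' with e | e | e
    · left
      rw [e] at P
      have := huniq _ _ _ P hb0
      have g0 := congrFun this 0
      have g1 := congrFun this 1
      have g2 := congrFun this 2
      have g3 := congrFun this 3
      simp [a] at g0 g1 g2 g3
      exact ⟨g0, g1, g2, g3⟩
    · right; right
      rw [e] at P
      have := huniq _ _ _ P P'
      have g0 := congrFun this 0
      have g1 := congrFun this 1
      have g2 := congrFun this 2
      have g3 := congrFun this 3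
      simp [a, a'] at g0 g1 g2 g3
      exact ⟨g0, g1, g2, g3⟩
    · right; left
      rw [← e] at P'
      have := huniq _ _ _ P' hb0
      have g0 := congrFun this 0
      have g1 := congrFun this 1
      have g2 := congrFun this 2
      have g3 := congrFun this 3
      simp [a'] at g0 g1 g2 g3
      exact ⟨g0, g1, g2, g3⟩
  obtain ⟨p, hp, g, e0, e1, e2, e3⟩ := main_tree H
  obtain ⟨b0, b1, b2, b3, b4⟩ := basic_spec (table_basic p hp)
  have hbg (i : Fin 4) : b i * g = dec p.1 i := by
    fin_cases i
    · simpa [dec] using e0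
    · simpa [dec] using e1
    · simpa [dec] using e2
    · simpa [dec] using e3
  have hg : g = ((∑ i, dec p.1 i : ℤ) : ℝ) := by
    push_cast
    simp only [← hbg]
    rw [← Finset.sum_mul, hbs, one_mul]
  set G := ∑ i, dec p.1 i with hG
  have hGp : 0 < G := by
    rw [hG, Fin.sum_univ_four]
    simp [dec]
    omega
  have hcross (i : Fin 4) : G * lam i = hz * dec p.1 i := by
    have : (G : ℝ) * lam i = hz * dec p.1 i := by
      rw [← hbg, ← hg, ← hbl]; ring
    exact_mod_cast this
  have hGz : G = hz := by
    have h1 : Finset.univ.gcd (fun i => G * lam i) = G := by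
      rw [Finset.gcd_mul_left, hgcd, mul_one, Int.normalize_of_nonneg hGp.le]
    have h3 : Finset.univ.gcd (fun i => hz * dec p.1 i) = hz := by
      rw [Finset.gcd_mul_left, gcd_dec b4, mul_one, Int.normalize_of_nonneg hhz.le]
    rw [← h1, ← h3]
    simp only [hcross]
  have hdec : dec p.1 = lam := by
    ext i
    have := hcross i
    rw [hGz] at this
    exact (mul_left_cancel₀ hhz.ne' this).symm
  refine ⟨p.1, mem_keys.2 ⟨p, hp, ?_, rfl⟩, hdec⟩
  -- the second tree
  intro ht
  obtain ⟨o, ho, hone⟩ : ∃ o ∈ S, o ≠ 0 := by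
    obtain ⟨x, y, hxy, hSe⟩ := Set.ncard_eq_two.1 h2
    by_cases hx : x = 0
    · exact ⟨y, by rw [hSe]; simp, fun hy => hxy (hx.trans hy.symm)⟩
    · exact ⟨x, by rw [hSe]; simp, hx⟩
  obtain ⟨c, hcp, hcs, hcw⟩ := (mem_intLatPts_iff hv o).1 ho
  apply excluded hp ht (c0 := c 0) (c1 := c 1) (c2 := c 2) (c3 := c 3)
  have f0 : ((decW p.1).l0 : ℝ) = lam 0 := by rw [← hdec]; simp [dec, decW]
  have f1 : ((decW p.1).l1 : ℝ) = lam 1 := by rw [← hdec]; simp [dec, decW]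
  have f2 : ((decW p.1).l2 : ℝ) = lam 2 := by rw [← hdec]; simp [dec, decW]
  have f3 : ((decW p.1).l3 : ℝ) = lam 3 := by rw [← hdec]; simp [dec, decW]
  have fh : ((decW p.1).h : ℝ) = hz := by
    rw [← hGz, hG, Fin.sum_univ_four]
    simp [dec, decW, Wt.h]
  refine ⟨hcp 0, hcp 1, hcp 2, hcp 3, ?_, ?_, ?_, ?_⟩
  · rw [← hcs, Fin.sum_univ_four]
  · have : (0 : ℝ) < (decW p.1).h := by rw [fh]; exact hhp
    exact_mod_cast this
  · rw [f0, f1, f2, f3, fh]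
    rintro ⟨g0, g1, g2, g3⟩
    apply hone
    have : c = b := by
      ext i
      have : c i * hz = b i * hz := by
        rw [hbl]
        fin_cases i
        · exact g0
        · exact g1
        · exact g2
        · exact g3
      exact mul_right_cancel₀ hhp.ne' this
    apply castPt_inj
    rw [← hcw, this, hb0.2]
  · rw [f0, f1, f2, f3, fh]
    intro k l a0 a1 a2 a3 hs g0 g1 g2 g3
    let a : Fin 4 → ℤ := ![a0, a1, a2, a3]
    have hs' : ∑ i, a i + 1 = (k : ℤ) + (l : ℤ) := by
      simp only [Fin.sum_univ_four, a]
      simp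
      exact_mod_cast hs
    have P := pt_aux hbs hbw hcs hcw k l a hs'
    have hscale (i : Fin 4) : (((k : ℤ) : ℝ) * c i + ((l : ℤ) : ℝ) * b i - a i) * hz =
        k * (c i * hz) + l * lam i - a i * hz := by
      rw [← hbl]; push_cast; ring
    have m := hmem _ _ (by
      intro i
      refine (mul_pos_iff_of_pos_right hhp).1 ?_
      rw [hscale]
      fin_cases i <;> simp [a] <;> assumption) P
    rcases two_pts h2 m h0 ho with e | e | e
    · left
      rw [e] at P
      have hu := huniq _ _ _ P hb0
      have hi (i : Fin 4) : k * (c i * hz) + l * lam i - a i * hz = (lam i : ℝ) := by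
        rw [← hscale, ← hbl i]
        exact congrArg (· * (hz : ℝ)) (congrFun hu i)
      have g0 := hi 0
      have g1 := hi 1
      have g2 := hi 2
      have g3 := hi 3
      simp [a] at g0 g1 g2 g3
      exact ⟨g0, g1, g2, g3⟩
    · right
      rw [e] at P
      have hu := huniq _ _ _ P ⟨hcs, hcw⟩
      have hi (i : Fin 4) : k * (c i * hz) + l * lam i - a i * hz = c i * hz := by
        rw [← hscale]
        exact congrArg (· * (hz : ℝ)) (congrFun hu i)
      have g0 := hi 0
      have g1 := hi 1
      have g2 := hi 2
      have g3 := hi 3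
      simp [a] at g0 g1 g2 g3
      exact ⟨g0, g1, g2, g3⟩
    · exact absurd e.symm hone

theorem dec_injective : Function.Injective dec := by
  intro x y h
  have h0 : q0 x = q0 y := by have := congrFun h 0; simpa [dec] using this
  have h1 : q1 x = q1 y := by have := congrFun h 1; simpa [dec] using this
  have h2 : q2 x = q2 y := by have := congrFun h 2; simpa [dec] using this
  have h3 : q3 x = q3 y := by have := congrFun h 3; simpa [dec] using this
  unfold q0 at h0
  unfold q1 at h1
  unfold q2 at h2
  unfold q3 at h3
  omega

theorem W32_eq : W32 = dec '' {x | x ∈ keys} := by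
  ext lam
  constructor
  · intro h
    obtain ⟨x, hx, e⟩ := forward h
    exact ⟨x, hx, e⟩
  · rintro ⟨x, hx, rfl⟩
    exact dec_mem hx

theorem W32_ncard : W32.ncard = 548 := by
  rw [W32_eq, Set.ncard_image_of_injective _ dec_injective]
  have : {x | x ∈ keys} = (keys.toFinset : Set ℕ) := by ext x; simp
  rw [this, Set.ncard_coe_finset, List.toFinset_card_of_nodup keys_nodup, keys_length]


end W32Proof

/-- There are exactly `548` normalised weight vectors of three-dimensional lattice
simplices with exactly two interior lattice points. -/
theorem card_weights_two_point_tetrahedra : W32.ncard = 548 := by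
  exact W32Proof.W32_ncard
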